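/- Let A be a σ-unital C*-algebra. Assume that for every sequence (a_i) of pairwise orthogonal positive elements of A there exist m, n ∈ ℕ such that m·[a_i] is weakly (2m,n)-divisible in Cu(A) for every i. Then for every positive element T of the corona algebra M(A)/A there exists m ∈ ℕ with wdiv_{2m}(m·[T]) < ∞ in Cu(M(A)/A). In particular, M(A)/A is nowhere scattered. -/

import Mathlib

/-!
Common definitions: abstract Cuntz semigroups, divisibility, and C*-algebra notions
(nowhere scatteredness, σ-unitality, etc.) used to formalize the statements.
-/

open scoped MultiplierAlgebra ENNReal
open Filter Topology

noncomputable section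

universe uu vv

/-- The (sequential) way-below relation `x ≪ y` (compact containment) in a partially
ordered set: whenever an increasing sequence has a supremum lying above `y`, some term
of the sequence already lies above `x`. -/
def WayBelow {S : Type*} [PartialOrder S] (x y : S) : Prop :=
  ∀ f : ℕ → S, Monotone f → ∀ s : S, IsLUB (Set.range f) s → y ≤ s → ∃ n, x ≤ f n

/-- An abstract Cuntz semigroup (`Cu`-semigroup): a positively ordered abelian monoid in
which every increasing sequence has a supremum, every element is the supremum of a
`≪`-increasing sequence, addition preserves `≪`, and which satisfies the standard
axioms (O5) (almost algebraic order) and (O6) (almost Riesz decomposition), as well as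
the existence of infima with idempotents `∞y = sup_n n•y` (all of these hold in the
Cuntz semigroup of any C*-algebra). -/
class CuSemigroup (S : Type*) extends AddCommMonoid S, PartialOrder S where
  add_le_add' : ∀ a b : S, a ≤ b → ∀ c : S, c + a ≤ c + b
  zero_le' : ∀ x : S, 0 ≤ x
  exists_isLUB : ∀ f : ℕ → S, Monotone f → ∃ s : S, IsLUB (Set.range f) s
  exists_waybelow_seq : ∀ x : S, ∃ f : ℕ → S, Monotone f ∧
    (∀ n, WayBelow (f n) (f (n + 1))) ∧ IsLUB (Set.range f) x
  waybelow_add : ∀ {x y z w : S}, WayBelow x y → WayBelow z w → WayBelow (x + z) (y + w)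
  /-- axiom (O5) -/
  almost_algebraic : ∀ x' x y' y z : S, WayBelow x' x → WayBelow y' y → x + y ≤ z →
    ∃ c : S, y' ≤ c ∧ x' + c ≤ z ∧ z ≤ x + c
  /-- axiom (O6) -/
  almost_riesz : ∀ x' x y z : S, WayBelow x' x → x ≤ y + z →
    ∃ v w : S, v ≤ x ∧ v ≤ y ∧ w ≤ x ∧ w ≤ z ∧ x' ≤ v + w
  /-- `infty y = ∞·y = sup_n n•y` -/
  infty : S → S
  isLUB_infty : ∀ y : S, IsLUB (Set.range fun n : ℕ => n • y) (infty y)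
  /-- the infimum `x ⊓ ∞y`, which exists in the Cuntz semigroup of any C*-algebra -/
  meetInfty : S → S → S
  isGLB_meetInfty : ∀ x y : S, IsGLB {x, infty y} (meetInfty x y)

namespace CuDiv

variable {S : Type*} [CuSemigroup S]

/-- `x` is weakly `(m, n)`-divisible. -/
def IsWeaklyDivisible (m n : ℕ) (x : S) : Prop :=
  ∀ x' : S, WayBelow x' x → ∃ y : Fin n → S, x' ≤ ∑ j, y j ∧ ∀ j, m • y j ≤ x

/-- `x` is `(m, n)`-divisible. -/
def IsDivisible (m n : ℕ) (x : S) : Prop :=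
  ∀ x' : S, WayBelow x' x → ∃ y : S, x' ≤ n • y ∧ m • y ≤ x

/-- `x` is weakly `(m, ω)`-divisible. -/
def IsWeaklyOmegaDivisible (m : ℕ) (x : S) : Prop :=
  ∀ x' : S, WayBelow x' x → ∃ (n : ℕ) (y : Fin n → S), x' ≤ ∑ j, y j ∧ ∀ j, m • y j ≤ x

/-- `x` is `(m, ω)`-divisible. -/
def IsOmegaDivisible (m : ℕ) (x : S) : Prop :=
  ∀ x' : S, WayBelow x' x → ∃ (y : S) (n : ℕ), x' ≤ n • y ∧ m • y ≤ x

/-- `wdiv m x` is the least positive integer `n` such that `x` is weakly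
`(m,n)`-divisible, and `∞` if there is no such `n`. -/
def wdiv (m : ℕ) (x : S) : ℕ∞ :=
  sInf {N : ℕ∞ | ∃ n : ℕ, 1 ≤ n ∧ N = n ∧ IsWeaklyDivisible m n x}

/-- `Div m x` is the least positive integer `n` such that `x` is `(m,n)`-divisible,
and `∞` if there is no such `n`. -/
def Div (m : ℕ) (x : S) : ℕ∞ :=
  sInf {N : ℕ∞ | ∃ n : ℕ, 1 ≤ n ∧ N = n ∧ IsDivisible m n x}

/-- An element `x` is strongly soft if for every `x' ≪ x` there is `t` with
`x' + t ≤ x ≤ ∞t`. -/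
def StronglySoft (x : S) : Prop :=
  ∀ x' : S, WayBelow x' x → ∃ t : S, x' + t ≤ x ∧ x ≤ CuSemigroup.infty t

/-- The Cuntz semigroup characterization of the Global Glimm Property: every element is
`(m, ω)`-divisible for every `m`. -/
def GlobalGlimm (S : Type*) [CuSemigroup S] : Prop :=
  ∀ (m : ℕ) (x : S), IsOmegaDivisible m x

/-- `Cu(A)` is left-soft separative. -/
def LeftSoftSeparative (S : Type*) [CuSemigroup S] : Prop :=
  ∀ x y t : S, StronglySoft x → WayBelow (x + t) (y + t) →
    WayBelow t (CuSemigroup.infty y) → WayBelow t (CuSemigroup.infty x) → WayBelow x y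

/-- `Cu(A)` is weakly cancellative. -/
def WeaklyCancellative (S : Type*) [CuSemigroup S] : Prop :=
  ∀ x y z : S, WayBelow (x + z) (y + z) → WayBelow x y

/-- `Cu(A)` has covering dimension zero. -/
def CoveringDimZero (S : Type*) [CuSemigroup S] : Prop :=
  ∀ x' x y₁ y₂ : S, WayBelow x' x → WayBelow x (y₁ + y₂) →
    ∃ z₁ z₂ : S, z₁ ≤ y₁ ∧ z₂ ≤ y₂ ∧ x' ≤ z₁ + z₂ ∧ z₁ + z₂ ≤ x

end CuDiv

/-- A functional on a Cuntz semigroup: an additive, order preserving map to `ℝ≥0∞`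
preserving suprema of increasing sequences.  (By Elliott–Robert–Santiago, the
functionals on `Cu(A)` are exactly those induced by the lower semicontinuous
2-quasitraces on `A ⊗ K`.) -/
structure CuFunctional (S : Type*) [CuSemigroup S] where
  toFun : S → ℝ≥0∞
  map_zero' : toFun 0 = 0
  map_add' : ∀ x y : S, toFun (x + y) = toFun x + toFun y
  mono' : ∀ x y : S, x ≤ y → toFun x ≤ toFun y
  sup' : ∀ f : ℕ → S, Monotone f → ∀ s : S, IsLUB (Set.range f) s →
    toFun s = ⨆ n, toFun (f n)

instance {S : Type*} [CuSemigroup S] : CoeFun (CuFunctional S) fun _ => S → ℝ≥0∞ :=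
  ⟨CuFunctional.toFun⟩

namespace CuDiv

variable {S : Type*} [CuSemigroup S]

/-- `x <ₛ y` : there is `γ < 1` with `λ(x) ≤ γ·λ(y)` for every functional `λ`. -/
def FunctionalLT (x y : S) : Prop :=
  ∃ γ : ℝ≥0∞, γ < 1 ∧ ∀ lam : CuFunctional S, lam x ≤ γ * lam y

/-- `A` has `k`-comparison (stated on `Cu(A)`). -/
def KComparison (S : Type*) [CuSemigroup S] (k : ℕ) : Prop :=
  ∀ (x : S) (b : Fin (k + 1) → S), (∀ i, FunctionalLT x (b i)) → x ≤ ∑ i, b i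

/-- `A` has strict comparison (stated on `Cu(A)`, via functionals, which correspond to
the lower semicontinuous 2-quasitraces). -/
def StrictComparison (S : Type*) [CuSemigroup S] : Prop :=
  ∀ x y : S, FunctionalLT x y → x ≤ y

/-- The natural topology on the cone `F(Cu(A))` of functionals. -/
def functionalTopology (S : Type*) [CuSemigroup S] : TopologicalSpace (CuFunctional S) :=
  TopologicalSpace.generateFrom
    ({U | ∃ (x : S) (r : ℝ≥0∞), U = {lam : CuFunctional S | r < lam x}} ∪
      {U | ∃ (x' x : S) (r : ℝ≥0∞), WayBelow x' x ∧ U = {lam : CuFunctional S | lam x' < r}})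

/-- A lower semicontinuous affine function on the cone of functionals of `Cu(A)`,
i.e. an element of `L(F(Cu(A)))`. -/
def IsLscAffine (F : CuFunctional S → ℝ≥0∞) : Prop :=
  (letI := functionalTopology S; LowerSemicontinuous F) ∧
    (∀ lam mu nu : CuFunctional S, (∀ x, nu x = lam x + mu x) → F nu = F lam + F mu) ∧
    (∀ (r : ℝ≥0∞) (lam nu : CuFunctional S), (∀ x, nu x = r * lam x) → F nu = r * F lam)

/-- The rank map of `Cu(A)` is surjective: every lower semicontinuous affine function on
the cone of functionals is realized as the rank function `λ ↦ λ(x)` of an element. -/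
def SurjectiveRankMap (S : Type*) [CuSemigroup S] : Prop :=
  ∀ F : CuFunctional S → ℝ≥0∞, IsLscAffine F → ∃ y : S, ∀ lam : CuFunctional S, lam y = F lam

end CuDiv

/-! ### C*-algebra notions -/

section CStar

variable {B : Type*} [NonUnitalCStarAlgebra B]

/-- Positivity in a C*-algebra: `a` is positive iff it is of the form `star b * b`. -/
def CStarNonneg (a : B) : Prop := ∃ b : B, a = star b * b

/-- Cuntz subequivalence `a ≼ b` : `a = lim_n rₙ b rₙ*`. -/
def CuntzBelow (a b : B) : Prop :=
  ∃ r : ℕ → B, Tendsto (fun n => r n * b * star (r n)) atTop (𝓝 a)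

/-- Cuntz equivalence. -/
def CuntzEquiv (a b : B) : Prop := CuntzBelow a b ∧ CuntzBelow b a

/-- `A` is σ-unital: it has a countable (norm-bounded, positive) approximate unit. -/
def SigmaUnital (A : Type*) [NonUnitalCStarAlgebra A] : Prop :=
  ∃ e : ℕ → A, (∀ n, CStarNonneg (e n) ∧ ‖e n‖ ≤ 1) ∧
    ∀ a : A, Tendsto (fun n => e n * a) atTop (𝓝 a) ∧ Tendsto (fun n => a * e n) atTop (𝓝 a)

end CStar

/-- A closed two-sided (automatically star-closed) ideal of a C*-algebra. -/
structure ClosedTwoSidedIdealC (A : Type*) [NonUnitalCStarAlgebra A] where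
  carrier : NonUnitalStarSubalgebra ℂ A
  isClosed : IsClosed (carrier : Set A)
  mul_mem_left : ∀ a : A, ∀ x ∈ carrier, a * x ∈ carrier
  mul_mem_right : ∀ a : A, ∀ x ∈ carrier, x * a ∈ carrier

section Reps

variable {A : Type*} [NonUnitalCStarAlgebra A]
variable {H : Type*} [NormedAddCommGroup H] [InnerProductSpace ℂ H] [CompleteSpace H]

/-- A (topologically) irreducible representation of `A` on a Hilbert space `H`. -/
def IsIrreducibleRep (π : A →⋆ₙₐ[ℂ] (H →L[ℂ] H)) : Prop :=
  (∃ a : A, π a ≠ 0) ∧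
    ∀ K : Submodule ℂ H, IsClosed (K : Set H) → (∀ a : A, ∀ v ∈ K, π a v ∈ K) →
      K = ⊥ ∨ K = ⊤

end Reps

/-- `A` has a nonzero elementary ideal-quotient `J/I`, expressed via a surjection of a
closed two-sided ideal `J` of `A` onto the algebra of compact operators on a Hilbert
space (the kernel `I` of such a `*`-homomorphism is automatically a closed two-sided
ideal of `A`, and conversely any nonzero elementary ideal-quotient arises this way). -/
def HasNonzeroElementaryIdealQuotient (A : Type*) [NonUnitalCStarAlgebra A] : Prop :=
  ∃ (J : ClosedTwoSidedIdealC A) (H : Type) (_ : NormedAddCommGroup H)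
    (_ : InnerProductSpace ℂ H) (_ : CompleteSpace H)
    (ψ : J.carrier →⋆ₙₐ[ℂ] (H →L[ℂ] H)),
      Set.range ψ = {T : H →L[ℂ] H | IsCompactOperator ⇑T} ∧ ∃ x, ψ x ≠ 0

/-- A C*-algebra is nowhere scattered if no ideal-quotient of it is nonzero and
elementary. -/
def NowhereScattered (A : Type*) [NonUnitalCStarAlgebra A] : Prop :=
  ¬ HasNonzeroElementaryIdealQuotient A

/-- A C*-algebra is elementary if it is isomorphic to the algebra of compact operators
on some Hilbert space. -/
def IsElementaryCStar (A : Type*) [NonUnitalCStarAlgebra A] : Prop :=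
  ∃ (H : Type) (_ : NormedAddCommGroup H) (_ : InnerProductSpace ℂ H) (_ : CompleteSpace H)
    (ψ : A →⋆ₙₐ[ℂ] (H →L[ℂ] H)),
      Function.Injective ψ ∧ Set.range ψ = {T : H →L[ℂ] H | IsCompactOperator ⇑T}

/-- A C*-algebra is simple if it is nonzero and has no nontrivial closed two-sided
ideals. -/
def IsSimpleCStar (A : Type*) [NonUnitalCStarAlgebra A] : Prop :=
  (∃ a : A, a ≠ 0) ∧
    ∀ J : ClosedTwoSidedIdealC A, (J.carrier : Set A) = {0} ∨ (J.carrier : Set A) = Set.univ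

/-- Real rank zero: the invertible self-adjoint elements are dense in the self-adjoint
part of the minimal unitization. -/
def RealRankZero (A : Type*) [NonUnitalCStarAlgebra A] : Prop :=
  ∀ x : Unitization ℂ A, IsSelfAdjoint x →
    x ∈ closure {y : Unitization ℂ A | IsSelfAdjoint y ∧ IsUnit y}

/-- Stable rank one: the invertible elements are dense in the minimal unitization. -/
def StableRankOne (A : Type*) [NonUnitalCStarAlgebra A] : Prop :=
  ∀ x : Unitization ℂ A, x ∈ closure {y : Unitization ℂ A | IsUnit y}

section CP

variable {A B : Type*} [NonUnitalCStarAlgebra A] [NonUnitalCStarAlgebra B]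

/-- A linear map between C*-algebras is completely positive if all of its matrix
amplifications preserve positivity. -/
def IsCompletelyPositive (φ : A →ₗ[ℂ] B) : Prop :=
  ∀ (n : ℕ) (a : Matrix (Fin n) (Fin n) A), (∃ b : Matrix (Fin n) (Fin n) A, a = star b * b) →
    ∃ c : Matrix (Fin n) (Fin n) B, a.map ⇑φ = star c * c

/-- A completely positive contractive (c.p.c.) map. -/
def IsCPC (φ : A →ₗ[ℂ] B) : Prop :=
  IsCompletelyPositive φ ∧ ∀ a : A, ‖φ a‖ ≤ ‖a‖

/-- A map between C*-algebras has order zero if it preserves orthogonality of positive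
elements. -/
def IsOrderZero (φ : A →ₗ[ℂ] B) : Prop :=
  ∀ a b : A, CStarNonneg a → CStarNonneg b → a * b = 0 → φ a * φ b = 0

end CP

/-- `A` has nuclear dimension at most `k`: there are c.p.c. approximations of the
identity through finite dimensional C*-algebras in which the downwards maps are sums of
`k+1` c.p.c. order zero maps. -/
def NuclearDimLE (A : Type*) [NonUnitalCStarAlgebra A] (k : ℕ) : Prop :=
  ∀ (F : Finset A) (ε : ℝ), 0 < ε →
    ∃ (Fd : Type) (_ : NonUnitalCStarAlgebra Fd) (_ : FiniteDimensional ℂ Fd)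
      (ψ : A →ₗ[ℂ] Fd) (φ : Fin (k + 1) → (Fd →ₗ[ℂ] A)),
        IsCPC ψ ∧ (∀ i, IsCPC (φ i) ∧ IsOrderZero (φ i)) ∧
        ∀ a ∈ F, ‖(∑ i, φ i (ψ a)) - a‖ ≤ ε

section Prim

variable (A : Type*) [NonUnitalCStarAlgebra A]

/-- A primitive ideal: the kernel of an irreducible representation. -/
def IsPrimitiveIdeal {A : Type*} [NonUnitalCStarAlgebra A] (J : ClosedTwoSidedIdealC A) : Prop :=
  ∃ (H : Type) (_ : NormedAddCommGroup H) (_ : InnerProductSpace ℂ H) (_ : CompleteSpace H)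
    (π : A →⋆ₙₐ[ℂ] (H →L[ℂ] H)),
      IsIrreducibleRep π ∧ ∀ a : A, a ∈ J.carrier ↔ π a = 0

/-- The primitive ideal space of `A`. -/
def PrimIdealSpace := {J : ClosedTwoSidedIdealC A // IsPrimitiveIdeal J}

/-- The hull-kernel (Jacobson) topology on the primitive ideal space. -/
instance : TopologicalSpace (PrimIdealSpace A) :=
  TopologicalSpace.generateFrom {U | ∃ a : A, U = {P : PrimIdealSpace A | a ∉ P.1.carrier}}

/-- `A` has topological dimension zero: the primitive ideal space has a basis of
compact open sets. -/
def TopDimZero : Prop :=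
  ∃ 𝒷 : Set (Set (PrimIdealSpace A)), TopologicalSpace.IsTopologicalBasis 𝒷 ∧
    ∀ U ∈ 𝒷, IsCompact U ∧ IsOpen U

end Prim

section Proj

variable {B : Type*} [NonUnitalCStarAlgebra B]

/-- A projection in a C*-algebra. -/
def IsProjectionElem (p : B) : Prop := IsSelfAdjoint p ∧ p * p = p

/-- `B` contains an infinite projection: a projection which is Murray-von Neumann
equivalent to a proper subprojection of itself. -/
def HasInfiniteProjection (B : Type*) [NonUnitalCStarAlgebra B] : Prop :=
  ∃ p v : B, IsProjectionElem p ∧ star v * v = p ∧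
    p * (v * star v) = v * star v ∧ v * star v ≠ p

end Proj

/-! ### The Cuntz semigroup of a C*-algebra -/

/-- Padding a matrix by one extra row and column of zeros. -/
def matPad {A : Type*} [Zero A] {n : ℕ} (a : Matrix (Fin n) (Fin n) A) :
    Matrix (Fin (n + 1)) (Fin (n + 1)) A :=
  Matrix.of fun i j =>
    if h : (i : ℕ) < n ∧ (j : ℕ) < n then a ⟨i, h.1⟩ ⟨j, h.2⟩ else 0

/-- A witness that `S` is the Cuntz semigroup of the C*-algebra `A`: it provides a
stabilization `stab` of `A` (a model of `A ⊗ K`, described as the C*-completion of the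
union of the matrix algebras `Mₙ(A)`), together with the class map
`cls : (stab)₊ → S = Cu(A)` identifying `S` with the set of Cuntz equivalence classes of
positive elements of `A ⊗ K`, with order induced by Cuntz subequivalence, addition
induced by orthogonal (diagonal) addition, and with the compact containment relation
`≪` given by `x ≪ [a]` iff `x ≤ [(a - ε)₊]` for some `ε > 0`. -/
structure IsCuntzSemigroupOf (A : Type uu) [NonUnitalCStarAlgebra A]
    (S : Type vv) [CuSemigroup S] where
  stab : Type (max uu vv)
  [stabCStar : NonUnitalCStarAlgebra stab]
  matEmb : (n : ℕ) → (Matrix (Fin n) (Fin n) A →⋆ₙₐ[ℂ] stab)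
  matEmb_injective : ∀ n, Function.Injective (matEmb n)
  matEmb_compat : ∀ (n : ℕ) (a : Matrix (Fin n) (Fin n) A), matEmb (n + 1) (matPad a) = matEmb n a
  matEmb_dense : Dense (⋃ n, Set.range (matEmb n))
  cls : stab → S
  cls_zero : cls 0 = 0
  cls_surj : ∀ s : S, ∃ b : stab, CStarNonneg b ∧ cls b = s
  cls_le_iff : ∀ a b : stab, CStarNonneg a → CStarNonneg b → (cls a ≤ cls b ↔ CuntzBelow a b)
  cls_add_orth : ∀ a b : stab, CStarNonneg a → CStarNonneg b → a * b = 0 →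
    cls (a + b) = cls a + cls b
  exists_orth : ∀ a b : stab, CStarNonneg a → CStarNonneg b →
    ∃ a' b' : stab, CStarNonneg a' ∧ CStarNonneg b' ∧ a' * b' = 0 ∧
      cls a' = cls a ∧ cls b' = cls b
  waybelow_iff : ∀ (x : S) (a : stab), CStarNonneg a →
    (WayBelow x (cls a) ↔ ∃ ε : ℝ, 0 < ε ∧ x ≤ cls (cfcₙ (fun t : ℝ => max (t - ε) 0) a))

attribute [instance] IsCuntzSemigroupOf.stabCStar

/-- The Cuntz class `[a] ∈ Cu(A)` of an element `a` of `A` itself (via the canonical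
embedding `A ≅ M₁(A) ⊆ A ⊗ K`). -/
def IsCuntzSemigroupOf.clsA {A : Type*} [NonUnitalCStarAlgebra A] {S : Type*} [CuSemigroup S]
    (h : IsCuntzSemigroupOf A S) (a : A) : S :=
  h.cls (h.matEmb 1 (Matrix.of fun _ _ => a))

/-- `B` has a surjective rank map (every lower semicontinuous affine function on the
cone of functionals on `Cu(B)` is realized as a rank function). -/
def HasSurjectiveRankMap (B : Type*) [NonUnitalCStarAlgebra B] : Prop :=
  ∀ (S : Type) (inst : CuSemigroup S), IsCuntzSemigroupOf B S → CuDiv.SurjectiveRankMap S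

/-- The family of separable sub-C*-algebras of `A` having a surjective rank map. -/
def sepSurjRankFamily (A : Type*) [NonUnitalCStarAlgebra A] :
    Set (NonUnitalStarSubalgebra ℂ A) :=
  {B | ∃ _h : IsClosed (B : Set A),
    TopologicalSpace.SeparableSpace B ∧ HasSurjectiveRankMap B}

/-- The family of separable sub-C*-algebras of `A` with a surjective rank map is
σ-complete (closed under countable increasing unions) and cofinal (every separable
sub-C*-algebra is contained in a member). -/
def SepSurjRankFamilySigmaCompleteCofinal (A : Type*) [NonUnitalCStarAlgebra A] : Prop :=
  (∀ Bseq : ℕ → NonUnitalStarSubalgebra ℂ A, Monotone Bseq →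
    (∀ n, Bseq n ∈ sepSurjRankFamily A) →
      (⨆ n, Bseq n).topologicalClosure ∈ sepSurjRankFamily A) ∧
  (∀ C : NonUnitalStarSubalgebra ℂ A, IsClosed (C : Set A) →
    TopologicalSpace.SeparableSpace C → ∃ B ∈ sepSurjRankFamily A, C ≤ B)

end

namespace CuntzAux

section Calculus

variable {B : Type*} [NonUnitalCStarAlgebra B]

lemma nonneg_iff [PartialOrder B] [StarOrderedRing B] {a : B} : CStarNonneg a ↔ 0 ≤ a :=
  CStarAlgebra.nonneg_iff_eq_star_mul_self.symm

lemma nonneg_star_mul_self (a : B) : CStarNonneg (star a * a) := ⟨a, rfl⟩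

lemma nonneg_mul_star_self (a : B) : CStarNonneg (a * star a) := ⟨star a, by simp⟩

lemma nonneg_zero : CStarNonneg (0 : B) := ⟨0, by simp⟩

lemma nonneg_isSelfAdjoint {a : B} (ha : CStarNonneg a) : IsSelfAdjoint a := by
  obtain ⟨b, rfl⟩ := ha
  exact IsSelfAdjoint.star_mul_self b

lemma nonneg_star {a : B} (ha : CStarNonneg a) : star a = a := (nonneg_isSelfAdjoint ha).star_eq

lemma nonneg_conj {a : B} (ha : CStarNonneg a) (r : B) : CStarNonneg (r * a * star r) := by
  obtain ⟨b, rfl⟩ := ha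
  exact ⟨b * star r, by simp [mul_assoc]⟩

lemma nonneg_add {a b : B} (ha : CStarNonneg a) (hb : CStarNonneg b) : CStarNonneg (a + b) := by
  let _ := CStarAlgebra.spectralOrder B
  have _ := CStarAlgebra.spectralOrderedRing B
  rw [nonneg_iff] at *
  exact add_nonneg ha hb

lemma nonneg_sum {ι : Type*} (s : Finset ι) {a : ι → B} (ha : ∀ i ∈ s, CStarNonneg (a i)) :
    CStarNonneg (∑ i ∈ s, a i) := by
  classical
  induction s using Finset.induction_on with
  | empty => simpa using nonneg_zero
  | insert i s hi ih =>
    rw [Finset.sum_insert hi]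
    exact nonneg_add (ha i (by simp)) (ih fun j hj => ha j (by simp [hj]))

lemma norm_le_norm_add {a b : B} (ha : CStarNonneg a) (hb : CStarNonneg b) : ‖a‖ ≤ ‖a + b‖ := by
  let _ := CStarAlgebra.spectralOrder B
  have _ := CStarAlgebra.spectralOrderedRing B
  rw [nonneg_iff] at ha hb
  exact CStarAlgebra.norm_le_norm_of_nonneg_of_le ha (le_add_of_nonneg_right hb)

lemma quasispectrum_mem {a : B} (ha : CStarNonneg a) {t : ℝ} (ht : t ∈ quasispectrum ℝ a) :
    0 ≤ t ∧ t ≤ ‖a‖ := by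
  let _ := CStarAlgebra.spectralOrder B
  have _ := CStarAlgebra.spectralOrderedRing B
  have h0 := quasispectrum_nonneg_of_nonneg a (nonneg_iff.1 ha) t ht
  refine ⟨h0, ?_⟩
  have h1 : ‖cfcₙ (id : ℝ → ℝ) a‖ ≤ ‖a‖ := by
    rw [cfcₙ_id ℝ a (nonneg_isSelfAdjoint ha)]
  have h2 := (norm_cfcₙ_le_iff (id : ℝ → ℝ) a ‖a‖ continuousOn_id rfl
    (nonneg_isSelfAdjoint ha)).1 h1 t ht
  simpa [abs_of_nonneg h0] using h2

lemma fc_mul {f g : ℝ → ℝ} (hf : Continuous f) (hf0 : f 0 = 0) (hg : Continuous g) (hg0 : g 0 = 0)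
    (a : B) : cfcₙ f a * cfcₙ g a = cfcₙ (fun t => f t * g t) a :=
  (cfcₙ_mul f g a hf.continuousOn hf0 hg.continuousOn hg0).symm

lemma fc_sub {f g : ℝ → ℝ} (hf : Continuous f) (hf0 : f 0 = 0) (hg : Continuous g) (hg0 : g 0 = 0)
    (a : B) : cfcₙ f a - cfcₙ g a = cfcₙ (fun t => f t - g t) a :=
  (cfcₙ_sub f g a hf.continuousOn hf0 hg.continuousOn hg0).symm

lemma fc_norm_le {a : B} (ha : CStarNonneg a) {f : ℝ → ℝ} {c : ℝ}
    (h : ∀ t, 0 ≤ t → t ≤ ‖a‖ → |f t| ≤ c) : ‖cfcₙ f a‖ ≤ c :=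
  norm_cfcₙ_le fun t ht => h t (quasispectrum_mem ha ht).1 (quasispectrum_mem ha ht).2

lemma fc_congr {a : B} (ha : CStarNonneg a) {f g : ℝ → ℝ} (h : ∀ t, 0 ≤ t → f t = g t) :
    cfcₙ f a = cfcₙ g a :=
  cfcₙ_congr fun t ht => h t (quasispectrum_mem ha ht).1

lemma fc_nonneg {a : B} (ha : CStarNonneg a) {f : ℝ → ℝ} (h : ∀ t, 0 ≤ t → 0 ≤ f t) :
    CStarNonneg (cfcₙ f a) := by
  let _ := CStarAlgebra.spectralOrder B
  have _ := CStarAlgebra.spectralOrderedRing B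
  exact nonneg_iff.2 (cfcₙ_nonneg fun t ht => h t (quasispectrum_mem ha ht).1)

lemma fc_id {a : B} (ha : IsSelfAdjoint a) : cfcₙ (fun t : ℝ => t) a = a := cfcₙ_id' ℝ a ha

lemma fc_star (f : ℝ → ℝ) (a : B) : star (cfcₙ f a) = cfcₙ f a :=
  (IsSelfAdjoint.cfcₙ (f := f) (a := a)).star_eq

/-- The cut-down `(a - ε)₊`. -/
noncomputable def cut (ε : ℝ) (a : B) : B := cfcₙ (fun t : ℝ => max (t - ε) 0) a

/-- A bounded approximation of the constant function `1`, vanishing at `0`. -/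
noncomputable def ratio (δ t : ℝ) : ℝ := t / max t δ

/-- A function whose square times `t` is the square of `ratio`. -/
noncomputable def rootRatio (δ t : ℝ) : ℝ := √t / max t δ

lemma ratio_continuous {δ : ℝ} (hδ : 0 < δ) : Continuous (ratio δ) :=
  continuous_id.div (by fun_prop) fun t => (lt_max_of_lt_right hδ).ne'

lemma rootRatio_continuous {δ : ℝ} (hδ : 0 < δ) : Continuous (rootRatio δ) :=
  Real.continuous_sqrt.div (by fun_prop) fun t => (lt_max_of_lt_right hδ).ne'

@[simp] lemma ratio_zero (δ : ℝ) : ratio δ 0 = 0 := by simp [ratio]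

@[simp] lemma rootRatio_zero (δ : ℝ) : rootRatio δ 0 = 0 := by simp [rootRatio]

lemma ratio_nonneg {δ t : ℝ} (ht : 0 ≤ t) : 0 ≤ ratio δ t := by
  unfold ratio; positivity

lemma ratio_le_one {δ t : ℝ} (hδ : 0 < δ) : ratio δ t ≤ 1 :=
  div_le_one_of_le₀ (le_max_left _ _) (hδ.le.trans (le_max_right _ _))

lemma ratio_eq_one {δ t : ℝ} (hδ : 0 < δ) (h : δ ≤ t) : ratio δ t = 1 := by
  rw [ratio, max_eq_left h, div_self (hδ.trans_le h).ne']

lemma rootRatio_sq {δ t : ℝ} (ht : 0 ≤ t) : rootRatio δ t * t * rootRatio δ t = ratio δ t ^ 2 := by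
  unfold rootRatio ratio
  rw [div_mul_eq_mul_div, div_mul_div_comm, div_pow, mul_assoc, mul_comm t, ← mul_assoc,
    Real.mul_self_sqrt ht]
  ring

lemma cut_continuous (ε : ℝ) : Continuous fun t : ℝ => max (t - ε) 0 := by fun_prop

lemma cut_zero_at {ε : ℝ} (hε : 0 ≤ ε) : max ((0 : ℝ) - ε) 0 = 0 := by simp [hε]

lemma cut_nonneg {a : B} (ha : CStarNonneg a) (ε : ℝ) : CStarNonneg (cut ε a) :=
  fc_nonneg ha fun _ _ => le_max_right _ _

lemma norm_sub_cut_le {a : B} (ha : CStarNonneg a) {ε : ℝ} (hε : 0 ≤ ε) : ‖a - cut ε a‖ ≤ ε := by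
  conv_lhs => rw [← fc_id (nonneg_isSelfAdjoint ha)]
  rw [cut, fc_id (nonneg_isSelfAdjoint ha)]
  nth_rw 1 [← fc_id (nonneg_isSelfAdjoint ha)]
  rw [fc_sub continuous_id' rfl (cut_continuous ε) (cut_zero_at hε)]
  refine fc_norm_le ha fun t h0 _ => ?_
  rw [abs_le]
  rcases le_total (t - ε) 0 with h | h
  · rw [max_eq_right h]; constructor <;> linarith
  · rw [max_eq_left h]; constructor <;> linarith

lemma cut_cut {a : B} (ha : CStarNonneg a) {ε δ : ℝ} (hε : 0 ≤ ε) (hδ : 0 ≤ δ) :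
    cut δ (cut ε a) = cut (ε + δ) a := by
  rw [cut, cut, ← cfcₙ_comp (fun t : ℝ => max (t - δ) 0) (fun t : ℝ => max (t - ε) 0) a
    (cut_continuous δ).continuousOn (cut_zero_at hδ) (cut_continuous ε).continuousOn
    (cut_zero_at hε) (nonneg_isSelfAdjoint ha)]
  refine fc_congr ha fun t _ => ?_
  simp only [Function.comp]
  rcases le_total (t - ε) 0 with h | h
  · rw [max_eq_right h, max_eq_right (by linarith), max_eq_right (by linarith)]
  · rw [max_eq_left h]; congr 1; ring

lemma map_fc {C : Type*} [NonUnitalCStarAlgebra C] (φ : B →⋆ₙₐ[ℂ] C) {f : ℝ → ℝ}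
    (hf : Continuous f) (hf0 : f 0 = 0) {a : B} (ha : IsSelfAdjoint a) :
    φ (cfcₙ f a) = cfcₙ f (φ a) :=
  open CStarAlgebra in NonUnitalStarAlgHomClass.map_cfcₙ (S := ℂ) φ f a hf.continuousOn hf0
    (map_continuous φ) ha (ha.map φ)

lemma map_cut {C : Type*} [NonUnitalCStarAlgebra C] (φ : B →⋆ₙₐ[ℂ] C) {ε : ℝ} (hε : 0 ≤ ε)
    {a : B} (ha : IsSelfAdjoint a) : φ (cut ε a) = cut ε (φ a) :=
  map_fc φ (cut_continuous ε) (cut_zero_at hε) ha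

lemma map_nonneg {C : Type*} [NonUnitalCStarAlgebra C] (φ : B →⋆ₙₐ[ℂ] C) {a : B}
    (ha : CStarNonneg a) : CStarNonneg (φ a) := by
  obtain ⟨b, rfl⟩ := ha
  exact ⟨φ b, by simp [map_star]⟩

/-- If `y* y` is dominated by `b`, then `y` is almost fixed by `ratio δ b`. -/
lemma norm_sub_mul_ratio_sq_le {b : B} (hb : CStarNonneg b) {y z : B}
    (h : b = star y * y + star z * z) {δ : ℝ} (hδ : 0 < δ) :
    ‖y - y * cfcₙ (ratio δ) b‖ ^ 2 ≤ δ := by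
  set g := cfcₙ (ratio δ) b with hg
  have hgs : star g = g := fc_star _ _
  have key : star (y - y * g) * (y - y * g) + star (z - z * g) * (z - z * g) =
      b - g * b - (b * g - g * b * g) := by
    rw [h]; simp only [star_sub, star_mul, hgs]; noncomm_ring
  have hbid := fc_id (nonneg_isSelfAdjoint hb)
  have e1 : g * b = cfcₙ (fun t => ratio δ t * t) b := by
    nth_rw 1 [← hbid]
    exact fc_mul (ratio_continuous hδ) (by simp) continuous_id' rfl b
  have e2 : b * g = cfcₙ (fun t => t * ratio δ t) b := by
    nth_rw 1 [← hbid]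
    exact fc_mul continuous_id' rfl (ratio_continuous hδ) (by simp) b
  have e3 : g * b * g = cfcₙ (fun t => ratio δ t * t * ratio δ t) b := by
    rw [e1]
    exact fc_mul ((ratio_continuous hδ).mul continuous_id') (by simp) (ratio_continuous hδ)
      (by simp) b
  have hc := ratio_continuous hδ
  have e4 : b - g * b - (b * g - g * b * g) =
      cfcₙ (fun t => t - ratio δ t * t - (t * ratio δ t - ratio δ t * t * ratio δ t)) b := by
    rw [e3, e2, e1]
    nth_rw 1 [← hbid]
    rw [fc_sub (by fun_prop) (by simp) (by fun_prop) (by simp),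
      fc_sub (by fun_prop) (by simp) (by fun_prop) (by simp),
      fc_sub (by fun_prop) (by simp) (by fun_prop) (by simp)]
  have h1 : ‖y - y * g‖ ^ 2 = ‖star (y - y * g) * (y - y * g)‖ := by
    rw [CStarRing.norm_star_mul_self, sq]
  rw [h1]
  refine (norm_le_norm_add (nonneg_star_mul_self _) (nonneg_star_mul_self (z - z * g))).trans ?_
  rw [key, e4]
  refine fc_norm_le hb fun t h0 _ => ?_
  have : t - ratio δ t * t - (t * ratio δ t - ratio δ t * t * ratio δ t) =
      t * (1 - ratio δ t) ^ 2 := by ring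
  rw [this]
  have r1 := ratio_le_one (t := t) hδ
  have r0 := ratio_nonneg (δ := δ) h0
  rw [abs_of_nonneg (by positivity)]
  rcases le_total δ t with h | h
  · simp [ratio_eq_one hδ h, hδ.le]
  · calc t * (1 - ratio δ t) ^ 2 ≤ t * 1 := by
          gcongr; exact pow_le_one₀ (by linarith) (by linarith)
      _ ≤ δ := by linarith

/-- The square root of a positive element. -/
noncomputable def root (a : B) : B := cfcₙ (fun t : ℝ => √t) a

lemma root_star (a : B) : star (root a) = root a := fc_star _ _

lemma root_mul_root {a : B} (ha : CStarNonneg a) : root a * root a = a := by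
  rw [root, fc_mul Real.continuous_sqrt (by simp) Real.continuous_sqrt (by simp)]
  conv_rhs => rw [← fc_id (nonneg_isSelfAdjoint ha)]
  exact fc_congr ha fun t ht => Real.mul_self_sqrt ht

end Calculus

section Comparison

variable {B : Type*} [NonUnitalCStarAlgebra B]

lemma cuntzBelow_iff {a b : B} :
    CuntzBelow a b ↔ ∀ η : ℝ, 0 < η → ∃ r : B, ‖r * b * star r - a‖ < η := by
  constructor
  · rintro ⟨r, hr⟩ η hη
    obtain ⟨n, hn⟩ := ((Metric.tendsto_nhds.1 hr) η hη).exists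
    exact ⟨r n, by rwa [dist_eq_norm] at hn⟩
  · intro h
    choose r hr using fun n : ℕ => h (1 / ((n : ℝ) + 1)) (by positivity)
    refine ⟨r, tendsto_iff_norm_sub_tendsto_zero.2 ?_⟩
    exact squeeze_zero (fun _ => norm_nonneg _) (fun n => (hr n).le)
      tendsto_one_div_add_atTop_nhds_zero_nat

lemma cuntzBelow_conj (r b : B) : CuntzBelow (r * b * star r) b :=
  ⟨fun _ => r, tendsto_const_nhds⟩

lemma norm_conj_le (r b : B) : ‖r * b * star r‖ ≤ ‖r‖ ^ 2 * ‖b‖ := by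
  calc ‖r * b * star r‖ ≤ ‖r‖ * ‖b‖ * ‖star r‖ :=
        (norm_mul_le _ _).trans (by gcongr; exact norm_mul_le _ _)
    _ = ‖r‖ ^ 2 * ‖b‖ := by rw [norm_star]; ring

lemma cuntzBelow_trans {a b c : B} (hab : CuntzBelow a b) (hbc : CuntzBelow b c) :
    CuntzBelow a c := by
  rw [cuntzBelow_iff] at *
  intro η hη
  obtain ⟨r, hr⟩ := hab (η / 2) (by positivity)
  obtain ⟨s, hs⟩ := hbc (η / (2 * (‖r‖ ^ 2 + 1))) (by positivity)
  refine ⟨r * s, ?_⟩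
  have e : r * s * c * star (r * s) - a =
      r * (s * c * star s - b) * star r + (r * b * star r - a) := by
    rw [star_mul]; noncomm_ring
  rw [e]
  have h1 : ‖r * (s * c * star s - b) * star r‖ ≤ η / 2 := by
    refine (norm_conj_le _ _).trans ?_
    calc ‖r‖ ^ 2 * ‖s * c * star s - b‖
        ≤ (‖r‖ ^ 2 + 1) * (η / (2 * (‖r‖ ^ 2 + 1))) := by gcongr; linarith
      _ = η / 2 := by field_simp
  linarith [norm_add_le (r * (s * c * star s - b) * star r) (r * b * star r - a)]

lemma cuntzBelow_fc {a : B} (ha : CStarNonneg a) {f h : ℝ → ℝ} (hf : Continuous f) (hf0 : f 0 = 0)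
    (hh : Continuous h) (hh0 : h 0 = 0)
    (H : ∀ δ : ℝ, 0 < δ → ∃ k : ℝ → ℝ, Continuous k ∧ k 0 = 0 ∧
      ∀ t, 0 ≤ t → t ≤ ‖a‖ → |k t * h t * k t - f t| ≤ δ) :
    CuntzBelow (cfcₙ f a) (cfcₙ h a) := by
  rw [cuntzBelow_iff]
  intro η hη
  obtain ⟨k, hk, hk0, hkt⟩ := H (η / 2) (by positivity)
  refine ⟨cfcₙ k a, ?_⟩
  rw [fc_star, fc_mul hk hk0 hh hh0, fc_mul (by fun_prop) (by simp [hk0]) hk hk0,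
    fc_sub (by fun_prop) (by simp [hk0]) hf hf0]
  exact (fc_norm_le ha hkt).trans_lt (by linarith)

lemma abs_pow_mul_sub_le {δ t : ℝ} (hδ : 0 < δ) (ht : 0 ≤ t) (n : ℕ) :
    |t * ratio δ t ^ n - t| ≤ δ := by
  have h0 := ratio_nonneg (δ := δ) ht
  have h1 := pow_le_one₀ (n := n) h0 (ratio_le_one hδ)
  have h2 := pow_nonneg h0 n
  rcases le_total δ t with h | h
  · simp [ratio_eq_one hδ h, hδ.le]
  · rw [abs_le]; constructor <;> nlinarith

lemma cuntzBelow_refl {a : B} (ha : CStarNonneg a) : CuntzBelow a a := by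
  have := cuntzBelow_fc ha (f := fun t => t) (h := fun t => t) continuous_id' rfl continuous_id' rfl
    fun δ hδ => ⟨ratio δ, ratio_continuous hδ, by simp, fun t ht _ => by
      have := abs_pow_mul_sub_le hδ ht 2
      convert this using 2; ring⟩
  rwa [fc_id (nonneg_isSelfAdjoint ha)] at this

lemma fc_sq {a : B} (ha : IsSelfAdjoint a) : cfcₙ (fun t : ℝ => t * t) a = a * a := by
  conv_rhs => rw [← fc_id ha]
  exact (fc_mul continuous_id' rfl continuous_id' rfl a).symm

lemma fc_cube {a : B} (ha : IsSelfAdjoint a) : cfcₙ (fun t : ℝ => t * t * t) a = a * a * a := by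
  rw [← fc_sq ha]
  nth_rw 3 [← fc_id ha]
  exact (fc_mul (f := fun t : ℝ => t * t) (by fun_prop) (by simp) continuous_id' rfl a).symm

lemma cuntzBelow_sq {a : B} (ha : CStarNonneg a) : CuntzBelow a (a * a) := by
  have := cuntzBelow_fc ha (f := fun t => t) (h := fun t => t * t) continuous_id' rfl
    (by fun_prop) (by simp)
    fun δ hδ => ⟨rootRatio δ, rootRatio_continuous hδ, by simp, fun t ht _ => by
      have := abs_pow_mul_sub_le hδ ht 2
      rw [← rootRatio_sq ht] at this
      convert this using 2; ring⟩
  rwa [fc_id (nonneg_isSelfAdjoint ha), fc_sq (nonneg_isSelfAdjoint ha)] at this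

lemma cuntzBelow_cube {a : B} (ha : CStarNonneg a) : CuntzBelow a (a * a * a) := by
  have := cuntzBelow_fc ha (f := fun t => t) (h := fun t => t * t * t) continuous_id' rfl
    (by fun_prop) (by simp)
    fun δ hδ => ⟨fun t => ratio δ t / max t δ, (ratio_continuous hδ).div (by fun_prop)
      fun t => (lt_max_of_lt_right hδ).ne', by simp, fun t ht _ => by
      have := abs_pow_mul_sub_le hδ ht 4
      convert this using 2
      have : max t δ ≠ 0 := (lt_max_of_lt_right hδ).ne'
      unfold ratio
      field_simp⟩
  rwa [fc_id (nonneg_isSelfAdjoint ha), fc_cube (nonneg_isSelfAdjoint ha)] at this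

lemma cuntzBelow_star_swap (x : B) : CuntzBelow (x * star x) (star x * x) := by
  refine cuntzBelow_trans (cuntzBelow_sq (nonneg_mul_star_self x)) ?_
  have := cuntzBelow_conj x (star x * x)
  rwa [show x * (star x * x) * star x = x * star x * (x * star x) by noncomm_ring] at this

/-- Comparison of positive elements ordered by `≤`. -/
lemma cuntzBelow_of_add {a c : B} (ha : CStarNonneg a) (hc : CStarNonneg c) :
    CuntzBelow a (a + c) := by
  rw [cuntzBelow_iff]
  intro η hη
  set y := root a
  set z := root c
  have hy : star y * y = a := by rw [root_star, root_mul_root ha]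
  have hz : star z * z = c := by rw [root_star, root_mul_root hc]
  have hb := nonneg_add ha hc
  set M := 2 * ‖y‖ + 1
  have hM : 0 < M := by positivity
  set δ := (η / (2 * M)) ^ 2
  have hδ : 0 < δ := by positivity
  refine ⟨y * cfcₙ (rootRatio δ) (a + c), ?_⟩
  set g := cfcₙ (ratio δ) (a + c) with hg
  have hgs : star g = g := fc_star _ _
  have h1 := norm_sub_mul_ratio_sq_le hb (y := y) (z := z) (by rw [hy, hz]) hδ
  have h2 : ‖y - y * g‖ ≤ η / (2 * M) := by
    have : ‖y - y * g‖ ^ 2 ≤ (η / (2 * M)) ^ 2 := h1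
    exact (pow_le_pow_iff_left₀ (norm_nonneg _) (by positivity) two_ne_zero).1 this
  have hk : cfcₙ (rootRatio δ) (a + c) * (a + c) * cfcₙ (rootRatio δ) (a + c) = g * g := by
    have hr := rootRatio_continuous hδ
    have hr' := ratio_continuous hδ
    nth_rw 2 [← fc_id (nonneg_isSelfAdjoint hb)]
    rw [fc_mul hr (by simp) continuous_id' rfl, fc_mul (by fun_prop) (by simp) hr (by simp), hg,
      fc_mul hr' (by simp) hr' (by simp)]
    exact fc_congr hb fun t ht => by rw [rootRatio_sq ht, sq]
  have e : y * cfcₙ (rootRatio δ) (a + c) * (a + c) * star (y * cfcₙ (rootRatio δ) (a + c)) - a =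
      (y * g - y) * star (y * g) + y * star (y * g - y) := by
    have hy' : star y = y := root_star a
    rw [star_mul, fc_star]
    calc _ = y * (cfcₙ (rootRatio δ) (a + c) * (a + c) * cfcₙ (rootRatio δ) (a + c)) * star y
          - a := by noncomm_ring
      _ = _ := by
        rw [hk, ← hy]; simp only [star_mul, star_sub, hy', hgs]; noncomm_ring
  rw [e]
  have hg1 : ‖g‖ ≤ 1 := fc_norm_le hb fun t h0 _ => by
    rw [abs_of_nonneg (ratio_nonneg h0)]; exact ratio_le_one hδ
  have h3 : ‖y * g - y‖ ≤ η / (2 * M) := by rwa [norm_sub_rev]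
  have h4 : ‖y * g‖ ≤ ‖y‖ := (norm_mul_le _ _).trans (by nlinarith [norm_nonneg y])
  calc ‖(y * g - y) * star (y * g) + y * star (y * g - y)‖
      ≤ ‖(y * g - y)‖ * ‖star (y * g)‖ + ‖y‖ * ‖star (y * g - y)‖ :=
        (norm_add_le _ _).trans (add_le_add (norm_mul_le _ _) (norm_mul_le _ _))
    _ ≤ η / (2 * M) * ‖y‖ + ‖y‖ * (η / (2 * M)) := by
        rw [norm_star, norm_star]; gcongr
    _ = (2 * ‖y‖) / M * (η / 2) := by field_simp; ring
    _ ≤ 1 * (η / 2) := by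
        gcongr; rw [div_le_one hM]; simp only [M]; linarith
    _ < η := by linarith

/-- A perturbation lemma of Rørdam type. -/
lemma cut_cuntzBelow {a c : B} (ha : CStarNonneg a) (hc : CStarNonneg c) {ε : ℝ}
    (h : ‖a - c‖ < ε) : CuntzBelow (cut ε a) c := by
  let _ := CStarAlgebra.spectralOrder B
  have _ := CStarAlgebra.spectralOrderedRing B
  set ε' := ‖a - c‖ with hε'
  have hε0 : 0 < ε := (norm_nonneg _).trans_lt h
  have h0' : 0 ≤ ε' := norm_nonneg _
  have hd : ∀ t : ℝ, 0 < max (t - ε') (ε - ε') := fun t => lt_max_of_lt_right (by linarith)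
  set k : ℝ → ℝ := fun t => √(max (t - ε) 0 / max (t - ε') (ε - ε')) with hk
  have hkc : Continuous k :=
    Real.continuous_sqrt.comp ((cut_continuous ε).div (by fun_prop) fun t => (hd t).ne')
  have hk0 : k 0 = 0 := by simp [hk, hε0.le]
  have hkk : ∀ t, k t * k t = max (t - ε) 0 / max (t - ε') (ε - ε') := fun t =>
    Real.mul_self_sqrt (div_nonneg (le_max_right _ _) (hd t).le)
  have hkt : ∀ t, k t * t * k t - ε' * (k t * k t) = max (t - ε) 0 := by
    intro t
    rw [mul_right_comm, hkk]
    rcases le_total t ε with h1 | h1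
    · rw [max_eq_right (by linarith : t - ε ≤ 0)]; simp
    · have := hd t
      rw [max_eq_left (by linarith : ε - ε' ≤ t - ε')] at this ⊢
      field_simp
  set e := cfcₙ k a with he
  have hes : star e = e := fc_star _ _
  have hcut : cut ε a = e * a * e - ε' • (e * e) := by
    have hid := fc_id (nonneg_isSelfAdjoint ha)
    have e1 : e * a * e = cfcₙ (fun t => k t * t * k t) a := by
      nth_rw 1 [← hid]
      rw [he, fc_mul hkc hk0 continuous_id' rfl, fc_mul (by fun_prop) (by simp) hkc hk0]
    have e2 : ε' • (e * e) = cfcₙ (fun t => ε' * (k t * k t)) a := by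
      rw [he, fc_mul hkc hk0 hkc hk0,
        ← cfcₙ_smul ε' (fun t => k t * k t) a (by fun_prop) (by simp [hk0])]
      rfl
    rw [e1, e2, fc_sub (by fun_prop) (by simp [hk0]) (by fun_prop) (by simp [hk0])]
    exact fc_congr ha fun t _ => (hkt t).symm
  have hsa : IsSelfAdjoint (a - c) := (nonneg_isSelfAdjoint ha).sub (nonneg_isSelfAdjoint hc)
  have hle : ((a - c : B) : Unitization ℂ B) ≤ algebraMap ℝ _ ε' := by
    have := IsSelfAdjoint.le_algebraMap_norm_self (a := ((a - c : B) : Unitization ℂ B))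
      (hsa.inr ℂ)
    rwa [Unitization.norm_inr (𝕜 := ℂ)] at this
  have hpos : CStarNonneg (e * c * e - cut ε a) := by
    rw [nonneg_iff, ← Unitization.inr_nonneg_iff]
    have h2 := star_left_conjugate_nonneg (sub_nonneg.2 hle) (e : Unitization ℂ B)
    convert h2 using 1
    rw [hcut, ← Unitization.inr_star, hes, Algebra.algebraMap_eq_smul_one]
    simp only [Unitization.inr_sub, Unitization.inr_mul, mul_sub, sub_mul, mul_smul_comm,
      smul_mul_assoc, mul_one]
    rw [Unitization.inr_smul, Unitization.inr_mul]
    abel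
  have h3 := cuntzBelow_of_add (cut_nonneg ha ε) hpos
  rw [add_sub_cancel] at h3
  refine cuntzBelow_trans h3 ?_
  have := cuntzBelow_conj e c
  rwa [hes] at this

/-- A positive element which is a limit of elements below `b` is below `b`. -/
lemma cuntzBelow_of_approx {a b : B} (H : ∀ η : ℝ, 0 < η → ∃ c, ‖a - c‖ < η ∧ CuntzBelow c b) :
    CuntzBelow a b := by
  rw [cuntzBelow_iff]
  intro η hη
  obtain ⟨c, hc, hcb⟩ := H (η / 2) (by positivity)
  obtain ⟨r, hr⟩ := cuntzBelow_iff.1 hcb (η / 2) (by positivity)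
  refine ⟨r, ?_⟩
  have := norm_sub_le_norm_sub_add_norm_sub (r * b * star r) c a
  rw [norm_sub_rev c a] at this
  linarith

end Comparison

instance {S : Type*} [CuSemigroup S] : IsOrderedAddMonoid S where
  add_le_add_left a b h c := by
    rw [add_comm a c, add_comm b c]
    exact CuSemigroup.add_le_add' a b h c

section Semigroup

universe u v
variable {A : Type u} [NonUnitalCStarAlgebra A] {S : Type v} [CuSemigroup S]
  (h : IsCuntzSemigroupOf A S)

lemma cls_le_of_cuntzBelow {a b : h.stab} (ha : CStarNonneg a) (hb : CStarNonneg b)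
    (hab : CuntzBelow a b) : h.cls a ≤ h.cls b := (h.cls_le_iff a b ha hb).2 hab

/-- Orthogonal representatives of two classes, with multipliers that vanish on the other one. -/
lemma exists_orth_pair {a b : h.stab} (ha : CStarNonneg a) (hb : CStarNonneg b) :
    ∃ c : h.stab, CStarNonneg c ∧ h.cls c = h.cls a + h.cls b ∧
      (∀ η : ℝ, 0 < η → ∃ u w : h.stab, ‖u * c * star u - a‖ < η ∧ ‖w * c * star w - b‖ < η ∧
        u * c * star w = 0 ∧ w * c * star u = 0) ∧
      (∀ η : ℝ, 0 < η → ∃ u w : h.stab, ‖c - (u * a * star u + w * b * star w)‖ < η) := by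
  obtain ⟨a', b', ha', hb', hab, hca, hcb⟩ := h.exists_orth a b ha hb
  have hba : b' * a' = 0 := by
    have := congrArg star hab
    rwa [star_mul, nonneg_star ha', nonneg_star hb', star_zero] at this
  refine ⟨a' + b', nonneg_add ha' hb', by rw [h.cls_add_orth a' b' ha' hb' hab, hca, hcb], ?_, ?_⟩
  · intro η hη
    have h1 := cuntzBelow_trans ((h.cls_le_iff a a' ha ha').1 hca.ge) (cuntzBelow_cube ha')
    have h2 := cuntzBelow_trans ((h.cls_le_iff b b' hb hb').1 hcb.ge) (cuntzBelow_cube hb')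
    obtain ⟨r, hr⟩ := cuntzBelow_iff.1 h1 η hη
    obtain ⟨s, hs⟩ := cuntzBelow_iff.1 h2 η hη
    refine ⟨r * a', s * b', ?_, ?_, ?_, ?_⟩
    · convert hr using 3
      rw [star_mul, nonneg_star ha', mul_add, mul_assoc r a' b', hab]
      noncomm_ring
    · convert hs using 3
      rw [star_mul, nonneg_star hb', mul_add, mul_assoc s b' a', hba]
      noncomm_ring
    · rw [star_mul, nonneg_star hb', mul_add, mul_assoc r a' b', hab, mul_zero, add_zero]
      rw [mul_assoc, mul_assoc, ← mul_assoc a' b', hab]; simp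
    · rw [star_mul, nonneg_star ha', mul_add, mul_assoc s b' a', hba, mul_zero, zero_add]
      simp [mul_assoc, ← mul_assoc b' a', hba]
  · intro η hη
    have h1 := (h.cls_le_iff a' a ha' ha).1 hca.le
    have h2 := (h.cls_le_iff b' b hb' hb).1 hcb.le
    obtain ⟨r, hr⟩ := cuntzBelow_iff.1 h1 (η / 2) (by positivity)
    obtain ⟨s, hs⟩ := cuntzBelow_iff.1 h2 (η / 2) (by positivity)
    refine ⟨r, s, ?_⟩
    have e : a' + b' - (r * a * star r + s * b * star s) =
        -(r * a * star r - a') - (s * b * star s - b') := by abel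
    rw [e]
    refine (norm_sub_le _ _).trans_lt ?_
    rw [norm_neg]; linarith

lemma cls_add_le {a b : h.stab} (ha : CStarNonneg a) (hb : CStarNonneg b) :
    h.cls (a + b) ≤ h.cls a + h.cls b := by
  obtain ⟨c, hc, hcls, H, -⟩ := exists_orth_pair h ha hb
  rw [← hcls]
  refine cls_le_of_cuntzBelow h (nonneg_add ha hb) hc (cuntzBelow_iff.2 fun η hη => ?_)
  obtain ⟨u, w, h1, h2, h3, h4⟩ := H (η / 2) (by positivity)
  refine ⟨u + w, ?_⟩
  have e : (u + w) * c * star (u + w) - (a + b) =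
      (u * c * star u - a) + (w * c * star w - b) + u * c * star w + w * c * star u := by
    rw [star_add]; noncomm_ring
  rw [e, h3, h4, add_zero, add_zero]
  exact (norm_add_le _ _).trans_lt (by linarith)

lemma cls_sum_le {ι : Type*} (s : Finset ι) (a : ι → h.stab) (ha : ∀ i ∈ s, CStarNonneg (a i)) :
    h.cls (∑ i ∈ s, a i) ≤ ∑ i ∈ s, h.cls (a i) := by
  classical
  induction s using Finset.induction_on with
  | empty => simp [h.cls_zero]
  | insert i s hi ih =>
    rw [Finset.sum_insert hi, Finset.sum_insert hi]
    refine (cls_add_le h (ha i (by simp))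
      (nonneg_sum s fun j hj => ha j (by simp [hj]))).trans ?_
    gcongr
    exact ih fun j hj => ha j (by simp [hj])

lemma cls_conj_le {b : h.stab} (hb : CStarNonneg b) (r : h.stab) :
    h.cls (r * b * star r) ≤ h.cls b :=
  cls_le_of_cuntzBelow h (nonneg_conj hb r) hb (cuntzBelow_conj r b)

lemma cls_le_of_cut {a : h.stab} (ha : CStarNonneg a) {z : S}
    (H : ∀ η : ℝ, 0 < η → h.cls (cut η a) ≤ z) : h.cls a ≤ z := by
  obtain ⟨c, hc, rfl⟩ := h.cls_surj z
  refine cls_le_of_cuntzBelow h ha hc (cuntzBelow_of_approx fun η hη => ⟨cut (η / 2) a, ?_, ?_⟩)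
  · exact (norm_sub_cut_le ha (by positivity)).trans_lt (by linarith)
  · exact (h.cls_le_iff _ _ (cut_nonneg ha _) hc).1 (H _ (by positivity))

lemma cls_cut_waybelow {b : h.stab} (hb : CStarNonneg b) {ε : ℝ} (hε : 0 < ε) :
    WayBelow (h.cls (cut ε b)) (h.cls b) :=
  (h.waybelow_iff _ b hb).2 ⟨ε, hε, le_rfl⟩

lemma exists_cut_of_waybelow {b : h.stab} (hb : CStarNonneg b) {x : S}
    (hx : WayBelow x (h.cls b)) : ∃ ε : ℝ, 0 < ε ∧ x ≤ h.cls (cut ε b) :=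
  (h.waybelow_iff _ b hb).1 hx

lemma cls_cut_le_sum {ι : Type*} [Fintype ι] {a : h.stab} (ha : CStarNonneg a) {b : ι → h.stab}
    (hb : ∀ i, CStarNonneg (b i)) {ε : ℝ} (t : ι → h.stab)
    (ht : ‖a - ∑ j, t j * b j * star (t j)‖ < ε) : h.cls (cut ε a) ≤ ∑ j, h.cls (b j) := by
  have hp := nonneg_sum Finset.univ (a := fun j => t j * b j * star (t j))
    fun j _ => nonneg_conj (hb j) (t j)
  refine (cls_le_of_cuntzBelow h (cut_nonneg ha _) hp (cut_cuntzBelow ha hp ht)).trans ?_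
  exact (cls_sum_le h _ _ fun j _ => nonneg_conj (hb j) (t j)).trans
    (Finset.sum_le_sum fun j _ => cls_conj_le h (hb j) (t j))

lemma cls_le_sum_of_approx {ι : Type*} [Fintype ι] {a : h.stab} (ha : CStarNonneg a)
    {b : ι → h.stab} (hb : ∀ i, CStarNonneg (b i))
    (H : ∀ η : ℝ, 0 < η → ∃ t : ι → h.stab, ‖a - ∑ j, t j * b j * star (t j)‖ < η) :
    h.cls a ≤ ∑ j, h.cls (b j) :=
  cls_le_of_cut h ha fun η hη => by
    obtain ⟨t, ht⟩ := H η hη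
    exact cls_cut_le_sum h ha hb t ht

/-- A representative of a finite sum of classes, with compressions in both directions. -/
lemma exists_rep_sum {ι : Type*} [DecidableEq ι] (s : Finset ι) (b : ι → h.stab)
    (hb : ∀ i, CStarNonneg (b i)) :
    ∃ c : h.stab, CStarNonneg c ∧ h.cls c = ∑ i ∈ s, h.cls (b i) ∧
      (∀ η : ℝ, 0 < η → ∃ r : ι → h.stab, ∀ p ∈ s, ∀ q ∈ s,
        ‖r p * c * star (r q) - if p = q then b p else 0‖ < η) ∧
      (∀ η : ℝ, 0 < η → ∃ t : ι → h.stab, ‖c - ∑ j ∈ s, t j * b j * star (t j)‖ < η) := by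
  induction s using Finset.induction_on with
  | empty => exact ⟨0, nonneg_zero, by simp [h.cls_zero], by simp, fun η hη => by simpa using hη⟩
  | insert i s hi ih =>
    obtain ⟨c, hc, hcls, H1, H2⟩ := ih
    obtain ⟨d, hd, hdcls, K1, K2⟩ := exists_orth_pair h (hb i) hc
    refine ⟨d, hd, by rw [hdcls, Finset.sum_insert hi, hcls], fun η hη => ?_, fun η hη => ?_⟩
    · obtain ⟨r, hr⟩ := H1 (η / 2) (by positivity)
      set M := 1 + ∑ p ∈ s, ‖r p‖ with hM
      have hMpos : 0 < M := by positivity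
      have hle : ∀ p ∈ s, ‖r p‖ ≤ M := fun p hp => by
        have := Finset.single_le_sum (f := fun p => ‖r p‖) (fun _ _ => norm_nonneg _) hp
        linarith
      obtain ⟨u, w, h1, h2, h3, h4⟩ := K1 (min η (η / (2 * M ^ 2))) (by positivity)
      refine ⟨fun p => if p = i then u else r p * w, fun p hp q hq => ?_⟩
      rcases Finset.mem_insert.1 hp with rfl | hp'
      · rcases Finset.mem_insert.1 hq with rfl | hq'
        · simpa using h1.trans_le (min_le_left _ _)
        · have hne : q ≠ p := fun e => hi (e ▸ hq')
          simp only [if_true, if_neg hne, if_neg hne.symm, star_mul, ← mul_assoc, h3]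
          simpa using hη
      · have hne : p ≠ i := fun e => hi (e ▸ hp')
        rcases Finset.mem_insert.1 hq with rfl | hq'
        · simp only [if_true, if_neg hne, mul_assoc]
          rw [← mul_assoc w, h4]
          simpa using hη
        · have hne' : q ≠ i := fun e => hi (e ▸ hq')
          simp only [if_neg hne, if_neg hne']
          have e : r p * w * d * star (r q * w) - (if p = q then b p else 0) =
              r p * (w * d * star w - c) * star (r q) +
                (r p * c * star (r q) - if p = q then b p else 0) := by
            rw [star_mul]; noncomm_ring
          rw [e]
          have hb1 : ‖r p * (w * d * star w - c) * star (r q)‖ ≤ η / 2 := by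
            calc _ ≤ ‖r p‖ * ‖w * d * star w - c‖ * ‖star (r q)‖ :=
                  (norm_mul_le _ _).trans (by gcongr; exact norm_mul_le _ _)
              _ ≤ M * (η / (2 * M ^ 2)) * M := by
                  rw [norm_star]
                  gcongr
                  · exact hle p hp'
                  · exact h2.le.trans (min_le_right _ _)
                  · exact hle q hq'
              _ = η / 2 := by field_simp
          linarith [norm_add_le (r p * (w * d * star w - c) * star (r q))
            (r p * c * star (r q) - if p = q then b p else 0), hr p hp' q hq']
    · obtain ⟨u, w, huw⟩ := K2 (η / 2) (by positivity)
      obtain ⟨t, ht⟩ := H2 (η / (2 * (‖w‖ ^ 2 + 1))) (by positivity)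
      refine ⟨fun j => if j = i then u else w * t j, ?_⟩
      have e1 : ∑ j ∈ insert i s, (if j = i then u else w * t j) * b j *
          star (if j = i then u else w * t j) =
          u * b i * star u + w * (∑ j ∈ s, t j * b j * star (t j)) * star w := by
        rw [Finset.sum_insert hi, Finset.mul_sum, Finset.sum_mul]
        congr 1
        · simp
        · refine Finset.sum_congr rfl fun j hj => ?_
          have hne : j ≠ i := fun e => hi (e ▸ hj)
          simp [hne, mul_assoc]
      rw [e1]
      have e2 : d - (u * b i * star u + w * (∑ j ∈ s, t j * b j * star (t j)) * star w) =
          (d - (u * b i * star u + w * c * star w)) +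
            w * (c - ∑ j ∈ s, t j * b j * star (t j)) * star w := by
        rw [mul_sub, sub_mul]; abel
      rw [e2]
      have hb1 : ‖w * (c - ∑ j ∈ s, t j * b j * star (t j)) * star w‖ ≤ η / 2 := by
        refine (norm_conj_le _ _).trans ?_
        calc ‖w‖ ^ 2 * ‖c - ∑ j ∈ s, t j * b j * star (t j)‖
            ≤ (‖w‖ ^ 2 + 1) * (η / (2 * (‖w‖ ^ 2 + 1))) := by gcongr; linarith
          _ = η / 2 := by field_simp
      linarith [norm_add_le (d - (u * b i * star u + w * c * star w))
        (w * (c - ∑ j ∈ s, t j * b j * star (t j)) * star w)]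

lemma approx_of_cls_le_sum {ι : Type*} [Fintype ι] {a : h.stab} (ha : CStarNonneg a)
    {b : ι → h.stab} (hb : ∀ i, CStarNonneg (b i)) (hab : h.cls a ≤ ∑ j, h.cls (b j))
    {η : ℝ} (hη : 0 < η) : ∃ t : ι → h.stab, ‖a - ∑ j, t j * b j * star (t j)‖ < η := by
  classical
  obtain ⟨c, hc, hcls, -, H⟩ := exists_rep_sum h Finset.univ b hb
  rw [← hcls, h.cls_le_iff a c ha hc] at hab
  obtain ⟨r, hr⟩ := cuntzBelow_iff.1 hab (η / 2) (by positivity)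
  obtain ⟨t, ht⟩ := H (η / (2 * (‖r‖ ^ 2 + 1))) (by positivity)
  refine ⟨fun j => r * t j, ?_⟩
  have e : a - ∑ j, r * t j * b j * star (r * t j) =
      -(r * c * star r - a) + r * (c - ∑ j, t j * b j * star (t j)) * star r := by
    have : ∑ j, r * t j * b j * star (r * t j) = r * (∑ j, t j * b j * star (t j)) * star r := by
      rw [Finset.mul_sum, Finset.sum_mul]
      exact Finset.sum_congr rfl fun j _ => by simp [mul_assoc]
    rw [this, mul_sub, sub_mul]; abel
  rw [e]
  have hb1 : ‖r * (c - ∑ j, t j * b j * star (t j)) * star r‖ ≤ η / 2 := by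
    refine (norm_conj_le _ _).trans ?_
    calc ‖r‖ ^ 2 * ‖c - ∑ j, t j * b j * star (t j)‖
        ≤ (‖r‖ ^ 2 + 1) * (η / (2 * (‖r‖ ^ 2 + 1))) := by gcongr; linarith
      _ = η / 2 := by field_simp
  refine (norm_add_le _ _).trans_lt ?_
  rw [norm_neg]; linarith

lemma approx_of_sum_cls_le {ι : Type*} [Fintype ι] [DecidableEq ι] {d : h.stab}
    (hd : CStarNonneg d) {b : ι → h.stab} (hb : ∀ i, CStarNonneg (b i))
    (hbd : ∑ j, h.cls (b j) ≤ h.cls d) {η : ℝ} (hη : 0 < η) :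
    ∃ r : ι → h.stab, ∀ p q, ‖r p * d * star (r q) - if p = q then b p else 0‖ < η := by
  obtain ⟨c, hc, hcls, H, -⟩ := exists_rep_sum h Finset.univ b hb
  rw [← hcls, h.cls_le_iff c d hc hd] at hbd
  obtain ⟨r, hr⟩ := H (η / 2) (by positivity)
  set M := 1 + ∑ p, ‖r p‖ with hM
  have hMpos : 0 < M := by positivity
  have hle : ∀ p, ‖r p‖ ≤ M := fun p => by
    have := Finset.single_le_sum (f := fun p => ‖r p‖) (fun _ _ => norm_nonneg _)
      (Finset.mem_univ p)
    linarith
  obtain ⟨w, hw⟩ := cuntzBelow_iff.1 hbd (η / (2 * M ^ 2)) (by positivity)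
  refine ⟨fun p => r p * w, fun p q => ?_⟩
  have e : r p * w * d * star (r q * w) - (if p = q then b p else 0) =
      r p * (w * d * star w - c) * star (r q) +
        (r p * c * star (r q) - if p = q then b p else 0) := by
    rw [star_mul]; noncomm_ring
  rw [e]
  have hb1 : ‖r p * (w * d * star w - c) * star (r q)‖ ≤ η / 2 := by
    calc _ ≤ ‖r p‖ * ‖w * d * star w - c‖ * ‖star (r q)‖ :=
          (norm_mul_le _ _).trans (by gcongr; exact norm_mul_le _ _)
      _ ≤ M * (η / (2 * M ^ 2)) * M := by
          rw [norm_star]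
          gcongr
          · exact hle p
          · exact hle q
      _ = η / 2 := by field_simp
  linarith [norm_add_le (r p * (w * d * star w - c) * star (r q))
    (r p * c * star (r q) - if p = q then b p else 0), hr p (by simp) q (by simp)]

lemma sum_cls_le_of_approx {ι : Type*} [Fintype ι] [DecidableEq ι] {d : h.stab}
    (hd : CStarNonneg d) {b : ι → h.stab} (hb : ∀ i, CStarNonneg (b i))
    (H : ∀ η : ℝ, 0 < η → ∃ r : ι → h.stab, ∀ p q,
      ‖r p * d * star (r q) - if p = q then b p else 0‖ ≤ η) :
    ∑ j, h.cls (b j) ≤ h.cls d := by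
  obtain ⟨c, hc, hcls, -, K⟩ := exists_rep_sum h Finset.univ b hb
  rw [← hcls]
  refine cls_le_of_cuntzBelow h hc hd (cuntzBelow_iff.2 fun η hη => ?_)
  obtain ⟨t, ht⟩ := K (η / 2) (by positivity)
  set M := 1 + ∑ p, ∑ q, ‖t p‖ * ‖t q‖ with hM
  have hMpos : 0 < M := by positivity
  obtain ⟨r, hr⟩ := H (η / (2 * M)) (by positivity)
  refine ⟨∑ p, t p * r p, ?_⟩
  have e : (∑ p, t p * r p) * d * star (∑ p, t p * r p) - c =
      (∑ p, ∑ q, t p * (r p * d * star (r q) - if p = q then b p else 0) * star (t q)) -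
        (c - ∑ j, t j * b j * star (t j)) := by
    have e1 : (∑ p, t p * r p) * d * star (∑ p, t p * r p) =
        ∑ p, ∑ q, t p * (r p * d * star (r q)) * star (t q) := by
      rw [Finset.sum_mul, star_sum, Finset.sum_mul_sum]
      exact Finset.sum_congr rfl fun p _ => Finset.sum_congr rfl fun q _ => by
        simp [mul_assoc]
    rw [e1]
    simp only [mul_sub, sub_mul, Finset.sum_sub_distrib]
    simp [mul_ite, ite_mul]
  rw [e]
  have hb1 : ‖∑ p, ∑ q, t p * (r p * d * star (r q) - if p = q then b p else 0) * star (t q)‖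
      ≤ η / 2 := by
    calc _ ≤ ∑ p, ∑ q, ‖t p‖ * ‖t q‖ * (η / (2 * M)) := by
          refine norm_sum_le_of_le _ fun p _ => norm_sum_le_of_le _ fun q _ => ?_
          refine (norm_mul_le _ _).trans ?_
          rw [norm_star]
          calc _ ≤ ‖t p‖ * (η / (2 * M)) * ‖t q‖ := by
                gcongr
                exact (norm_mul_le _ _).trans (by gcongr; exact hr p q)
            _ = _ := by ring
      _ = (∑ p, ∑ q, ‖t p‖ * ‖t q‖) * (η / (2 * M)) := by simp only [Finset.sum_mul]
      _ ≤ M * (η / (2 * M)) := by gcongr; linarith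
      _ = η / 2 := by field_simp
  refine (norm_sub_le _ _).trans_lt ?_
  linarith

lemma exists_waybelow_sum (h : IsCuntzSemigroupOf A S) {ι : Type*} [Fintype ι]
    {x' x : S} {y : ι → S} (hx : WayBelow x' x)
    (hxy : x ≤ ∑ j, y j) : ∃ y' : ι → S, (∀ j, WayBelow (y' j) (y j)) ∧ x' ≤ ∑ j, y' j := by
  obtain ⟨a, ha, rfl⟩ := h.cls_surj x
  choose b hb hby using fun j => h.cls_surj (y j)
  obtain ⟨ε, hε, hxε⟩ := exists_cut_of_waybelow h ha hx
  simp only [← hby] at hxy ⊢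
  obtain ⟨t, ht⟩ := approx_of_cls_le_sum h ha hb hxy (half_pos hε)
  set M := 1 + ∑ j, ‖t j‖ ^ 2 with hM
  have hMpos : 0 < M := by positivity
  set δ := ε / (2 * M)
  have hδ : 0 < δ := by positivity
  refine ⟨fun j => h.cls (cut δ (b j)), fun j => cls_cut_waybelow h (hb j) hδ, hxε.trans ?_⟩
  refine cls_cut_le_sum h ha (fun j => cut_nonneg (hb j) δ) t ?_
  have e : a - ∑ j, t j * cut δ (b j) * star (t j) =
      (a - ∑ j, t j * b j * star (t j)) + ∑ j, t j * (b j - cut δ (b j)) * star (t j) := by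
    simp only [mul_sub, sub_mul, Finset.sum_sub_distrib]; abel
  rw [e]
  have hb1 : ‖∑ j, t j * (b j - cut δ (b j)) * star (t j)‖ ≤ ε / 2 := by
    calc _ ≤ ∑ j, ‖t j‖ ^ 2 * δ := by
          refine norm_sum_le_of_le _ fun j _ => (norm_conj_le _ _).trans ?_
          gcongr
          exact norm_sub_cut_le (hb j) hδ.le
      _ = (∑ j, ‖t j‖ ^ 2) * δ := by rw [Finset.sum_mul]
      _ ≤ M * δ := by gcongr; linarith
      _ = ε / 2 := by simp only [δ]; field_simp
  linarith [norm_add_le (a - ∑ j, t j * b j * star (t j))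
    (∑ j, t j * (b j - cut δ (b j)) * star (t j))]

end Semigroup

section Matrices

universe u v
variable {A : Type u} [NonUnitalCStarAlgebra A] {S : Type v} [CuSemigroup S]
  (h : IsCuntzSemigroupOf A S)

/-- The embedding of matrices, viewed on the C*-algebra of matrices. -/
noncomputable def cstarEmb (m : ℕ) : CStarMatrix (Fin m) (Fin m) A →⋆ₙₐ[ℂ] h.stab where
  toFun x := h.matEmb m (CStarMatrix.ofMatrix.symm x)
  map_smul' c x := map_smul (h.matEmb m) c _
  map_zero' := map_zero (h.matEmb m)
  map_add' x y := map_add (h.matEmb m) _ _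
  map_mul' x y := map_mul (h.matEmb m) _ _
  map_star' x := map_star (h.matEmb m) _

lemma norm_entry_le (m : ℕ) (x : Matrix (Fin m) (Fin m) A) (k l : Fin m) :
    ‖x k l‖ ≤ ‖h.matEmb m x‖ := by
  let _ := CStarAlgebra.spectralOrder A
  have _ := CStarAlgebra.spectralOrderedRing A
  have hinj : Function.Injective (cstarEmb h m) := h.matEmb_injective m
  have := NonUnitalStarAlgHom.norm_map (cstarEmb h m) hinj (CStarMatrix.ofMatrix x)
  calc ‖x k l‖ ≤ ‖CStarMatrix.ofMatrix x‖ :=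
        CStarMatrix.norm_entry_le_norm (M := CStarMatrix.ofMatrix x)
    _ = ‖h.matEmb m x‖ := this.symm

lemma isClosed_range_matEmb (m : ℕ) : IsClosed (Set.range (h.matEmb m)) := by
  let _ := CStarAlgebra.spectralOrder A
  have _ := CStarAlgebra.spectralOrderedRing A
  have hinj : Function.Injective (cstarEmb h m) := h.matEmb_injective m
  have := (NonUnitalStarAlgHom.isometry (cstarEmb h m) hinj).isClosedEmbedding.isClosed_range
  exact this

/-- The amplification `a ↦ a ⊗ 1ₘ`. -/
noncomputable def amp (m : ℕ) : A →⋆ₙₐ[ℂ] h.stab where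
  toFun a := h.matEmb m (Matrix.diagonal fun _ => a)
  map_smul' c x := by
    rw [MonoidHom.id_apply, ← map_smul]; congr 1; ext i j; simp [Matrix.diagonal_apply]
  map_zero' := by simp
  map_add' x y := by rw [← map_add, Matrix.diagonal_add]
  map_mul' x y := by rw [← map_mul, Matrix.diagonal_mul_diagonal]
  map_star' x := by
    rw [← map_star, Matrix.star_eq_conjTranspose, Matrix.diagonal_conjTranspose]; rfl

lemma amp_apply (m : ℕ) (a : A) : amp h m a = h.matEmb m (Matrix.diagonal fun _ => a) := rfl

/-- The corner embedding `a ↦ a ⊗ e₀₀`. -/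
noncomputable def corner (m : ℕ) : A →⋆ₙₐ[ℂ] h.stab where
  toFun a := h.matEmb (m + 1) (Matrix.single 0 0 a)
  map_smul' c x := by rw [MonoidHom.id_apply, ← map_smul, Matrix.smul_single]
  map_zero' := by simp
  map_add' x y := by rw [← map_add, Matrix.single_add]
  map_mul' x y := by rw [← map_mul, Matrix.single_mul_single_same]
  map_star' x := by
    rw [← map_star, Matrix.star_eq_conjTranspose, Matrix.conjTranspose_single]

lemma corner_apply (m : ℕ) (a : A) : corner h m a = h.matEmb (m + 1) (Matrix.single 0 0 a) := rfl

lemma matPad_single (m : ℕ) (a : A) :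
    matPad (Matrix.single 0 0 a : Matrix (Fin (m + 1)) (Fin (m + 1)) A) = Matrix.single 0 0 a := by
  ext i j
  simp only [matPad, Matrix.of_apply, Matrix.single_apply, Fin.ext_iff, Fin.val_zero]
  split_ifs <;> first | rfl | omega

lemma corner_eq (m : ℕ) (a : A) : corner h m a = h.matEmb 1 (Matrix.of fun _ _ => a) := by
  induction m with
  | zero =>
    rw [corner_apply]; congr 1; ext i j
    obtain rfl : i = 0 := Fin.fin_one_eq_zero i
    obtain rfl : j = 0 := Fin.fin_one_eq_zero j
    simp
  | succ m ih => rw [← ih, corner_apply, corner_apply, ← matPad_single, h.matEmb_compat]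

lemma clsA_eq (m : ℕ) (a : A) : h.clsA a = h.cls (corner h m a) := by
  rw [corner_eq]; rfl

/-- The `m`-fold multiple of a class is represented by the amplification. -/
lemma nsmul_clsA {m : ℕ} (hm : 1 ≤ m) {a : A} (ha : CStarNonneg a) :
    m • h.clsA a = h.cls (amp h m a) := by
  obtain ⟨m, rfl⟩ : ∃ k, m = k + 1 := ⟨m - 1, by omega⟩
  have hsum : (m + 1) • h.clsA a = ∑ _p : Fin (m + 1), h.cls (corner h m a) := by
    simp [clsA_eq h m]
  rw [hsum]
  have hc := map_nonneg (corner h m) ha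
  have hd := map_nonneg (amp h (m + 1)) ha
  have hg : ∀ δ : ℝ, 0 < δ → ‖cfcₙ (ratio δ) a * a * cfcₙ (ratio δ) a - a‖ ≤ δ := by
    intro δ hδ
    have hcont := ratio_continuous hδ
    have hid := fc_id (nonneg_isSelfAdjoint ha)
    nth_rw 2 4 [← hid]
    rw [fc_mul hcont (by simp) continuous_id' rfl, fc_mul (by fun_prop) (by simp) hcont (by simp),
      fc_sub (by fun_prop) (by simp) continuous_id' rfl]
    refine fc_norm_le ha fun t ht _ => ?_
    convert abs_pow_mul_sub_le hδ ht 2 using 2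
    ring
  refine le_antisymm ?_ ?_
  · refine sum_cls_le_of_approx h hd (fun _ => hc) fun η hη => ?_
    set g := cfcₙ (ratio η) a with hgdef
    have hgs : star g = g := fc_star _ _
    refine ⟨fun p => h.matEmb (m + 1) (Matrix.single 0 p g), fun p q => ?_⟩
    have e : h.matEmb (m + 1) (Matrix.single 0 p g) * amp h (m + 1) a *
        star (h.matEmb (m + 1) (Matrix.single 0 q g)) =
        if p = q then corner h m (g * a * g) else 0 := by
      rw [amp_apply, ← map_star, ← map_mul, ← map_mul, Matrix.star_eq_conjTranspose,
        Matrix.conjTranspose_single, Matrix.single_mul_mul_single, hgs]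
      split_ifs with hpq
      · subst hpq; simp [corner_apply]
      · simp [hpq]
    rw [e]
    split_ifs with hpq
    · rw [← map_sub]
      exact (NonUnitalStarAlgHom.norm_apply_le _ _).trans (hg η hη)
    · simpa using hη.le
  · refine cls_le_sum_of_approx h hd (fun _ => hc) fun η hη => ?_
    set g := cfcₙ (ratio (η / 2)) a with hgdef
    have hgs : star g = g := fc_star _ _
    refine ⟨fun p => h.matEmb (m + 1) (Matrix.single p 0 g), ?_⟩
    have e : ∑ p, h.matEmb (m + 1) (Matrix.single p 0 g) * corner h m a *
        star (h.matEmb (m + 1) (Matrix.single p 0 g)) = amp h (m + 1) (g * a * g) := by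
      rw [amp_apply, corner_apply, ← Matrix.sum_single_eq_diagonal, map_sum]
      refine Finset.sum_congr rfl fun p _ => ?_
      rw [← map_star, ← map_mul, ← map_mul, Matrix.star_eq_conjTranspose,
        Matrix.conjTranspose_single, Matrix.single_mul_mul_single, hgs]
      simp
    rw [e, ← map_sub]
    refine (NonUnitalStarAlgHom.norm_apply_le _ _).trans_lt ?_
    rw [norm_sub_rev]
    exact (hg _ (half_pos hη)).trans_lt (by linarith)

lemma matPad_mul_mul_matPad {n : ℕ} (x y : Matrix (Fin n) (Fin n) A)
    (z : Matrix (Fin (n + 1)) (Fin (n + 1)) A) :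
    matPad x * z * matPad y = matPad (x * z.submatrix Fin.castSucc Fin.castSucc * y) := by
  have hp : ∀ w : Matrix (Fin n) (Fin n) A, (∀ i j, matPad w (Fin.castSucc i) (Fin.castSucc j) =
      w i j) ∧ (∀ i, matPad w i (Fin.last n) = 0) ∧ ∀ j, matPad w (Fin.last n) j = 0 := fun w =>
    ⟨fun i j => by simp [matPad], fun i => by simp [matPad], fun j => by simp [matPad]⟩
  ext i j
  refine Fin.lastCases ?_ (fun i => ?_) i
  · rw [(hp _).2.2, Matrix.mul_apply]
    refine Finset.sum_eq_zero fun k _ => ?_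
    rw [Matrix.mul_apply, Finset.sum_eq_zero fun l _ => by rw [(hp x).2.2, zero_mul], zero_mul]
  · refine Fin.lastCases ?_ (fun j => ?_) j
    · rw [(hp _).2.1, Matrix.mul_apply]
      exact Finset.sum_eq_zero fun k _ => by rw [(hp y).2.1, mul_zero]
    · rw [(hp _).1]
      simp only [Matrix.mul_apply, Fin.sum_univ_castSucc, (hp x).1, (hp y).1, (hp x).2.1,
        (hp y).2.2, zero_mul, mul_zero, add_zero, Matrix.submatrix_apply]

lemma exists_matEmb_add (m k : ℕ) (x : Matrix (Fin m) (Fin m) A) :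
    ∃ X : Matrix (Fin (m + k)) (Fin (m + k)) A, h.matEmb (m + k) X = h.matEmb m x := by
  induction k with
  | zero => exact ⟨x, rfl⟩
  | succ k ih =>
    obtain ⟨X, hX⟩ := ih
    exact ⟨matPad X, (h.matEmb_compat (m + k) X).trans hX⟩

lemma exists_compression_add (m k : ℕ) (z : Matrix (Fin (m + k)) (Fin (m + k)) A) :
    ∃ w : Matrix (Fin m) (Fin m) A, ∀ x y : Matrix (Fin m) (Fin m) A,
      h.matEmb m x * h.matEmb (m + k) z * h.matEmb m y = h.matEmb m (x * w * y) := by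
  induction k with
  | zero => exact ⟨z, fun x y => by simp⟩
  | succ k ih =>
    obtain ⟨w, hw⟩ := ih (z.submatrix Fin.castSucc Fin.castSucc)
    refine ⟨w, fun x y => ?_⟩
    obtain ⟨X, hX⟩ := exists_matEmb_add h m k x
    obtain ⟨Y, hY⟩ := exists_matEmb_add h m k y
    rw [← hw, ← hX, ← hY, ← map_mul, ← map_mul, ← h.matEmb_compat (m + k) X,
      ← h.matEmb_compat (m + k) Y, ← h.matEmb_compat (m + k), ← matPad_mul_mul_matPad, map_mul,
      map_mul]
    rfl

/-- Matrices of size `m` form a hereditary subalgebra of the stabilization. -/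
lemma exists_matEmb_eq (m : ℕ) (x y : Matrix (Fin m) (Fin m) A) (z : h.stab) :
    ∃ w : Matrix (Fin m) (Fin m) A, h.matEmb m w = h.matEmb m x * z * h.matEmb m y := by
  have hcl : IsClosed {z : h.stab | h.matEmb m x * z * h.matEmb m y ∈ Set.range (h.matEmb m)} :=
    (isClosed_range_matEmb h m).preimage (by fun_prop)
  have hsub : (⋃ n, Set.range (h.matEmb n)) ⊆
      {z : h.stab | h.matEmb m x * z * h.matEmb m y ∈ Set.range (h.matEmb m)} := by
    rintro _ ⟨_, ⟨n, rfl⟩, z, rfl⟩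
    rcases le_total m n with hmn | hmn
    · obtain ⟨k, rfl⟩ := Nat.exists_eq_add_of_le hmn
      obtain ⟨w, hw⟩ := exists_compression_add h m k z
      exact ⟨x * w * y, (hw x y).symm⟩
    · obtain ⟨k, rfl⟩ := Nat.exists_eq_add_of_le hmn
      obtain ⟨Z, hZ⟩ := exists_matEmb_add h n k z
      exact ⟨x * Z * y, by rw [map_mul, map_mul, hZ]⟩
  have := closure_minimal hsub hcl (h.matEmb_dense z)
  exact this

end Matrices

section Witnesses

universe u v
variable {A : Type u} [NonUnitalCStarAlgebra A] {S : Type v} [CuSemigroup S]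
  (h : IsCuntzSemigroupOf A S)

lemma fc_ratio_cuntzBelow {B : Type*} [NonUnitalCStarAlgebra B] {b : B} (hb : CStarNonneg b)
    {δ : ℝ} (hδ : 0 < δ) : CuntzBelow (cfcₙ (ratio δ) b) b := by
  conv_rhs => rw [← fc_id (nonneg_isSelfAdjoint hb)]
  refine cuntzBelow_fc hb (ratio_continuous hδ) (by simp) continuous_id' rfl fun ε hε => ?_
  -- `k(t)² t = t / max t δ` up to `ε`, for `k(t)² = ratio(t) ^ 2 / max t δ`
  refine ⟨fun t => ratio (min (ε * δ) 1) t * Real.sqrt (1 / max t δ), ?_, by simp, ?_⟩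
  · have h1 := ratio_continuous (δ := min (ε * δ) 1) (by positivity)
    refine h1.mul (Real.continuous_sqrt.comp ?_)
    exact continuous_const.div (by fun_prop) fun t => (lt_max_of_lt_right hδ).ne'
  · intro t ht _
    have hm : 0 < max t δ := lt_max_of_lt_right hδ
    have key := abs_pow_mul_sub_le (δ := min (ε * δ) 1) (by positivity) ht 2
    have hs : Real.sqrt (1 / max t δ) * Real.sqrt (1 / max t δ) = 1 / max t δ :=
      Real.mul_self_sqrt (by positivity)
    have e : ratio (min (ε * δ) 1) t * Real.sqrt (1 / max t δ) * t *
        (ratio (min (ε * δ) 1) t * Real.sqrt (1 / max t δ)) - ratio δ t =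
        (t * ratio (min (ε * δ) 1) t ^ 2 - t) / max t δ := by
      calc _ = ratio (min (ε * δ) 1) t ^ 2 * t *
            (Real.sqrt (1 / max t δ) * Real.sqrt (1 / max t δ)) - t / max t δ := by
              rw [ratio.eq_1 δ t]; ring
        _ = _ := by rw [hs]; ring
    rw [e, abs_div, abs_of_pos hm, div_le_iff₀ hm]
    calc _ ≤ ε * δ := key.trans (min_le_left _ _)
      _ ≤ _ := by gcongr; exact le_max_right _ _

lemma norm_cube_sub_le {B : Type*} [NonUnitalCStarAlgebra B] {G ρ : B} {η : ℝ}
    (hG : ‖G‖ ≤ 2) (hρ : ‖ρ‖ ≤ 1) (hη : ‖G - ρ‖ ≤ η) :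
    ‖ρ * ρ * ρ - G * G * G‖ ≤ 7 * η := by
  have e : ρ * ρ * ρ - G * G * G =
      (ρ - G) * G * G + ρ * (ρ - G) * G + ρ * ρ * (ρ - G) := by noncomm_ring
  have h0 : ‖ρ - G‖ ≤ η := by rwa [norm_sub_rev]
  have hη0 : 0 ≤ η := (norm_nonneg _).trans h0
  have n3 : ∀ x y z : B, ‖x * y * z‖ ≤ ‖x‖ * ‖y‖ * ‖z‖ := fun x y z =>
    (norm_mul_le _ _).trans (by gcongr; exact norm_mul_le _ _)
  rw [e]
  calc _ ≤ ‖(ρ - G) * G * G‖ + ‖ρ * (ρ - G) * G‖ + ‖ρ * ρ * (ρ - G)‖ := norm_add₃_le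
    _ ≤ η * 2 * 2 + 1 * η * 2 + 1 * 1 * η := by
        gcongr
        · exact (n3 _ _ _).trans (by gcongr)
        · exact (n3 _ _ _).trans (by gcongr)
        · exact (n3 _ _ _).trans (by gcongr)
    _ = 7 * η := by ring

lemma exists_divisor {b d : h.stab} (hb : CStarNonneg b) (hd : CStarNonneg d) {k : ℕ}
    (hk : k • h.cls b ≤ h.cls d) {δ η : ℝ} (hδ : 0 < δ) (hη : 0 < η) :
    ∃ r : Fin k → h.stab, ∀ p q, ‖(r p * d) * star (r q * d) -
      if p = q then cfcₙ (ratio δ) b else 0‖ < η := by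
  have hρ : CStarNonneg (cfcₙ (ratio δ) b) := fc_nonneg hb fun t ht => ratio_nonneg ht
  have hdd : CStarNonneg (d * d) := by
    have := nonneg_star_mul_self d
    rwa [nonneg_star hd] at this
  have hle : ∑ _p : Fin k, h.cls (cfcₙ (ratio δ) b) ≤ h.cls (d * d) := by
    rw [Finset.sum_const, Finset.card_univ, Fintype.card_fin]
    exact (nsmul_le_nsmul_right
      (cls_le_of_cuntzBelow h hρ hb (fc_ratio_cuntzBelow hb hδ)) k).trans
      (hk.trans (cls_le_of_cuntzBelow h hd hdd (cuntzBelow_sq hd)))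
  obtain ⟨r, hr⟩ := approx_of_sum_cls_le h hdd (fun _ => hρ) hle hη
  refine ⟨r, fun p q => ?_⟩
  have := hr p q
  rwa [show r p * d * star (r q * d) = r p * (d * d) * star (r q) by
    rw [star_mul, nonneg_star hd]; simp only [mul_assoc]]

/-- Quantitative form of `[E] ≤ ∑ yⱼ`, `k yⱼ ≤ [d]` through factorizations. -/
lemma exists_factorization {E d : h.stab} (hE : CStarNonneg E) (hd : CStarNonneg d) {n k : ℕ}
    (y : Fin n → S) (hy : h.cls E ≤ ∑ j, y j) (hk : ∀ j, k • y j ≤ h.cls d) (p₀ : Fin k)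
    {η : ℝ} (hη : 0 < η) :
    ∃ (t : Fin n → h.stab) (r : Fin n → Fin k → h.stab),
      ‖E * E * E - ∑ j, (E * t j * d) * ((d * r j p₀ * d) * star (d * r j p₀ * d)) *
        star (E * t j * d)‖ < η ∧
      (∀ j p q, ‖(d * r j p * d) * star (d * r j q * d) -
        if p = q then (d * r j p₀ * d) * star (d * r j p₀ * d) else 0‖ < η) ∧
      (∀ j p, ‖d * r j p * d‖ ≤ 2) ∧ ∀ j, ‖E * t j * d‖ ≤ 2 * (‖E‖ * (‖E‖ + 1)) := by
  choose b hb hby using fun j => h.cls_surj (y j)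
  simp_rw [← hby] at hy hk
  set K : ℝ := ‖E‖ ^ 2 * (1 + n + n * ((‖E‖ + 1) * 7)) + 4 with hK
  have hK4 : 4 ≤ K := by
    rw [hK]; linarith [show 0 ≤ ‖E‖ ^ 2 * (1 + n + n * ((‖E‖ + 1) * 7)) by positivity]
  obtain ⟨η₁, hη₁, hη₁1, hη₁K⟩ : ∃ η₁ : ℝ, 0 < η₁ ∧ η₁ ≤ 1 ∧ K * η₁ < η := by
    refine ⟨min 1 (η / (2 * K)), by positivity, min_le_left _ _, ?_⟩
    calc K * min 1 (η / (2 * K)) ≤ K * (η / (2 * K)) := by gcongr; exact min_le_right _ _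
      _ = η / 2 := by field_simp
      _ < η := by linarith
  obtain ⟨t, ht⟩ := approx_of_cls_le_sum h hE hb hy hη₁
  obtain ⟨δ, hδ, hδt⟩ : ∃ δ : ℝ, 0 < δ ∧ ∀ j, ‖t j‖ ^ 2 * δ ≤ η₁ := by
    refine ⟨η₁ / (1 + ∑ j, ‖t j‖ ^ 2), by positivity, fun j => ?_⟩
    have hj : ‖t j‖ ^ 2 ≤ ∑ j, ‖t j‖ ^ 2 :=
      Finset.single_le_sum (f := fun j => ‖t j‖ ^ 2) (fun i _ => by positivity) (Finset.mem_univ j)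
    rw [mul_div_assoc', div_le_iff₀ (by positivity)]
    nlinarith
  choose r hr using fun j => exists_divisor h (hb j) hd (hk j) hδ hη₁
  set ρ : Fin n → h.stab := fun j => cfcₙ (ratio δ) (b j) with hρ
  set x : Fin n → Fin k → h.stab := fun j p => r j p * d with hx
  set w : Fin n → h.stab := fun j => t j * root (b j) with hw
  have hds := nonneg_star hd
  have hEs := nonneg_star hE
  have hρ1 : ∀ j, ‖ρ j‖ ≤ 1 := fun j => fc_norm_le (hb j) fun s hs _ => by
    rw [abs_of_nonneg (ratio_nonneg hs)]; exact ratio_le_one hδ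
  have hGρ : ∀ j p, ‖x j p * star (x j p) - ρ j‖ ≤ η₁ := fun j p => by
    have := (hr j p p).le
    rwa [if_pos rfl] at this
  have hG2 : ∀ j p, ‖x j p * star (x j p)‖ ≤ 2 := fun j p => by
    have := norm_le_norm_add_norm_sub' (x j p * star (x j p)) (ρ j)
    linarith [hGρ j p, hρ1 j]
  have hx2 : ∀ j p, ‖x j p‖ * ‖x j p‖ ≤ 2 := fun j p => by
    rw [← CStarRing.norm_self_mul_star]; exact hG2 j p
  have hxx : ∀ j p q, ‖x j p‖ * ‖x j q‖ ≤ 2 := fun j p q => by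
    nlinarith [hx2 j p, hx2 j q, sq_nonneg (‖x j p‖ - ‖x j q‖)]
  have hww : ∀ j, w j * star (w j) = t j * b j * star (t j) := fun j => by
    simp only [hw, star_mul, root_star]
    rw [mul_assoc, ← mul_assoc (root _), root_mul_root (hb j), mul_assoc]
  have hw2 : ∀ j, ‖w j‖ * ‖w j‖ ≤ ‖E‖ + 1 := fun j => by
    rw [← CStarRing.norm_self_mul_star, hww]
    have h1 : ‖t j * b j * star (t j)‖ ≤ ‖∑ j, t j * b j * star (t j)‖ := by
      rw [← Finset.add_sum_erase _ _ (Finset.mem_univ j)]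
      exact norm_le_norm_add (nonneg_conj (hb j) _)
        (nonneg_sum _ fun i _ => nonneg_conj (hb i) _)
    have h2 := norm_le_norm_add_norm_sub' (∑ j, t j * b j * star (t j)) E
    rw [norm_sub_rev] at h2
    linarith
  have hv : ∀ j p, d * (star (r j p₀) * r j p) * d = star (x j p₀) * x j p := fun j p => by
    simp only [hx, star_mul, hds, mul_assoc]
  have hs : ∀ j, E * (w j * r j p₀) * d = E * w j * x j p₀ := fun j => by
    simp only [hx, mul_assoc]
  refine ⟨fun j => w j * r j p₀, fun j p => star (r j p₀) * r j p, ?_, ?_, ?_, ?_⟩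
  · simp only [hv, hs]
    have e1 : ∀ j, E * w j * x j p₀ * (star (x j p₀) * x j p₀ * star (star (x j p₀) * x j p₀)) *
        star (E * w j * x j p₀) = E * (w j * ((x j p₀ * star (x j p₀)) * (x j p₀ * star (x j p₀)) *
          (x j p₀ * star (x j p₀))) * star (w j)) * E := fun j => by
      simp only [star_mul, star_star, hEs, mul_assoc]
    simp only [e1]
    have e2 : E * E * E - ∑ j, E * (w j * ((x j p₀ * star (x j p₀)) * (x j p₀ * star (x j p₀)) *
          (x j p₀ * star (x j p₀))) * star (w j)) * E =
        E * ((E - ∑ j, t j * b j * star (t j)) +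
          ∑ j, (t j * b j * star (t j) - w j * (ρ j * ρ j * ρ j) * star (w j)) +
          ∑ j, w j * (ρ j * ρ j * ρ j - (x j p₀ * star (x j p₀)) * (x j p₀ * star (x j p₀)) *
          (x j p₀ * star (x j p₀))) * star (w j)) * E := by
      rw [← Finset.sum_mul, ← Finset.mul_sum, ← sub_mul, ← mul_sub]
      congr 2
      simp only [mul_sub, sub_mul, Finset.sum_sub_distrib]
      abel
    have b1 : ∀ j, ‖t j * b j * star (t j) - w j * (ρ j * ρ j * ρ j) * star (w j)‖ ≤ η₁ := by
      intro j
      have hc := ratio_continuous hδ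
      have hsq : Continuous fun s : ℝ => Real.sqrt s := Real.continuous_sqrt
      have e3 : root (b j) * (ρ j * ρ j * ρ j) * root (b j) =
          cfcₙ (fun s => s * ratio δ s ^ 3) (b j) := by
        simp only [hρ, root]
        rw [fc_mul hc (by simp) hc (by simp), fc_mul (by fun_prop) (by simp) hc (by simp),
          fc_mul (by fun_prop) (by simp) (by fun_prop) (by simp),
          fc_mul (by fun_prop) (by simp) (by fun_prop) (by simp)]
        refine fc_congr (hb j) fun s hs => ?_
        have := Real.mul_self_sqrt hs
        calc _ = (√s * √s) * ratio δ s ^ 3 := by ring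
          _ = _ := by rw [this]
      have e4 : t j * b j * star (t j) - w j * (ρ j * ρ j * ρ j) * star (w j) =
          t j * (b j - cfcₙ (fun s => s * ratio δ s ^ 3) (b j)) * star (t j) := by
        rw [← e3, mul_sub, sub_mul]
        simp only [hw, star_mul, root_star, mul_assoc]
      rw [e4]
      refine (norm_conj_le _ _).trans (le_trans ?_ (hδt j))
      gcongr
      nth_rw 1 [← fc_id (nonneg_isSelfAdjoint (hb j))]
      rw [fc_sub continuous_id' rfl (by fun_prop) (by simp)]
      refine fc_norm_le (hb j) fun s hs _ => ?_
      rw [abs_sub_comm]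
      exact abs_pow_mul_sub_le hδ hs 3
    have b2 : ∀ j, ‖w j * (ρ j * ρ j * ρ j - (x j p₀ * star (x j p₀)) * (x j p₀ * star (x j p₀)) *
          (x j p₀ * star (x j p₀))) * star (w j)‖ ≤ (‖E‖ + 1) * 7 * η₁ := fun j => by
      refine (norm_conj_le _ _).trans ?_
      rw [pow_two, mul_assoc (‖E‖ + 1)]
      gcongr ?_ * ?_
      · exact hw2 j
      · exact norm_cube_sub_le (hG2 j p₀) (hρ1 j) (hGρ j p₀)
    rw [e2]
    have hconj := fun z => norm_conj_le E z
    rw [hEs] at hconj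
    refine (hconj _).trans_lt (lt_of_le_of_lt ?_ hη₁K)
    calc _ ≤ ‖E‖ ^ 2 * (η₁ + n * η₁ + n * ((‖E‖ + 1) * 7 * η₁)) := by
          gcongr
          refine norm_add₃_le.trans ?_
          gcongr
          · refine (norm_sum_le _ _).trans ((Finset.sum_le_sum fun j _ => b1 j).trans ?_)
            simp
          · refine (norm_sum_le _ _).trans ((Finset.sum_le_sum fun j _ => b2 j).trans ?_)
            simp
      _ ≤ K * η₁ := by rw [hK]; nlinarith
  · intro j p q
    simp only [hv]
    have e5 : star (x j p₀) * x j p * star (star (x j p₀) * x j q) -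
        (if p = q then star (x j p₀) * x j p₀ * star (star (x j p₀) * x j p₀) else 0) =
        star (x j p₀) * ((x j p * star (x j q) - if p = q then ρ j else 0) -
          if p = q then x j p₀ * star (x j p₀) - ρ j else 0) * star (star (x j p₀)) := by
      split_ifs <;> simp only [star_mul, star_star, mul_assoc, sub_zero, mul_sub, sub_mul]
      abel
    rw [e5]
    refine (norm_conj_le _ _).trans_lt (lt_of_le_of_lt ?_ hη₁K)
    rw [norm_star, pow_two]
    have hif : ‖(if p = q then x j p₀ * star (x j p₀) - ρ j else 0 : h.stab)‖ ≤ η₁ := by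
      split_ifs
      · exact hGρ j p₀
      · simpa using hη₁.le
    calc _ ≤ 2 * (η₁ + η₁) := by
          gcongr
          · exact hx2 j p₀
          · exact (norm_sub_le _ _).trans (add_le_add (hr j p q).le hif)
      _ ≤ K * η₁ := by nlinarith
  · intro j p
    simp only [hv]
    exact (norm_mul_le _ _).trans (by rw [norm_star]; exact hxx j p₀ p)
  · intro j
    simp only [hs]
    have hw1 : ‖w j‖ * ‖x j p₀‖ ≤ 2 * (‖E‖ + 1) := by
      have a1 := hw2 j
      have a2 := hx2 j p₀
      nlinarith [sq_nonneg (‖w j‖ - ‖x j p₀‖), norm_nonneg E]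
    calc _ ≤ ‖E‖ * (‖w j‖ * ‖x j p₀‖) := by
          rw [mul_assoc E]
          exact (norm_mul_le _ _).trans (by gcongr; exact norm_mul_le _ _)
      _ ≤ ‖E‖ * (2 * (‖E‖ + 1)) := by gcongr
      _ = _ := by ring

/-- The factorization of `exists_factorization` inside `m × m` matrices. -/
lemma exists_matrix_factorization {E d : A} (hE : CStarNonneg E) (hd : CStarNonneg d) {m n k : ℕ}
    (y : Fin n → S) (hy : h.cls (amp h m E) ≤ ∑ j, y j)
    (hk : ∀ j, k • y j ≤ h.cls (amp h m d)) (p₀ : Fin k) {η : ℝ} (hη : 0 < η) :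
    ∃ (s : Fin n → Matrix (Fin m) (Fin m) A) (v : Fin n → Fin k → Matrix (Fin m) (Fin m) A),
      (∀ j, ∃ s', s j = Matrix.diagonal (fun _ => root E) * s' *
        Matrix.diagonal fun _ => root d) ∧
      (∀ j p, ∃ v', v j p = Matrix.diagonal (fun _ => root d) * v' *
        Matrix.diagonal fun _ => root d) ∧
      ‖h.matEmb m ((Matrix.diagonal fun _ => E * E * E) -
        ∑ j, s j * (v j p₀ * star (v j p₀)) * star (s j))‖ < η ∧
      (∀ j p q, ‖h.matEmb m (v j p * star (v j q) -
        if p = q then v j p₀ * star (v j p₀) else 0)‖ < η) ∧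
      (∀ j p, ‖h.matEmb m (v j p)‖ ≤ 2) ∧
      ∀ j, ‖h.matEmb m (s j)‖ ≤ 2 * (‖E‖ * (‖E‖ + 1)) := by
  obtain ⟨t, r, h1, h2, h3, h4⟩ := exists_factorization h (map_nonneg (amp h m) hE)
    (map_nonneg (amp h m) hd) y hy hk p₀ hη
  have hfac : ∀ {x z : A}, CStarNonneg x → CStarNonneg z → ∀ w : h.stab,
      ∃ W : Matrix (Fin m) (Fin m) A, (∃ w', W = Matrix.diagonal (fun _ => root x) * w' *
        Matrix.diagonal fun _ => root z) ∧ h.matEmb m W = amp h m x * w * amp h m z := by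
    intro x z hx hz w
    obtain ⟨w', hw'⟩ := exists_matEmb_eq h m (Matrix.diagonal fun _ => root x)
      (Matrix.diagonal fun _ => root z) w
    refine ⟨_, ⟨w', rfl⟩, ?_⟩
    rw [map_mul, map_mul, hw', ← amp_apply, ← amp_apply]
    conv_rhs => rw [← root_mul_root hx, ← root_mul_root hz, map_mul, map_mul]
    simp only [mul_assoc]
  choose s hs hs' using fun j => hfac hE hd (t j)
  choose v hv hv' using fun j p => hfac hd hd (r j p)
  refine ⟨s, v, hs, hv, ?_, ?_, ?_, ?_⟩
  · convert h1 using 2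
    rw [map_sub, map_sum]
    congr 1
    · rw [← map_mul, ← map_mul, amp_apply]
    · refine Finset.sum_congr rfl fun j _ => ?_
      rw [map_mul, map_mul, map_mul, map_star, map_star, hs', hv']
  · intro j p q
    convert h2 j p q using 2
    rw [map_sub, map_mul, map_star, hv', hv']
    congr 1
    split_ifs
    · rw [map_mul, map_star, hv']
    · exact map_zero _
  · intro j p
    rw [hv']
    exact h3 j p
  · intro j
    rw [hs']
    have hle := NonUnitalStarAlgHom.norm_apply_le (amp h m) E
    exact (h4 j).trans (by gcongr)

end Witnesses

section Scattered

/-- A family of `2m` almost orthogonal vectors of the same length in `ℂᵐ` is small. -/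
lemma le_of_gram_almost_scalar {m : ℕ} (hm : 1 ≤ m) (W : Matrix (Fin (2 * m)) (Fin m) ℂ) {z : ℂ}
    {η : ℝ} (H : ∀ p q, ‖(W * W.conjTranspose) p q - if p = q then z else 0‖ ≤ η) :
    ‖z‖ ≤ 2 * m * η := by
  set G := W * W.conjTranspose with hG
  have hdet : G.det = 0 := by
    by_contra hne
    have h1 : G.rank = 2 * m := by
      rw [Matrix.rank_of_isUnit G ((Matrix.isUnit_iff_isUnit_det G).2 (Ne.isUnit hne)),
        Fintype.card_fin]
    have h2 : G.rank ≤ m := (Matrix.rank_mul_le_left _ _).trans (Matrix.rank_le_width W)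
    omega
  have hex : ∃ k, ‖G k k‖ ≤ ∑ j ∈ Finset.univ.erase k, ‖G k j‖ := by
    by_contra! hcon
    exact det_ne_zero_of_sum_row_lt_diag hcon hdet
  obtain ⟨k, hk⟩ := hex
  have h1 : ‖z‖ ≤ ‖G k k‖ + η := by
    have h2 := H k k
    rw [if_pos rfl] at h2
    have h3 := norm_le_norm_add_norm_sub' z (G k k)
    rw [norm_sub_rev] at h3
    linarith
  have h2 : ∑ j ∈ Finset.univ.erase k, ‖G k j‖ ≤ ∑ _j ∈ Finset.univ.erase k, η := by
    refine Finset.sum_le_sum fun j hj => ?_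
    have h3 := H k j
    rwa [if_neg (Finset.ne_of_mem_erase hj).symm, sub_zero] at h3
  rw [Finset.sum_const, Finset.card_erase_of_mem (Finset.mem_univ k), Finset.card_univ,
    Fintype.card_fin, nsmul_eq_mul, Nat.cast_sub (by omega)] at h2
  push_cast at h2
  linarith

lemma fc_of_idempotent {B : Type*} [NonUnitalCStarAlgebra B] {e : B} (hs : IsSelfAdjoint e)
    (he : e * e = e) {f : ℝ → ℝ} (hf0 : f 0 = 0) : cfcₙ f e = f 1 • e := by
  rw [← cfcₙ_const_mul_id (R := ℝ) (f 1) e hs]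
  refine cfcₙ_congr fun t ht => ?_
  have := IsIdempotentElem.quasispectrum_subset ℝ (A := B) he ht
  rcases this with rfl | rfl
  · simp [hf0]
  · simp

lemma isCompactOperator_rankOne {H : Type*} [NormedAddCommGroup H] [InnerProductSpace ℂ H]
    (ξ : H) : IsCompactOperator (InnerProductSpace.rankOne ℂ ξ ξ) := by
  have h1 : IsCompactOperator (id : ℂ → ℂ) := isCompactOperator_id
  exact (h1.comp_clm (innerSL ℂ ξ)).clm_comp (ContinuousLinearMap.toSpanSingleton ℂ ξ)

/-- Divisibility excludes quotients of ideals onto nonzero algebras of compact operators. -/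
lemma nowhereScattered_of_divisible {Q : Type*} [NonUnitalCStarAlgebra Q] {S : Type*}
    [CuSemigroup S] (h : IsCuntzSemigroupOf Q S)
    (hdiv : ∀ T : Q, CStarNonneg T → ∃ m n : ℕ, 1 ≤ m ∧
      CuDiv.IsWeaklyDivisible (2 * m) n (m • h.clsA T)) : NowhereScattered Q := by
  rintro ⟨J, H, _, _, _, ψ, hψ, x₀, hx₀⟩
  have _ : IsClosed (J.carrier : Set Q) := J.isClosed
  obtain ⟨ζ, hζ⟩ : ∃ ζ : H, ζ ≠ 0 := by
    by_contra! hcon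
    exact hx₀ (ContinuousLinearMap.ext fun v => by rw [hcon v]; simp)
  obtain ⟨ξ, hξ⟩ : ∃ ξ : H, ‖ξ‖ = 1 := ⟨((‖ζ‖⁻¹ : ℝ) : ℂ) • ζ, by
    rw [norm_smul]; simp [hζ]⟩
  set e : H →L[ℂ] H := InnerProductSpace.rankOne ℂ ξ ξ with he
  have hee : e * e = e := InnerProductSpace.isIdempotentElem_rankOne_self hξ
  have hes : IsSelfAdjoint e := by
    rw [ContinuousLinearMap.isSelfAdjoint_iff_isSymmetric]
    intro v w
    simp only [he, ContinuousLinearMap.coe_coe, InnerProductSpace.rankOne_apply, inner_smul_left,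
      inner_smul_right, inner_conj_symm]
    ring
  have hξξ : inner ℂ ξ ξ = (1 : ℂ) := by rw [inner_self_eq_norm_sq_to_K, hξ]; simp
  obtain ⟨b, hb⟩ : e ∈ Set.range ψ := by rw [hψ]; exact isCompactOperator_rankOne ξ
  set p : J.carrier := star b * b with hp
  have hpn : CStarNonneg p := nonneg_star_mul_self b
  have hψp : ψ p = e := by rw [hp, map_mul, map_star, hb, hes.star_eq, hee]
  let ι : J.carrier →⋆ₙₐ[ℂ] Q := NonUnitalStarSubalgebraClass.subtype J.carrier
  have hιp : CStarNonneg (ι p) := map_nonneg ι hpn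
  obtain ⟨m, n, hm, hmn⟩ := hdiv (ι p) hιp
  set E : J.carrier := cut (1 / 2) p with hE
  have hEn : CStarNonneg E := cut_nonneg hpn _
  have hιE : ι E = cut (1 / 2) (ι p) := map_cut ι (by norm_num) (nonneg_isSelfAdjoint hpn)
  have hway : WayBelow (h.cls (amp h m (ι E))) (m • h.clsA (ι p)) := by
    rw [nsmul_clsA h hm hιp, hιE, map_cut (amp h m) (by norm_num) (nonneg_isSelfAdjoint hιp)]
    exact cls_cut_waybelow h (map_nonneg _ hιp) (by norm_num)
  obtain ⟨y, hy, hyk⟩ := hmn _ hway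
  simp_rw [nsmul_clsA h hm hιp] at hyk
  -- the vector state at `ξ`
  let χ : J.carrier → ℂ := fun x => inner ℂ ξ (ψ x ξ)
  have hχsum : ∀ {κ : Type} (s : Finset κ) (f : κ → J.carrier), χ (∑ i ∈ s, f i) =
      ∑ i ∈ s, χ (f i) := fun s f => by
    simp only [χ, map_sum, ContinuousLinearMap.sum_apply, inner_sum]
  have hχsub : ∀ x y, χ (x - y) = χ x - χ y := fun x y => by
    simp only [χ, map_sub, ContinuousLinearMap.sub_apply, inner_sub_right]
  have hχnorm : ∀ x, ‖χ x‖ ≤ ‖x‖ := fun x => by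
    calc ‖χ x‖ ≤ ‖ξ‖ * ‖ψ x ξ‖ := norm_inner_le_norm _ _
      _ ≤ ‖ξ‖ * (‖ψ x‖ * ‖ξ‖) := by gcongr; exact (ψ x).le_opNorm ξ
      _ = ‖ψ x‖ := by rw [hξ]; ring
      _ ≤ ‖x‖ := NonUnitalStarAlgHom.norm_apply_le ψ x
  have hχstar : ∀ x, χ (star x) = star (χ x) := fun x => by
    simp only [χ, map_star, ContinuousLinearMap.star_eq_adjoint,
      ContinuousLinearMap.adjoint_inner_right]
    rw [← inner_conj_symm]; rfl
  have hχmul : ∀ x y, e * ψ y = ψ y → χ (x * y) = χ x * χ y := fun x y hy => by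
    have h1 : ψ y ξ = χ y • ξ := by
      conv_lhs => rw [← hy]
      rfl
    change inner ℂ ξ (ψ (x * y) ξ) = χ x * χ y
    rw [map_mul, ContinuousLinearMap.mul_apply, h1, map_smul, inner_smul_right]
    exact mul_comm _ _
  set k₀ : J.carrier := root p with hk₀
  have hψk : ψ k₀ = e := by
    rw [hk₀, root, map_fc ψ Real.continuous_sqrt (by simp) (nonneg_isSelfAdjoint hpn), hψp,
      fc_of_idempotent hes hee (by simp)]
    simp
  have hιk : ι k₀ = root (ι p) := map_fc ι Real.continuous_sqrt (by simp)
    (nonneg_isSelfAdjoint hpn)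
  have hψE : ψ E = (1 / 2 : ℝ) • e := by
    rw [hE, map_cut ψ (by norm_num) (nonneg_isSelfAdjoint hpn), hψp, cut,
      fc_of_idempotent hes hee (by norm_num)]
    norm_num
  have hχE : χ (E * E * E) = 1 / 8 := by
    have : ψ (E * E * E) = (1 / 8 : ℝ) • e := by
      rw [map_mul, map_mul, hψE]
      simp only [smul_mul_assoc, mul_smul_comm, hee, smul_smul]
      norm_num
    simp only [χ, this, ContinuousLinearMap.smul_apply, he, InnerProductSpace.rankOne_apply,
      hξξ, one_smul]
    rw [inner_smul_right_eq_smul, hξξ]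
    simp
  set C : ℝ := 2 * (‖ι E‖ * (‖ι E‖ + 1)) with hC
  have hC0 : 0 ≤ C := by positivity
  set K : ℝ := 1 + n * (m * (m * (m * (C * (2 * m) * C)))) with hK
  have hK0 : 0 < K := by positivity
  have hη : (0 : ℝ) < 1 / (16 * K) := by positivity
  set η : ℝ := 1 / (16 * K) with hηdef
  have hKη : K * η = 1 / 16 := by rw [hηdef]; field_simp
  obtain ⟨s, v, hs, hv, h1, h2, -, h4⟩ := exists_matrix_factorization h (map_nonneg ι hEn) hιp y
    hy hyk ⟨0, by omega⟩ hη
  set p₀ : Fin (2 * m) := ⟨0, by omega⟩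
  have hsJ : ∀ j k l, ∃ x : J.carrier, ι x = s j k l ∧ ψ x * e = ψ x := by
    intro j k l
    obtain ⟨s', hs'⟩ := hs j
    have hrE : ι (root E) = root (ι E) := map_fc ι Real.continuous_sqrt (by simp)
      (nonneg_isSelfAdjoint hEn)
    refine ⟨⟨ι (root E) * s' k l, J.mul_mem_right _ _ (root E).2⟩ * k₀, ?_, ?_⟩
    · rw [hs', map_mul, Matrix.mul_diagonal, Matrix.diagonal_mul, hιk, ← hrE]
      rfl
    · rw [map_mul, hψk, mul_assoc, hee]
  have hvJ : ∀ j p k l, ∃ x : J.carrier, ι x = v j p k l ∧ e * ψ x = ψ x ∧ ψ x * e = ψ x := by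
    intro j p k l
    obtain ⟨v', hv'⟩ := hv j p
    let u : J.carrier := ⟨v' k l * ι k₀, J.mul_mem_left _ _ k₀.2⟩
    let u' : J.carrier := ⟨ι k₀ * v' k l, J.mul_mem_right _ _ k₀.2⟩
    have huu : k₀ * u = u' * k₀ := Subtype.ext (mul_assoc (ι k₀) (v' k l) (ι k₀)).symm
    refine ⟨k₀ * u, ?_, ?_, ?_⟩
    · rw [huu, hv', map_mul, Matrix.mul_diagonal, Matrix.diagonal_mul, ← hιk]
      rfl
    · rw [map_mul, hψk, ← mul_assoc, hee]
    · rw [huu, map_mul, hψk, mul_assoc, hee]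
  choose sJ hsJ hse using hsJ
  choose vJ hvJ hve hve' using hvJ
  have hstar : ∀ x, ψ x * e = ψ x → e * ψ (star x) = ψ (star x) := fun x hx => by
    rw [map_star, ← hx, star_mul, hes.star_eq, ← mul_assoc, hee]
  have hentry : ∀ (M : Matrix (Fin m) (Fin m) Q) (x : J.carrier) (k l : Fin m), ι x = M k l →
      ‖h.matEmb m M‖ < η → ‖χ x‖ ≤ η := fun M x k l hx hM =>
    (hχnorm x).trans (((congrArg norm hx).le.trans (norm_entry_le h m M k l)).trans hM.le)
  have hVsmall : ∀ j k l, ‖χ (vJ j p₀ k l)‖ * ‖χ (vJ j p₀ k l)‖ ≤ 2 * m * η := by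
    intro j k l
    have hprod : ∀ p q, χ (∑ l, vJ j p k l * star (vJ j q k l)) =
        ∑ l, χ (vJ j p k l) * star (χ (vJ j q k l)) := fun p q => by
      rw [hχsum]
      refine Finset.sum_congr rfl fun l _ => ?_
      rw [hχmul _ _ (hstar _ (hve' _ _ _ _)), hχstar]
    have hz := le_of_gram_almost_scalar hm (Matrix.of fun p l => χ (vJ j p k l))
      (z := ∑ l, χ (vJ j p₀ k l) * star (χ (vJ j p₀ k l))) (η := η) fun p q => by
        have := hentry _ ((∑ l, vJ j p k l * star (vJ j q k l)) -
          if p = q then ∑ l, vJ j p₀ k l * star (vJ j p₀ k l) else 0) k k ?_ (h2 j p q)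
        · rw [hχsub, hprod] at this
          rw [Matrix.mul_apply]
          simp only [Matrix.conjTranspose_apply, Matrix.of_apply]
          convert this using 3
          split_ifs
          · rw [hprod]
          · simp [χ]
        · rw [map_sub, map_sum, Matrix.sub_apply, Matrix.mul_apply]
          simp only [map_mul, map_star, hvJ, Matrix.star_apply]
          congr 1
          split_ifs
          · rw [map_sum, Matrix.mul_apply]
            simp only [map_mul, map_star, hvJ, Matrix.star_apply]
          · exact map_zero _
    refine le_trans ?_ hz
    have hcast : ∑ l, χ (vJ j p₀ k l) * star (χ (vJ j p₀ k l)) =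
        ((∑ l, ‖χ (vJ j p₀ k l)‖ * ‖χ (vJ j p₀ k l)‖ : ℝ) : ℂ) := by
      push_cast
      refine Finset.sum_congr rfl fun l _ => ?_
      rw [← pow_two, ← Complex.mul_conj']
      rfl
    rw [hcast, Complex.norm_real, Real.norm_of_nonneg (by positivity)]
    exact Finset.single_le_sum (f := fun l => ‖χ (vJ j p₀ k l)‖ * ‖χ (vJ j p₀ k l)‖)
      (fun i _ => by positivity) (Finset.mem_univ l)
  have hVV : ∀ j k k' l, ‖χ (vJ j p₀ k l)‖ * ‖χ (vJ j p₀ k' l)‖ ≤ 2 * m * η := fun j k k' l => by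
    nlinarith [hVsmall j k l, hVsmall j k' l,
      sq_nonneg (‖χ (vJ j p₀ k l)‖ - ‖χ (vJ j p₀ k' l)‖)]
  have hsC : ∀ j k l, ‖χ (sJ j k l)‖ ≤ C := fun j k l =>
    (hχnorm _).trans (((congrArg norm (hsJ j k l)).le.trans (norm_entry_le h m _ k l)).trans (h4 j))
  have hmain : ‖χ (E * E * E - ∑ j, ∑ b, (∑ a, sJ j ⟨0, hm⟩ a *
      ∑ l, (vJ j p₀ a l * star (vJ j p₀ b l))) * star (sJ j ⟨0, hm⟩ b))‖ ≤ η := by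
    refine hentry _ _ ⟨0, hm⟩ ⟨0, hm⟩ ?_ h1
    rw [Matrix.sub_apply, Matrix.sum_apply, Matrix.diagonal_apply_eq]
    simp only [Matrix.mul_apply, map_sub, map_sum, map_mul, map_star, hvJ, hsJ, Matrix.star_apply]
  have hterm : ∀ j a b l, ‖χ (sJ j ⟨0, hm⟩ a * (vJ j p₀ a l * star (vJ j p₀ b l)) *
      star (sJ j ⟨0, hm⟩ b))‖ ≤ C * (2 * m * η) * C := by
    intro j a b l
    rw [hχmul _ _ (hstar _ (hse _ _ _)), hχmul, hχmul _ _ (hstar _ (hve' _ _ _ _)), hχstar, hχstar,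
      norm_mul, norm_mul, norm_mul, norm_star, norm_star]
    · gcongr ?_ * ?_ * ?_
      · exact hsC _ _ _
      · exact hVV _ _ _ _
      · exact hsC _ _ _
    · rw [map_mul, ← mul_assoc, hve]
  have hsum : ‖χ (∑ j, ∑ b, (∑ a, sJ j ⟨0, hm⟩ a *
      ∑ l, (vJ j p₀ a l * star (vJ j p₀ b l))) * star (sJ j ⟨0, hm⟩ b))‖ ≤
      n * (m * (m * (m * (C * (2 * m * η) * C)))) := by
    simp only [Finset.mul_sum, Finset.sum_mul, hχsum]
    have hb : ∀ {N : ℕ} {f : Fin N → ℂ} {c : ℝ}, (∀ i, ‖f i‖ ≤ c) → ‖∑ i, f i‖ ≤ N * c :=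
      fun {N f c} hf => (norm_sum_le _ _).trans ((Finset.sum_le_sum fun i _ => hf i).trans
        (by simp))
    exact hb fun j => hb fun b => hb fun a => hb fun l => hterm j a b l
  rw [hχsub, hχE] at hmain
  have hfin := norm_le_norm_add_norm_sub' (1 / 8 : ℂ) (χ (∑ j, ∑ b, (∑ a, sJ j ⟨0, hm⟩ a *
      ∑ l, (vJ j p₀ a l * star (vJ j p₀ b l))) * star (sJ j ⟨0, hm⟩ b)))
  have h8 : ‖(1 / 8 : ℂ)‖ = 1 / 8 := by norm_num
  have : n * (m * (m * (m * (C * (2 * m * η) * C)))) + η = K * η := by rw [hK]; ring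
  linarith

end Scattered

section ApproximateUnit

variable {A : Type*} [NonUnitalCStarAlgebra A]

lemma tendsto_mul_of_closure {u : ℕ → A} (hu : ∀ k, ‖u k‖ ≤ 1) {a : A}
    (H : ∀ ε : ℝ, 0 < ε → ∃ b, ‖a - b‖ < ε ∧ Tendsto (fun k => b * u k) atTop (𝓝 b)) :
    Tendsto (fun k => a * u k) atTop (𝓝 a) := by
  rw [Metric.tendsto_atTop]
  intro ε hε
  obtain ⟨b, hb, hbt⟩ := H (ε / 3) (by positivity)
  obtain ⟨N, hN⟩ := (Metric.tendsto_atTop.1 hbt) (ε / 3) (by positivity)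
  refine ⟨N, fun k hk => ?_⟩
  have h1 := hN k hk
  rw [dist_eq_norm] at h1 ⊢
  have e : a * u k - a = (a - b) * u k + (b * u k - b) - (a - b) := by noncomm_ring
  have h2 : ‖(a - b) * u k‖ ≤ ‖a - b‖ := by
    refine (norm_mul_le _ _).trans ?_
    have := mul_le_mul_of_nonneg_left (hu k) (norm_nonneg (a - b))
    linarith
  rw [e]
  have h3 := norm_sub_le ((a - b) * u k + (b * u k - b)) (a - b)
  have h4 := norm_add_le ((a - b) * u k) (b * u k - b)
  linarith

/-- The function that is `0` below `2^{-(k+1)}`, `1` above `2^{-k}` and linear in between. -/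
noncomputable def ramp (k : ℕ) (t : ℝ) : ℝ := max 0 (min 1 (2 ^ (k + 1) * t - 1))

lemma ramp_continuous (k : ℕ) : Continuous (ramp k) := by unfold ramp; fun_prop

@[simp] lemma ramp_zero (k : ℕ) : ramp k 0 = 0 := by simp [ramp]

lemma ramp_nonneg (k : ℕ) (t : ℝ) : 0 ≤ ramp k t := le_max_left _ _

lemma ramp_le_one (k : ℕ) (t : ℝ) : ramp k t ≤ 1 := max_le zero_le_one (min_le_left _ _)

lemma ramp_eq_one {k : ℕ} {t : ℝ} (h : 1 ≤ 2 ^ k * t) : ramp k t = 1 := by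
  have : (1 : ℝ) ≤ 2 ^ (k + 1) * t - 1 := by rw [pow_succ]; linarith
  rw [ramp, min_eq_left this]; simp

lemma ramp_mul_ramp {i j : ℕ} (hij : i < j) {t : ℝ} (ht : 0 ≤ t) :
    ramp j t * ramp i t = ramp i t := by
  rcases le_or_gt 1 (2 ^ j * t) with h | h
  · rw [ramp_eq_one h, one_mul]
  · have h1 : (2 : ℝ) ^ (i + 1) ≤ 2 ^ j := pow_le_pow_right₀ (by norm_num) hij
    have h2 : (2 : ℝ) ^ (i + 1) * t ≤ 2 ^ j * t := by gcongr
    have : ramp i t = 0 := by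
      rw [ramp]
      exact max_eq_left ((min_le_right _ _).trans (by linarith))
    rw [this, mul_zero]

/-- A σ-unital C*-algebra has a sequential approximate unit `u` with `uⱼ uᵢ = uᵢ` for `i < j`. -/
lemma exists_approximate_unit (hA : SigmaUnital A) :
    ∃ u : ℕ → A, (∀ k, star (u k) = u k) ∧ (∀ k, ‖u k‖ ≤ 1) ∧
      (∀ i j, i < j → u j * u i = u i ∧ u i * u j = u i) ∧
      ∀ a, Tendsto (fun k => u k * a) atTop (𝓝 a) := by
  obtain ⟨e, he, hea⟩ := hA
  let _ := CStarAlgebra.spectralOrder A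
  have _ := CStarAlgebra.spectralOrderedRing A
  set g : ℕ → A := fun n => ((1 / 2 : ℝ) ^ n) • e n with hg
  have hgn : ∀ n, 0 ≤ g n := fun n =>
    smul_nonneg (by positivity) (nonneg_iff.1 (he n).1)
  have hgs : Summable g := by
    refine Summable.of_norm_bounded (g := fun n => (1 / 2 : ℝ) ^ n)
      (summable_geometric_of_lt_one (by norm_num) (by norm_num)) fun n => ?_
    rw [hg, norm_smul, Real.norm_of_nonneg (by positivity)]
    exact mul_le_of_le_one_right (by positivity) (he n).2
  set b : A := ∑' n, g n with hb
  have hbn : CStarNonneg b := nonneg_iff.2 (tsum_nonneg hgn)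
  set u : ℕ → A := fun k => cfcₙ (ramp k) b with hu
  have hu1 : ∀ k, ‖u k‖ ≤ 1 := fun k => fc_norm_le hbn fun t _ _ => by
    rw [abs_of_nonneg (ramp_nonneg _ _)]; exact ramp_le_one _ _
  have hus : ∀ k, star (u k) = u k := fun k => fc_star _ _
  have huu : ∀ i j, i < j → u j * u i = u i ∧ u i * u j = u i := fun i j hij => by
    constructor <;> simp only [hu] <;>
      rw [fc_mul (ramp_continuous _) (by simp) (ramp_continuous _) (by simp)] <;>
      refine fc_congr hbn fun t ht => ?_
    · exact ramp_mul_ramp hij ht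
    · rw [mul_comm]; exact ramp_mul_ramp hij ht
  have hρ : ∀ δ : ℝ, 0 < δ → Tendsto (fun k => cfcₙ (ratio δ) b * u k) atTop
      (𝓝 (cfcₙ (ratio δ) b)) := by
    intro δ hδ
    rw [tendsto_iff_norm_sub_tendsto_zero]
    have hlim : Tendsto (fun k : ℕ => (1 / 2 : ℝ) ^ k / δ) atTop (𝓝 0) := by
      simpa using (tendsto_pow_atTop_nhds_zero_of_lt_one (r := (1 / 2 : ℝ)) (by norm_num)
        (by norm_num)).div_const δ
    refine squeeze_zero (fun _ => norm_nonneg _) (fun k => ?_) hlim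
    have hc := ratio_continuous hδ
    have hr := ramp_continuous k
    simp only [hu]
    rw [fc_mul hc (by simp) hr (by simp), fc_sub (by fun_prop) (by simp) hc (by simp)]
    refine fc_norm_le hbn fun t ht _ => ?_
    have h0 := ratio_nonneg (δ := δ) ht
    rw [abs_sub_comm, abs_of_nonneg (by nlinarith [ramp_le_one k t])]
    rcases le_or_gt 1 (2 ^ k * t) with h | h
    · rw [ramp_eq_one h]; simp; positivity
    · have h1 : t ≤ (1 / 2 : ℝ) ^ k := by
        rw [one_div, inv_pow, ← one_div, le_div_iff₀ (by positivity)]; linarith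
      have h2 : ratio δ t ≤ t / δ := by
        unfold ratio; gcongr; exact le_max_right _ _
      have h3 : t / δ ≤ (1 / 2 : ℝ) ^ k / δ := by gcongr
      nlinarith [ramp_nonneg k t]
  have key : ∀ a, Tendsto (fun k => a * u k) atTop (𝓝 a) := by
    have hroot : ∀ n, Tendsto (fun k => root (g n) * u k) atTop (𝓝 (root (g n))) := by
      intro n
      have hgn' : CStarNonneg (g n) := nonneg_iff.2 (hgn n)
      have hrest : CStarNonneg (∑' k, if k = n then 0 else g k) :=
        nonneg_iff.2 (tsum_nonneg fun k => by split_ifs; exacts [le_rfl, hgn k])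
      obtain ⟨z, hz⟩ := hrest
      have hdec : b = star (root (g n)) * root (g n) + star z * z := by
        rw [root_star, root_mul_root hgn', ← hz, hb]
        exact hgs.tsum_eq_add_tsum_ite n
      refine tendsto_mul_of_closure hu1 fun ε hε => ?_
      refine ⟨root (g n) * cfcₙ (ratio (ε ^ 2 / 4)) b, ?_, ?_⟩
      · have := norm_sub_mul_ratio_sq_le hbn hdec (δ := ε ^ 2 / 4) (by positivity)
        nlinarith [norm_nonneg (root (g n) - root (g n) * cfcₙ (ratio (ε ^ 2 / 4)) b)]
      · simp only [mul_assoc]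
        exact (hρ _ (by positivity)).const_mul _
    intro a
    refine tendsto_mul_of_closure hu1 fun ε hε => ?_
    obtain ⟨N, hN⟩ := (Metric.tendsto_atTop.1 (hea a).2) ε hε
    have h1 := hN N le_rfl
    rw [dist_comm, dist_eq_norm] at h1
    refine ⟨a * e N, h1, ?_⟩
    have hgN : CStarNonneg (g N) := nonneg_iff.2 (hgn N)
    have h2 : e N = ((2 : ℝ) ^ N) • (root (g N) * root (g N)) := by
      rw [root_mul_root hgN, hg, smul_smul, ← mul_pow]; norm_num
    rw [h2]
    simp only [mul_smul_comm, smul_mul_assoc, mul_assoc]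
    exact (((hroot N).const_mul _).const_mul _).const_smul _
  refine ⟨u, hus, hu1, huu, fun a => ?_⟩
  have := (key (star a)).star
  simpa [hus] using this

end ApproximateUnit

section Blocks

/-- A sequence of pairwise orthogonal self-adjoint elements which is locally finite: the elements
annihilated by all but finitely many terms are dense. -/
structure BlockSystem (A : Type*) [NonUnitalCStarAlgebra A] where
  φ : ℕ → A
  star_φ : ∀ i, star (φ i) = φ i
  orth : ∀ i j, i ≠ j → φ i * φ j = 0
  exists_approx : ∀ (a : A) (ε : ℝ), 0 < ε → ∃ a', ‖a - a'‖ < ε ∧ ∃ N, ∀ i, N ≤ i → φ i * a' = 0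

variable {A : Type*} [NonUnitalCStarAlgebra A]

/-- `x` is annihilated, on either side, by everything that annihilates `e`. -/
def InBlock (e x : A) : Prop := ∀ c, (e * c = 0 → x * c = 0) ∧ (c * e = 0 → c * x = 0)

lemma inBlock_self (e : A) : InBlock e e := fun _ => ⟨id, id⟩

lemma InBlock.mul_left {e x : A} (hx : InBlock e x) (z : A) {y : A} (hy : InBlock e y) :
    InBlock e (x * z * y) := fun c =>
  ⟨fun h => by rw [mul_assoc, (hy c).1 h, mul_zero],
   fun h => by rw [mul_assoc, ← mul_assoc, (hx c).2 h, zero_mul]⟩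

variable (β : BlockSystem A)

/-- The algebra of bounded sequences whose `i`-th term lies in the `i`-th block. -/
noncomputable def BlockSystem.subalg : NonUnitalStarSubalgebra ℂ (lp (fun _ : ℕ => A) ∞) where
  carrier := {b | ∀ i, InBlock (β.φ i) (b i)}
  add_mem' {x y} hx hy i c := by
    have h1 := hx i c
    have h2 := hy i c
    constructor
    · intro h
      rw [lp.coeFn_add, Pi.add_apply, add_mul, h1.1 h, h2.1 h, add_zero]
    · intro h
      rw [lp.coeFn_add, Pi.add_apply, mul_add, h1.2 h, h2.2 h, add_zero]
  zero_mem' i c := by simp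
  mul_mem' {x y} hx hy i c := by
    have h1 := hx i c
    have h2 := hy i c
    constructor
    · intro h
      rw [lp.infty_coeFn_mul, Pi.mul_apply, mul_assoc, h2.1 h, mul_zero]
    · intro h
      rw [lp.infty_coeFn_mul, Pi.mul_apply, ← mul_assoc, h1.2 h, zero_mul]
  smul_mem' r x hx i c := by
    have h1 := hx i c
    constructor
    · intro h
      rw [lp.coeFn_smul, Pi.smul_apply, smul_mul_assoc, h1.1 h, smul_zero]
    · intro h
      rw [lp.coeFn_smul, Pi.smul_apply, mul_smul_comm, h1.2 h, smul_zero]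
  star_mem' {x} hx i c := by
    have h1 := hx i (star c)
    constructor
    · intro h
      have := h1.2 (by rw [← β.star_φ, ← star_mul, h, star_zero])
      rw [lp.coeFn_star, Pi.star_apply, ← star_star c, ← star_mul, this, star_zero]
    · intro h
      have := h1.1 (by rw [← β.star_φ, ← star_mul, h, star_zero])
      rw [lp.coeFn_star, Pi.star_apply, ← star_star c, ← star_mul, this, star_zero]

lemma BlockSystem.mem_subalg {b : lp (fun _ : ℕ => A) ∞} :
    b ∈ β.subalg ↔ ∀ i, InBlock (β.φ i) (b i) := Iff.rfl

lemma continuous_lp_apply (i : ℕ) : Continuous fun b : lp (fun _ : ℕ => A) ∞ => b i := by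
  refine (LipschitzWith.of_dist_le_mul (K := 1) fun x y => ?_).continuous
  rw [dist_eq_norm, dist_eq_norm, NNReal.coe_one, one_mul, ← Pi.sub_apply, ← lp.coeFn_sub]
  exact lp.norm_apply_le_norm ENNReal.top_ne_zero (x - y) i

instance BlockSystem.isClosed_subalg : IsClosed (β.subalg : Set (lp (fun _ : ℕ => A) ∞)) := by
  have : (β.subalg : Set (lp (fun _ : ℕ => A) ∞)) = ⋂ i, ⋂ c,
      {b | (β.φ i * c = 0 → b i * c = 0) ∧ (c * β.φ i = 0 → c * b i = 0)} := by
    ext b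
    simp only [SetLike.mem_coe, β.mem_subalg, InBlock, Set.mem_iInter, Set.mem_setOf_eq]
  rw [this]
  refine isClosed_iInter fun i => isClosed_iInter fun c => ?_
  have hc := continuous_lp_apply (A := A) i
  refine IsClosed.and ?_ ?_
  · by_cases h : β.φ i * c = 0
    · simp only [h, forall_const]
      exact isClosed_eq (hc.mul continuous_const) continuous_const
    · simp only [h, false_imp_iff]; exact isClosed_univ
  · by_cases h : c * β.φ i = 0
    · simp only [h, forall_const]
      exact isClosed_eq (continuous_const.mul hc) continuous_const
    · simp only [h, false_imp_iff]; exact isClosed_univ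

/-- The block algebra, as a C*-algebra. -/
def BlockSystem.Alg : Type _ := ↥β.subalg

noncomputable instance BlockSystem.cstarAlg : NonUnitalCStarAlgebra β.Alg :=
  inferInstanceAs (NonUnitalCStarAlgebra β.subalg)

/-- Evaluation of a block sequence at an index. -/
noncomputable def BlockSystem.ev (i : ℕ) : β.Alg →⋆ₙₐ[ℂ] A where
  toFun b := b.1 i
  map_smul' _ _ := rfl
  map_zero' := rfl
  map_add' _ _ := rfl
  map_mul' _ _ := rfl
  map_star' _ := rfl

/-- A bounded block sequence, as an element of the block algebra. -/
noncomputable def BlockSystem.ofFun (b : ℕ → A) (hb : ∀ i, InBlock (β.φ i) (b i)) (C : ℝ)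
    (hC : ∀ i, ‖b i‖ ≤ C) : β.Alg :=
  ⟨⟨b, memℓp_infty ⟨C, by rintro _ ⟨i, rfl⟩; exact hC i⟩⟩, hb⟩

@[simp] lemma BlockSystem.ev_ofFun (b : ℕ → A) (hb : ∀ i, InBlock (β.φ i) (b i)) (C : ℝ)
    (hC : ∀ i, ‖b i‖ ≤ C) (i : ℕ) : β.ev i (β.ofFun b hb C hC) = b i := rfl

lemma BlockSystem.inBlock_ev (b : β.Alg) (i : ℕ) : InBlock (β.φ i) (β.ev i b) := b.2 i

lemma BlockSystem.norm_ev_le (b : β.Alg) (i : ℕ) : ‖β.ev i b‖ ≤ ‖b‖ :=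
  lp.norm_apply_le_norm ENNReal.top_ne_zero b.1 i

lemma BlockSystem.norm_le (b : β.Alg) {C : ℝ} (hC : 0 ≤ C) (h : ∀ i, ‖β.ev i b‖ ≤ C) :
    ‖b‖ ≤ C := lp.norm_le_of_forall_le hC h

lemma BlockSystem.ext {b c : β.Alg} (h : ∀ i, β.ev i b = β.ev i c) : b = c :=
  Subtype.ext (lp.ext (funext h))

lemma InBlock.mul_eq_zero {i j : ℕ} (hij : i ≠ j) {x y : A} (hx : InBlock (β.φ i) x)
    (hy : InBlock (β.φ j) y) : x * y = 0 :=
  (hy _).2 ((hx _).1 (β.orth i j hij))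

/-- The sum of finitely many terms of a block sequence. -/
noncomputable def BlockSystem.partialSum (t : Finset ℕ) : β.Alg →⋆ₙₐ[ℂ] A where
  toFun b := ∑ i ∈ t, β.ev i b
  map_smul' c b := by simp [Finset.smul_sum]
  map_zero' := by simp
  map_add' b c := by simp [Finset.sum_add_distrib]
  map_mul' b c := by
    rw [Finset.sum_mul_sum]
    refine Finset.sum_congr rfl fun i hi => ?_
    rw [Finset.sum_eq_single_of_mem i hi, map_mul]
    exact fun j _ hj => InBlock.mul_eq_zero β hj.symm (β.inBlock_ev b i) (β.inBlock_ev c j)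
  map_star' b := by simp [map_star]

lemma BlockSystem.norm_partialSum_le (t : Finset ℕ) (b : β.Alg) :
    ‖β.partialSum t b‖ ≤ ‖b‖ := NonUnitalStarAlgHom.norm_apply_le _ b

lemma BlockSystem.summable_left (b : β.Alg) (a : A) : Summable fun i => β.ev i b * a := by
  rw [summable_iff_vanishing_norm]
  intro ε hε
  obtain ⟨a', ha', N, hN⟩ := β.exists_approx a (ε / (‖b‖ + 1)) (by positivity)
  refine ⟨Finset.range N, fun t ht => ?_⟩
  have : ∑ i ∈ t, β.ev i b * a = β.partialSum t b * (a - a') := by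
    rw [mul_sub]
    have h0 : β.partialSum t b * a' = 0 := by
      change (∑ i ∈ t, β.ev i b) * a' = 0
      rw [Finset.sum_mul]
      refine Finset.sum_eq_zero fun i hi => (β.inBlock_ev b i _).1 (hN i ?_)
      by_contra hlt
      exact Finset.disjoint_left.1 ht hi (Finset.mem_range.2 (not_le.1 hlt))
    rw [h0, sub_zero]
    change _ = (∑ i ∈ t, β.ev i b) * a
    rw [Finset.sum_mul]
  rw [this]
  calc ‖β.partialSum t b * (a - a')‖ ≤ ‖b‖ * ‖a - a'‖ :=
        (norm_mul_le _ _).trans (by gcongr; exact β.norm_partialSum_le t b)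
    _ ≤ (‖b‖ + 1) * ‖a - a'‖ := by gcongr; linarith
    _ < (‖b‖ + 1) * (ε / (‖b‖ + 1)) := by gcongr
    _ = ε := by field_simp

lemma BlockSystem.summable_right (b : β.Alg) (a : A) : Summable fun i => a * β.ev i b := by
  have := (β.summable_left (star b) (star a)).star
  simpa [map_star] using this

lemma BlockSystem.norm_tsum_left_le (b : β.Alg) (a : A) :
    ‖∑' i, β.ev i b * a‖ ≤ ‖b‖ * ‖a‖ := by
  refine le_of_tendsto ((β.summable_left b a).hasSum.norm) (Eventually.of_forall fun t => ?_)
  have : ∑ i ∈ t, β.ev i b * a = β.partialSum t b * a := by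
    change _ = (∑ i ∈ t, β.ev i b) * a
    rw [Finset.sum_mul]
  rw [this]
  exact (norm_mul_le _ _).trans (by gcongr; exact β.norm_partialSum_le t b)

lemma BlockSystem.norm_tsum_right_le (b : β.Alg) (a : A) :
    ‖∑' i, a * β.ev i b‖ ≤ ‖b‖ * ‖a‖ := by
  have := β.norm_tsum_left_le (star b) (star a)
  rw [norm_star, norm_star, ← norm_star (∑' i, _), tsum_star] at this
  simpa [map_star] using this

/-- The strict sum of a block sequence, as a multiplier. -/
noncomputable def BlockSystem.multiplier (b : β.Alg) : 𝓜(ℂ, A) where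
  fst := LinearMap.mkContinuous
    { toFun := fun a => ∑' i, β.ev i b * a
      map_add' := fun x y => by
        simp only [mul_add]
        exact (β.summable_left b x).tsum_add (β.summable_left b y)
      map_smul' := fun c x => by
        simp only [mul_smul_comm, RingHom.id_apply]
        exact (β.summable_left b x).tsum_const_smul c } ‖b‖ (β.norm_tsum_left_le b)
  snd := LinearMap.mkContinuous
    { toFun := fun a => ∑' i, a * β.ev i b
      map_add' := fun x y => by
        simp only [add_mul]
        exact (β.summable_right b x).tsum_add (β.summable_right b y)
      map_smul' := fun c x => by
        simp only [smul_mul_assoc, RingHom.id_apply]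
        exact (β.summable_right b x).tsum_const_smul c } ‖b‖ (β.norm_tsum_right_le b)
  central x y := by
    change (∑' i, x * β.ev i b) * y = x * ∑' i, β.ev i b * y
    rw [← (β.summable_right b x).tsum_mul_right, ← (β.summable_left b y).tsum_mul_left]
    simp only [mul_assoc]

lemma BlockSystem.multiplier_fst (b : β.Alg) (a : A) :
    (β.multiplier b).fst a = ∑' i, β.ev i b * a := rfl

lemma BlockSystem.multiplier_snd (b : β.Alg) (a : A) :
    (β.multiplier b).snd a = ∑' i, a * β.ev i b := rfl

lemma multiplier_ext {x y : 𝓜(ℂ, A)} (h : ∀ a, x.fst a = y.fst a) : x = y := by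
  have h1 : (x - y).fst = 0 := by
    ext a; simp [h a]
  have h2 := DoubleCentralizer.norm_fst (x - y)
  rw [h1, norm_zero] at h2
  exact sub_eq_zero.1 (norm_eq_zero.1 h2.symm)

/-- The strict sum of block sequences, as a homomorphism into the multiplier algebra. -/
noncomputable def BlockSystem.toMultiplier : β.Alg →⋆ₙₐ[ℂ] 𝓜(ℂ, A) where
  toFun := β.multiplier
  map_smul' c b := multiplier_ext fun a => by
    simp only [β.multiplier_fst, DoubleCentralizer.smul_fst, MonoidHom.id_apply,
      ContinuousLinearMap.smul_apply, map_smul, smul_mul_assoc]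
    exact (β.summable_left b a).tsum_const_smul c
  map_zero' := multiplier_ext fun a => by simp [β.multiplier_fst]
  map_add' b c := multiplier_ext fun a => by
    simp only [β.multiplier_fst, DoubleCentralizer.add_fst, ContinuousLinearMap.add_apply,
      map_add, add_mul]
    exact (β.summable_left b a).tsum_add (β.summable_left c a)
  map_mul' b c := multiplier_ext fun a => by
    rw [DoubleCentralizer.mul_fst, ContinuousLinearMap.mul_apply, β.multiplier_fst,
      β.multiplier_fst, β.multiplier_fst]
    refine tsum_congr fun i => ?_
    rw [← (β.summable_left c a).tsum_mul_left, tsum_eq_single i, map_mul, mul_assoc]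
    intro j hj
    rw [← mul_assoc, InBlock.mul_eq_zero β hj.symm (β.inBlock_ev b i) (β.inBlock_ev c j), zero_mul]
  map_star' b := multiplier_ext fun a => by
    rw [DoubleCentralizer.star_fst, β.multiplier_fst, β.multiplier_snd, tsum_star]
    simp [map_star]

lemma BlockSystem.toMultiplier_fst (b : β.Alg) (a : A) :
    (β.toMultiplier b).fst a = ∑' i, β.ev i b * a := rfl

/-- The truncation of a block sequence to its first `N` terms. -/
noncomputable def BlockSystem.trunc (b : β.Alg) (N : ℕ) : β.Alg :=
  β.ofFun (fun i => if i < N then β.ev i b else 0)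
    (fun i c => by
      split_ifs
      · exact β.inBlock_ev b i c
      · simp) ‖b‖
    (fun i => by
      split_ifs
      · exact β.norm_ev_le b i
      · simp)

lemma BlockSystem.ev_trunc (b : β.Alg) (N i : ℕ) :
    β.ev i (β.trunc b N) = if i < N then β.ev i b else 0 := rfl

lemma BlockSystem.toMultiplier_trunc (b : β.Alg) (N : ℕ) :
    β.toMultiplier (β.trunc b N) = ((∑ i ∈ Finset.range N, β.ev i b : A) : 𝓜(ℂ, A)) := by
  refine multiplier_ext fun a => ?_
  rw [β.toMultiplier_fst, DoubleCentralizer.coe_fst,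
    tsum_eq_sum (s := Finset.range N)]
  · change _ = (∑ i ∈ Finset.range N, β.ev i b) * a
    rw [Finset.sum_mul]
    refine Finset.sum_congr rfl fun i hi => ?_
    rw [β.ev_trunc, if_pos (Finset.mem_range.1 hi)]
  · intro i hi
    rw [β.ev_trunc, if_neg (fun h => hi (Finset.mem_range.2 h)), zero_mul]

lemma BlockSystem.trunc_tendsto {b : β.Alg} (hb : Tendsto (fun i => ‖β.ev i b‖) atTop (𝓝 0)) :
    Tendsto (fun N => β.trunc b N) atTop (𝓝 b) := by
  rw [Metric.tendsto_atTop]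
  intro ε hε
  obtain ⟨N, hN⟩ := (Metric.tendsto_atTop.1 hb) (ε / 2) (by positivity)
  refine ⟨N, fun n hn => ?_⟩
  rw [dist_eq_norm]
  refine (β.norm_le _ (by positivity : (0 : ℝ) ≤ ε / 2) fun i => ?_).trans_lt (by linarith)
  rw [map_sub, β.ev_trunc]
  split_ifs with h
  · simp; positivity
  · have := hN i (by omega)
    rw [dist_zero_right, norm_norm] at this
    rw [zero_sub, norm_neg]; exact this.le

end Blocks

section Corona

variable {A : Type*} [NonUnitalCStarAlgebra A] (β : BlockSystem A)
  {Q : Type*} [NonUnitalCStarAlgebra Q] (piQ : 𝓜(ℂ, A) →⋆ₙₐ[ℂ] Q)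

/-- The image of the block algebra in the corona algebra. -/
noncomputable def BlockSystem.toCorona : β.Alg →⋆ₙₐ[ℂ] Q := piQ.comp β.toMultiplier

lemma BlockSystem.toCorona_eq_zero
    (hker : ∀ a : A, piQ (a : 𝓜(ℂ, A)) = 0) {b : β.Alg}
    (hb : Tendsto (fun i => ‖β.ev i b‖) atTop (𝓝 0)) : β.toCorona piQ b = 0 := by
  have hc : Continuous (β.toCorona piQ) := by
    open CStarAlgebra in exact map_continuous (β.toCorona piQ)
  have h1 := (hc.tendsto b).comp (β.trunc_tendsto hb)
  have h2 : (β.toCorona piQ) ∘ (fun N => β.trunc b N) = fun _ => 0 := by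
    funext N
    change piQ (β.toMultiplier (β.trunc b N)) = 0
    rw [β.toMultiplier_trunc, hker]
  rw [h2] at h1
  exact (tendsto_nhds_unique tendsto_const_nhds h1).symm

end Corona

section Compression

variable {A : Type*} [NonUnitalCStarAlgebra A]

lemma star_mul_fst {X : 𝓜(ℂ, A)} (hX : star X = X) {e f : A} (he : star e = e)
    (hf : star f = f) : star (e * X.fst f) = f * X.fst e := by
  have h1 : star (X.fst f) = X.snd f := by
    conv_rhs => rw [← hX, DoubleCentralizer.star_snd, hf]
  rw [star_mul, he, h1, X.central]

lemma fst_mul (X : 𝓜(ℂ, A)) (a b : A) : X.fst (a * b) = X.fst a * b := by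
  have h1 : ∀ z, z * (X.fst (a * b) - X.fst a * b) = 0 := fun z => by
    rw [mul_sub, ← X.central, ← mul_assoc, ← mul_assoc, ← X.central, sub_self]
  have h2 := h1 (star (X.fst (a * b) - X.fst a * b))
  exact sub_eq_zero.1 (CStarRing.star_mul_self_eq_zero_iff _ |>.1 h2)

lemma nonneg_mul_fst (y : 𝓜(ℂ, A)) {e : A} (he : star e = e) :
    CStarNonneg (e * (star y * y).fst e) := by
  refine ⟨y.fst e, ?_⟩
  have h1 : star (y.fst e) = (star y).snd e := by rw [DoubleCentralizer.star_snd, he]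
  rw [h1, (star y).central, DoubleCentralizer.mul_fst]; rfl

variable (β : BlockSystem A)

/-- The sequence of the `φᵢ` itself, as an element of the block algebra. -/
noncomputable def BlockSystem.gen {C : ℝ} (hC : ∀ i, ‖β.φ i‖ ≤ C) : β.Alg :=
  β.ofFun β.φ (fun i => inBlock_self _) C hC

lemma BlockSystem.star_gen {C : ℝ} (hC : ∀ i, ‖β.φ i‖ ≤ C) : star (β.gen hC) = β.gen hC :=
  β.ext fun i => by rw [map_star]; exact β.star_φ i

lemma BlockSystem.tendsto_partialSum (b : β.Alg) (a : A) :
    Tendsto (fun N => β.partialSum (Finset.range N) b * a) atTop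
      (𝓝 ((β.toMultiplier b).fst a)) := by
  have := (β.summable_left b a).hasSum.tendsto_sum_nat
  refine this.congr fun N => ?_
  change _ = (∑ i ∈ Finset.range N, β.ev i b) * a
  rw [Finset.sum_mul]

lemma BlockSystem.exists_compression {C : ℝ} (hC : ∀ i, ‖β.φ i‖ ≤ C) {X : 𝓜(ℂ, A)}
    (hX : star X = X)
    (hs : Summable fun n => ‖β.φ n * X.fst (∑ i ∈ Finset.range n, β.φ i)‖) {a : β.Alg}
    (ha : ∀ i, β.ev i a = β.φ i * X.fst (β.φ i)) :
    ∃ c : A, β.toMultiplier (β.gen hC) * X * β.toMultiplier (β.gen hC) =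
      β.toMultiplier a + (c : 𝓜(ℂ, A)) := by
  set g := β.gen hC with hg
  set F : ℕ → A := fun N => ∑ i ∈ Finset.range N, β.φ i with hF
  have hFg : ∀ N, β.partialSum (Finset.range N) g = F N := fun N => rfl
  have hFs : ∀ N, star (F N) = F N := fun N => by simp [hF, β.star_φ]
  set d : ℕ → A := fun n => β.φ n * X.fst (F n) with hd
  have hds : Summable fun n => d n + star (d n) := by
    have h1 : Summable d := Summable.of_norm hs
    exact h1.add h1.star
  refine ⟨∑' n, (d n + star (d n)), multiplier_ext fun x => ?_⟩
  have key : ∀ N, F N * X.fst (F N) = β.partialSum (Finset.range N) a +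
      ∑ n ∈ Finset.range N, (d n + star (d n)) := by
    intro N
    change _ = ∑ i ∈ Finset.range N, β.ev i a + _
    induction N with
    | zero => simp [hF]
    | succ n ih =>
      have e1 : F (n + 1) = F n + β.φ n := Finset.sum_range_succ _ _
      rw [e1, Finset.sum_range_succ, Finset.sum_range_succ, map_add, add_mul, mul_add, mul_add, ih,
        ha, hd]
      dsimp only
      rw [star_mul_fst hX (β.star_φ n) (hFs n)]
      abel
  have lim1 : Tendsto (fun N => F N * X.fst (F N * x)) atTop
      (𝓝 ((β.toMultiplier g * X * β.toMultiplier g).fst x)) := by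
    have h1 := β.tendsto_partialSum g x
    have h2 := β.tendsto_partialSum g (X.fst ((β.toMultiplier g).fst x))
    simp only [hFg] at h1 h2
    have h3 : Tendsto (fun N => F N * X.fst (F N * x - (β.toMultiplier g).fst x)) atTop (𝓝 0) := by
      have h4 : Tendsto (fun N => X.fst (F N * x - (β.toMultiplier g).fst x)) atTop (𝓝 0) := by
        have := (X.fst.continuous.tendsto _).comp (h1.sub_const ((β.toMultiplier g).fst x))
        rw [sub_self, map_zero] at this
        exact this
      rw [tendsto_zero_iff_norm_tendsto_zero] at h4 ⊢
      refine squeeze_zero (fun _ => norm_nonneg _) (fun N => (norm_mul_le _ _).trans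
        (mul_le_mul_of_nonneg_right (β.norm_partialSum_le (Finset.range N) g) (norm_nonneg _))) ?_
      simpa using h4.const_mul ‖g‖
    have h5 := h3.add h2
    simp only [map_sub, mul_sub, sub_add_cancel, zero_add] at h5
    exact h5
  have lim2 : Tendsto (fun N => F N * X.fst (F N * x)) atTop
      (𝓝 ((β.toMultiplier a + ((∑' n, (d n + star (d n)) : A) : 𝓜(ℂ, A))).fst x)) := by
    have h1 := β.tendsto_partialSum a x
    have h2 := hds.hasSum.tendsto_sum_nat.mul_const x
    have h3 := h1.add h2
    refine h3.congr fun N => ?_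
    rw [← add_mul, ← key, mul_assoc]
    congr 1
    exact (fst_mul X (F N) x).symm
  exact tendsto_nhds_unique lim1 lim2

lemma BlockSystem.nonneg_of_ev {a : β.Alg} (ha : ∀ i, CStarNonneg (β.ev i a)) :
    CStarNonneg a := by
  have hsa : IsSelfAdjoint a :=
    β.ext fun i => by rw [map_star]; exact nonneg_star (ha i)
  have h1 : cfcₙ (fun t : ℝ => |t|) a = a := β.ext fun i => by
    rw [map_fc (β.ev i) continuous_abs (by simp) hsa,
      fc_congr (ha i) (g := fun t => t) fun t ht => abs_of_nonneg ht,
      fc_id (nonneg_isSelfAdjoint (ha i))]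
  rw [← h1]
  let _ := CStarAlgebra.spectralOrder β.Alg
  have _ := CStarAlgebra.spectralOrderedRing β.Alg
  exact nonneg_iff.2 (cfcₙ_nonneg fun t _ => abs_nonneg t)

end Compression

section Splitting

variable {B : Type*} [NonUnitalCStarAlgebra B] {S : Type*} [CuSemigroup S]
  (h : IsCuntzSemigroupOf B S)

lemma cls_star_mul_self_le_add {t g₀ g₁ : h.stab} (h₀ : star g₀ = g₀) (h₁ : star g₁ = g₁)
    (ht : t = t * g₀ + t * g₁) :
    h.cls (star t * t) ≤ h.cls (g₀ * (star t * t) * g₀) + h.cls (g₁ * (star t * t) * g₁) := by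
  have hswap : ∀ x : h.stab, h.cls (x * star x) ≤ h.cls (star x * x) := fun x =>
    cls_le_of_cuntzBelow h (nonneg_mul_star_self x) (nonneg_star_mul_self x)
      (cuntzBelow_star_swap x)
  have e1 : t * star t + (t * g₀ - t * g₁) * star (t * g₀ - t * g₁) =
      (t * g₀ * star (t * g₀) + t * g₀ * star (t * g₀)) +
      (t * g₁ * star (t * g₁) + t * g₁ * star (t * g₁)) := by
    conv_lhs => enter [1]; rw [ht]
    rw [star_add, star_sub]; noncomm_ring
  have hdouble : ∀ x : h.stab, CStarNonneg x → h.cls (x + x) ≤ h.cls x := fun x hx => by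
    refine cls_le_of_cuntzBelow h (nonneg_add hx hx) hx (cuntzBelow_iff.2 fun η hη => ?_)
    obtain ⟨r, hr⟩ := cuntzBelow_iff.1 (cuntzBelow_refl hx) (η / 2) (by positivity)
    refine ⟨Real.sqrt 2 • r, ?_⟩
    have e : Real.sqrt 2 • r * x * star (Real.sqrt 2 • r) - (x + x) =
        (2 : ℝ) • (r * x * star r - x) := by
      rw [star_smul, star_trivial]
      simp only [smul_mul_assoc, mul_smul_comm, smul_smul]
      rw [Real.mul_self_sqrt (by norm_num), smul_sub, two_smul ℝ x]
    rw [e, norm_smul, Real.norm_of_nonneg (by norm_num)]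
    linarith
  have hpart : ∀ g : h.stab, star g = g →
      h.cls (t * g * star (t * g) + t * g * star (t * g)) ≤ h.cls (g * (star t * t) * g) := by
    intro g hg
    refine (hdouble _ (nonneg_mul_star_self _)).trans ((hswap _).trans_eq ?_)
    rw [star_mul, hg]; simp only [mul_assoc]
  calc h.cls (star t * t) ≤ h.cls (t * star t) := by simpa using hswap (star t)
    _ ≤ h.cls (t * star t + (t * g₀ - t * g₁) * star (t * g₀ - t * g₁)) :=
        cls_le_of_cuntzBelow h (nonneg_mul_star_self _)
          (nonneg_add (nonneg_mul_star_self _) (nonneg_mul_star_self _))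
          (cuntzBelow_of_add (nonneg_mul_star_self _) (nonneg_mul_star_self _))
    _ ≤ _ := by
        rw [e1]
        exact (cls_add_le h (nonneg_add (nonneg_mul_star_self _) (nonneg_mul_star_self _))
          (nonneg_add (nonneg_mul_star_self _) (nonneg_mul_star_self _))).trans
          (add_le_add (hpart g₀ h₀) (hpart g₁ h₁))

end Splitting

section Decomposition

variable {A : Type*} [NonUnitalCStarAlgebra A]

/-- An approximate unit `0 = e₀, e₁, …` with `eⱼ eᵢ = eᵢ` for `i < j` along which `X`
is almost block tridiagonal. -/
lemma exists_quasicentral_unit (hA : SigmaUnital A) (X : 𝓜(ℂ, A)) :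
    ∃ e : ℕ → A, (∀ k, star (e k) = e k) ∧ (∀ k, ‖e k‖ ≤ 1) ∧ e 0 = 0 ∧
      (∀ i j, i < j → e j * e i = e i ∧ e i * e j = e i) ∧
      (∀ a, Tendsto (fun k => e k * a) atTop (𝓝 a)) ∧
      ∀ i j, i < j → ‖e j * X.fst (e i) - X.fst (e i)‖ ≤ (1 / 4 : ℝ) ^ j := by
  obtain ⟨u, hus, hu1, huu, hut⟩ := exists_approximate_unit hA
  have step : ∀ K n : ℕ, ∃ K', K < K' ∧
      ∀ l ≤ K, ‖u K' * X.fst (u l) - X.fst (u l)‖ ≤ (1 / 4 : ℝ) ^ n := by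
    intro K n
    have h1 : ∀ l ∈ Set.Iic K, ∀ᶠ k in atTop,
        ‖u k * X.fst (u l) - X.fst (u l)‖ ≤ (1 / 4 : ℝ) ^ n := by
      intro l _
      have := (Metric.tendsto_nhds.1 (hut (X.fst (u l)))) ((1 / 4 : ℝ) ^ n) (by positivity)
      filter_upwards [this] with k hk
      rw [dist_eq_norm] at hk
      exact hk.le
    have h2 := (Filter.eventually_all_finite (Set.finite_Iic K)).2 h1
    obtain ⟨K', hK', hK⟩ := ((eventually_gt_atTop K).and h2).exists
    exact ⟨K', hK', fun l hl => hK l hl⟩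
  choose next hnext hbd using step
  let k : ℕ → ℕ := fun n => Nat.rec 0 (fun n K => next K (n + 2)) n
  have hk : ∀ n, k (n + 1) = next (k n) (n + 2) := fun n => rfl
  have hmono : StrictMono k := strictMono_nat_of_lt_succ fun n => by rw [hk]; exact hnext _ _
  let e : ℕ → A := fun n => Nat.casesOn n 0 fun n => u (k n)
  have he : ∀ n, e (n + 1) = u (k n) := fun n => rfl
  have he0 : e 0 = 0 := rfl
  refine ⟨e, ?_, ?_, he0, ?_, ?_, ?_⟩
  · rintro (_ | n)
    · simp [he0]
    · exact hus _
  · rintro (_ | n)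
    · simp [he0]
    · exact hu1 _
  · rintro (_ | i) (_ | j) hij
    · omega
    · simp [he0]
    · omega
    · exact huu _ _ (hmono (by omega))
  · intro a
    rw [← tendsto_add_atTop_iff_nat 1]
    exact (hut a).comp hmono.tendsto_atTop
  · rintro (_ | i) (_ | j) hij
    · omega
    · simp [he0]
    · omega
    · obtain ⟨j, rfl⟩ : ∃ l, j = l + 1 := ⟨j - 1, by omega⟩
      exact hbd (k j) (j + 2) (k i) (hmono.monotone (by omega))

/-- The blocks `e_{2i+σ+1} - e_{2i+σ}` of an approximate unit. -/
noncomputable def unitBlocks {e : ℕ → A} (hs : ∀ k, star (e k) = e k)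
    (hee : ∀ i j, i < j → e j * e i = e i ∧ e i * e j = e i)
    (ht : ∀ a, Tendsto (fun k => e k * a) atTop (𝓝 a)) (σ : ℕ) : BlockSystem A where
  φ i := e (2 * i + σ + 1) - e (2 * i + σ)
  star_φ i := by rw [star_sub, hs, hs]
  orth := by
    intro i j hij
    rw [sub_mul, mul_sub, mul_sub]
    rcases lt_or_gt_of_ne hij with h | h
    · rw [(hee _ (2 * j + σ + 1) (by omega)).2, (hee _ (2 * j + σ) (by omega)).2,
        (hee _ (2 * j + σ + 1) (by omega)).2, (hee _ (2 * j + σ) (by omega)).2]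
      simp
    · rw [(hee (2 * j + σ + 1) (2 * i + σ + 1) (by omega)).1,
        (hee (2 * j + σ) (2 * i + σ + 1) (by omega)).1,
        (hee (2 * j + σ + 1) (2 * i + σ) (by omega)).1,
        (hee (2 * j + σ) (2 * i + σ) (by omega)).1]
      simp
  exists_approx a ε hε := by
    obtain ⟨N, hN⟩ := (Metric.tendsto_atTop.1 (ht a)) ε hε
    refine ⟨e N * a, ?_, N + 1, fun i hi => ?_⟩
    · have := hN N le_rfl
      rwa [dist_comm, dist_eq_norm] at this
    · rw [← mul_assoc, sub_mul, (hee N (2 * i + σ + 1) (by omega)).1,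
        (hee N (2 * i + σ) (by omega)).1, sub_self, zero_mul]

/-- Every positive element of the corona algebra is controlled, in the Cuntz semigroup,
by the images of two block sequences. -/
lemma exists_block_decomposition (hA : SigmaUnital A) {Q : Type*} [NonUnitalCStarAlgebra Q]
    {S : Type*} [CuSemigroup S] (h : IsCuntzSemigroupOf Q S) (piQ : 𝓜(ℂ, A) →⋆ₙₐ[ℂ] Q)
    (hsurj : Function.Surjective piQ) (hker : ∀ a : A, piQ (a : 𝓜(ℂ, A)) = 0) {T : Q}
    (hT : CStarNonneg T) :
    ∃ β : Fin 2 → BlockSystem A, ∃ a : ∀ σ, (β σ).Alg, (∀ σ, CStarNonneg (a σ)) ∧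
      (∀ σ, h.clsA ((β σ).toCorona piQ (a σ)) ≤ h.clsA T) ∧
      h.clsA T ≤ ∑ σ, h.clsA ((β σ).toCorona piQ (a σ)) := by
  obtain ⟨t, rfl⟩ := hT
  obtain ⟨y, rfl⟩ := hsurj t
  set X := star y * y with hX
  have hXs : star X = X := by simp [hX]
  obtain ⟨e, hs, h1, h0, hee, ht, hq⟩ := exists_quasicentral_unit hA X
  let β : Fin 2 → BlockSystem A := fun σ => unitBlocks hs hee ht σ
  have hφ : ∀ σ i, (β σ).φ i = e (2 * i + σ + 1) - e (2 * i + σ) := fun _ _ => rfl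
  have hC : ∀ σ i, ‖(β σ).φ i‖ ≤ 2 := fun σ i => by
    rw [hφ]
    exact (norm_sub_le _ _).trans (by linarith [h1 (2 * i + σ + 1), h1 (2 * i + σ)])
  have hoff : ∀ σ i n, i < n → ‖(β σ).φ n * X.fst ((β σ).φ i)‖ ≤ 4 * (1 / 4 : ℝ) ^ n := by
    intro σ i n hin
    have hd : ∀ k, n ≤ k → (1 / 4 : ℝ) ^ k ≤ (1 / 4 : ℝ) ^ n := fun k hk =>
      pow_le_pow_of_le_one (by norm_num) (by norm_num) hk
    set E := fun p q => e q * X.fst (e p) - X.fst (e p) with hE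
    have hEb : ∀ p q, p < q → n ≤ q → ‖E p q‖ ≤ (1 / 4 : ℝ) ^ n := fun p q hpq hn =>
      (hq p q hpq).trans (hd _ hn)
    have e1 : (β σ).φ n * X.fst ((β σ).φ i) =
        (E (2 * i + σ + 1) (2 * n + σ + 1) - E (2 * i + σ) (2 * n + σ + 1)) -
        (E (2 * i + σ + 1) (2 * n + σ) - E (2 * i + σ) (2 * n + σ)) := by
      rw [hφ, hφ, map_sub]; simp only [hE]; noncomm_ring
    rw [e1]
    refine (norm_sub_le _ _).trans ?_
    have b1 := norm_sub_le (E (2 * i + σ + 1) (2 * n + σ + 1)) (E (2 * i + σ) (2 * n + σ + 1))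
    have b2 := norm_sub_le (E (2 * i + σ + 1) (2 * n + σ)) (E (2 * i + σ) (2 * n + σ))
    have c1 := hEb (2 * i + σ + 1) (2 * n + σ + 1) (by omega) (by omega)
    have c2 := hEb (2 * i + σ) (2 * n + σ + 1) (by omega) (by omega)
    have c3 := hEb (2 * i + σ + 1) (2 * n + σ) (by omega) (by omega)
    have c4 := hEb (2 * i + σ) (2 * n + σ) (by omega) (by omega)
    linarith
  have hsum : ∀ σ, Summable fun n =>
      ‖(β σ).φ n * X.fst (∑ i ∈ Finset.range n, (β σ).φ i)‖ := by
    intro σ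
    refine Summable.of_nonneg_of_le (fun _ => norm_nonneg _) (fun n => ?_)
      ((summable_geometric_of_lt_one (r := (1 / 2 : ℝ)) (by norm_num) (by norm_num)).mul_left 4)
    rw [map_sum, Finset.mul_sum]
    refine (norm_sum_le_of_le _ fun i hi => hoff σ i n (Finset.mem_range.1 hi)).trans ?_
    rw [Finset.sum_const, Finset.card_range, nsmul_eq_mul]
    have h2 : (n : ℝ) ≤ 2 ^ n := by exact_mod_cast Nat.lt_two_pow_self.le
    have h3 : (1 / 4 : ℝ) ^ n = (1 / 2) ^ n * (1 / 2) ^ n := by rw [← mul_pow]; norm_num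
    have h4 : (2 : ℝ) ^ n * (1 / 2) ^ n = 1 := by rw [← mul_pow]; norm_num
    have h5 : (0 : ℝ) ≤ (1 / 2) ^ n := by positivity
    rw [h3]
    calc (n : ℝ) * (4 * ((1 / 2) ^ n * (1 / 2) ^ n))
        ≤ 2 ^ n * (4 * ((1 / 2) ^ n * (1 / 2) ^ n)) := by
          gcongr
      _ = 4 * (1 / 2) ^ n * (2 ^ n * (1 / 2) ^ n) := by ring
      _ = 4 * (1 / 2) ^ n := by rw [h4, mul_one]
  let a : ∀ σ, (β σ).Alg := fun σ => (β σ).ofFun (fun i => (β σ).φ i * X.fst ((β σ).φ i))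
    (fun i c => ⟨fun hc => by rw [mul_assoc, ← fst_mul, hc, map_zero, mul_zero],
      fun hc => by rw [← mul_assoc, hc, zero_mul]⟩) (2 * (‖X.fst‖ * 2)) (fun i => by
      refine (norm_mul_le _ _).trans ?_
      gcongr
      · exact hC σ i
      · exact (X.fst.le_opNorm _).trans (by gcongr; exact hC σ i))
  have ha : ∀ σ i, (β σ).ev i (a σ) = (β σ).φ i * X.fst ((β σ).φ i) := fun _ _ => rfl
  set G : Fin 2 → 𝓜(ℂ, A) := fun σ => (β σ).toMultiplier ((β σ).gen (hC σ)) with hG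
  have hGs : ∀ σ, star (G σ) = G σ := fun σ => by
    simp only [hG]; rw [← map_star, (β σ).star_gen]
  have hG1 : G 0 + G 1 = 1 := by
    refine multiplier_ext fun x => ?_
    have s0 := ((β 0).summable_left ((β 0).gen (hC 0)) x).hasSum
    have s1 := ((β 1).summable_left ((β 1).gen (hC 1)) x).hasSum
    have s2 := HasSum.even_add_odd (f := fun n => (e (n + 1) - e n) * x) s0 s1
    have s3 := s2.tendsto_sum_nat
    have s4 : Tendsto (fun n => ∑ i ∈ Finset.range n, (e (i + 1) - e i) * x) atTop (𝓝 x) := by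
      refine (ht x).congr fun n => ?_
      rw [← Finset.sum_mul, Finset.sum_range_sub, h0, sub_zero]
    rw [DoubleCentralizer.add_fst, DoubleCentralizer.one_fst]
    exact tendsto_nhds_unique s3 s4
  have hcomp : ∀ σ, (β σ).toCorona piQ (a σ) = piQ (G σ) * (star (piQ y) * piQ y) * piQ (G σ) := by
    intro σ
    obtain ⟨c, hc⟩ := (β σ).exists_compression (hC σ) hXs (hsum σ) (ha σ)
    have := congrArg piQ hc
    rw [map_add, hker, add_zero] at this
    rw [← map_star, ← map_mul, ← map_mul, ← map_mul]
    exact this.symm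
  have hcls : ∀ x : Q, CStarNonneg x → h.clsA x = h.cls (amp h 1 x) := fun x hx => by
    rw [← nsmul_clsA h le_rfl hx, one_smul]
  have hann : ∀ σ, CStarNonneg (a σ) := fun σ => (β σ).nonneg_of_ev fun i => by
    rw [ha]; exact nonneg_mul_fst y ((β σ).star_φ i)
  have hgs : ∀ σ, star (amp h 1 (piQ (G σ))) = amp h 1 (piQ (G σ)) := fun σ => by
    rw [← map_star, ← map_star, hGs]
  have hclsσ : ∀ σ, h.clsA ((β σ).toCorona piQ (a σ)) = h.cls (amp h 1 (piQ (G σ)) *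
      (star (amp h 1 (piQ y)) * amp h 1 (piQ y)) * amp h 1 (piQ (G σ))) := fun σ => by
    rw [hcls _ (map_nonneg _ (hann σ)), hcomp, map_mul, map_mul, map_mul, map_star]
  refine ⟨β, a, hann, fun σ => ?_, ?_⟩
  · rw [hclsσ, hcls _ (nonneg_star_mul_self _), map_mul, map_star]
    conv_lhs => enter [2, 2]; rw [← hgs σ]
    exact cls_conj_le h (nonneg_star_mul_self _) _
  · rw [Fin.sum_univ_two, hclsσ, hclsσ, hcls _ (nonneg_star_mul_self _), map_mul, map_star]
    refine cls_star_mul_self_le_add h (hgs 0) (hgs 1) ?_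
    rw [← map_mul, ← map_mul, ← map_mul, ← map_mul, ← map_add, ← map_add, ← mul_add, hG1, mul_one]

end Decomposition

section UniformDivisibility

universe u v
variable {A : Type u} [NonUnitalCStarAlgebra A] {S : Type v} [CuSemigroup S]
  (h : IsCuntzSemigroupOf A S)

/-- Divisibility of `m [(d - ε)₊]` through `m [d]`. -/
def CutDivisible (m n : ℕ) (ε : ℝ) (d : A) : Prop :=
  ∃ y : Fin n → S, m • h.clsA (cut ε d) ≤ ∑ j, y j ∧ ∀ j, (2 * m) • y j ≤ m • h.clsA d

lemma cutDivisible_of_isWeaklyDivisible {m n : ℕ} (hm : 1 ≤ m) {d : A} (hd : CStarNonneg d)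
    (H : CuDiv.IsWeaklyDivisible (2 * m) n (m • h.clsA d)) {ε : ℝ} (hε : 0 < ε) :
    CutDivisible h m n ε d := by
  refine H _ ?_
  rw [nsmul_clsA h hm hd, nsmul_clsA h hm (cut_nonneg hd ε),
    map_cut _ hε.le (nonneg_isSelfAdjoint hd)]
  exact cls_cut_waybelow h (map_nonneg _ hd) hε

/-- A diagonal argument makes the divisibility constants of a block sequence independent of
the size of the cut-down, for all but finitely many blocks. -/
lemma BlockSystem.exists_eventually_cutDivisible (β : BlockSystem A) {a : β.Alg}
    (ha : CStarNonneg a)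
    (hdiv : ∀ a : ℕ → A, (∀ i, CStarNonneg (a i)) → (∀ i j, i ≠ j → a i * a j = 0) →
      ∃ m n : ℕ, 1 ≤ m ∧ 1 ≤ n ∧
        ∀ i, CuDiv.IsWeaklyDivisible (2 * m) n (m • h.clsA (a i))) :
    ∃ m n : ℕ, 1 ≤ m ∧ 1 ≤ n ∧ ∀ ε : ℝ, 0 < ε →
      ∀ᶠ i in atTop, CutDivisible h m n ε (β.ev i (cut ε a)) := by
  by_contra! hcon
  have hbad : ∀ k : ℕ, ∃ ε : ℝ, 0 < ε ∧ ∃ᶠ i in atTop,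
      ¬ CutDivisible h (k.unpair.1 + 1) (k.unpair.2 + 1) ε (β.ev i (cut ε a)) := by
    intro k
    obtain ⟨ε, hε, hf⟩ := hcon (k.unpair.1 + 1) (k.unpair.2 + 1) (by omega) (by omega)
    exact ⟨ε, hε, hf⟩
  choose ε hε hfreq using hbad
  obtain ⟨ι, hι, hbad⟩ := extraction_forall_of_frequently hfreq
  have hnn : ∀ k, CStarNonneg (β.ev (ι k) (cut (ε k) a)) := fun k =>
    map_nonneg _ (cut_nonneg ha _)
  obtain ⟨m, n, hm, hn, H⟩ := hdiv (fun k => β.ev (ι k) (cut (ε k) a)) hnn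
    fun k l hkl => InBlock.mul_eq_zero β (hι.injective.ne hkl) (β.inBlock_ev _ _)
      (β.inBlock_ev _ _)
  refine hbad (Nat.pair (m - 1) (n - 1)) ?_
  rw [Nat.unpair_pair, Nat.sub_add_cancel hm, Nat.sub_add_cancel hn]
  exact cutDivisible_of_isWeaklyDivisible h hm (hnn _) (H _) (hε _)

end UniformDivisibility

section MatrixMap

variable {B C : Type*} [NonUnitalCStarAlgebra B] [NonUnitalCStarAlgebra C]

/-- The entrywise application of a homomorphism to square matrices. -/
noncomputable def matMap (m : ℕ) (f : B →⋆ₙₐ[ℂ] C) :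
    Matrix (Fin m) (Fin m) B →⋆ₙₐ[ℂ] Matrix (Fin m) (Fin m) C where
  toFun x := x.map f
  map_smul' c x := by ext; simp
  map_zero' := by ext; simp
  map_add' x y := by ext; simp
  map_mul' x y := by ext; simp [Matrix.mul_apply]
  map_star' x := by ext; simp [Matrix.star_apply, map_star]

@[simp] lemma matMap_apply (m : ℕ) (f : B →⋆ₙₐ[ℂ] C) (x : Matrix (Fin m) (Fin m) B)
    (k l : Fin m) : matMap m f x k l = f (x k l) := rfl

lemma matMap_diagonal (m : ℕ) (f : B →⋆ₙₐ[ℂ] C) (x : B) :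
    matMap m f (Matrix.diagonal fun _ => x) = Matrix.diagonal fun _ => f x := by
  ext k l
  rw [matMap_apply, Matrix.diagonal_apply, Matrix.diagonal_apply]
  split_ifs
  · rfl
  · exact map_zero f

end MatrixMap

section CoronaDivisibility

universe u v w x
variable {A : Type u} [NonUnitalCStarAlgebra A] {S : Type v} [CuSemigroup S]
  (h : IsCuntzSemigroupOf A S) (β : BlockSystem A)
  {Q : Type w} [NonUnitalCStarAlgebra Q] (piQ : 𝓜(ℂ, A) →⋆ₙₐ[ℂ] Q)

lemma BlockSystem.matMap_toCorona_eq_zero (hker : ∀ a : A, piQ (a : 𝓜(ℂ, A)) = 0) {m : ℕ}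
    {P : Matrix (Fin m) (Fin m) β.Alg}
    (hP : ∀ᶠ i : ℕ in atTop, ‖h.matEmb m (matMap m (β.ev i) P)‖ < 1 / ((i : ℝ) + 1)) :
    matMap m (β.toCorona piQ) P = 0 := by
  ext k l
  rw [matMap_apply, Matrix.zero_apply]
  refine β.toCorona_eq_zero piQ hker ?_
  refine squeeze_zero' (Eventually.of_forall fun _ => norm_nonneg _) ?_
    tendsto_one_div_add_atTop_nhds_zero_nat
  filter_upwards [hP] with i hi
  exact (norm_entry_le h m (matMap m (β.ev i) P) k l).trans hi.le

lemma InBlock.diagonal_mul_mul_diagonal {m : ℕ} {e x z : A} (hx : InBlock e x) (hz : InBlock e z)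
    (w : Matrix (Fin m) (Fin m) A) (k l : Fin m) :
    InBlock e ((Matrix.diagonal (fun _ => x) * w * Matrix.diagonal fun _ => z :
      Matrix (Fin m) (Fin m) A) k l) := by
  rw [Matrix.mul_diagonal, Matrix.diagonal_mul]
  exact hx.mul_left _ hz

/-- A sequence of matrices with entries in the blocks, as a matrix over the block algebra. -/
lemma BlockSystem.exists_matrix {m : ℕ} (w : ℕ → Matrix (Fin m) (Fin m) A)
    (hw : ∀ i k l, InBlock (β.φ i) (w i k l)) {C : ℝ} (hC : ∀ i, ‖h.matEmb m (w i)‖ ≤ C) :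
    ∃ W : Matrix (Fin m) (Fin m) β.Alg, ∀ i, matMap m (β.ev i) W = w i :=
  ⟨Matrix.of fun k l => β.ofFun (fun i => w i k l) (fun i => hw i k l) C
    fun i => (norm_entry_le h m (w i) k l).trans (hC i), fun _ => rfl⟩

lemma BlockSystem.ext_matrix {m : ℕ} {V W : Matrix (Fin m) (Fin m) β.Alg}
    (H : ∀ i, matMap m (β.ev i) V = matMap m (β.ev i) W) : V = W := by
  ext k l : 2
  exact β.ext fun i => congrFun (congrFun (H i) k) l

/-- Block sequences with uniform divisibility constants have divisible images in the corona. -/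
lemma BlockSystem.exists_isWeaklyDivisible_toCorona {SQ : Type x} [CuSemigroup SQ]
    (hQ : IsCuntzSemigroupOf Q SQ) (hker : ∀ a : A, piQ (a : 𝓜(ℂ, A)) = 0) {a : β.Alg}
    (ha : CStarNonneg a)
    (hdiv : ∀ a : ℕ → A, (∀ i, CStarNonneg (a i)) → (∀ i j, i ≠ j → a i * a j = 0) →
      ∃ m n : ℕ, 1 ≤ m ∧ 1 ≤ n ∧
        ∀ i, CuDiv.IsWeaklyDivisible (2 * m) n (m • h.clsA (a i))) :
    ∃ m n : ℕ, 1 ≤ m ∧ 1 ≤ n ∧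
      CuDiv.IsWeaklyDivisible (2 * m) n (m • hQ.clsA (β.toCorona piQ a)) := by
  obtain ⟨m, n, hm, hn, hgood⟩ := β.exists_eventually_cutDivisible h ha hdiv
  refine ⟨m, n, hm, hn, fun x' hx' => ?_⟩
  set Θ := β.toCorona piQ with hΘ
  have hsa := nonneg_isSelfAdjoint ha
  rw [nsmul_clsA hQ hm (map_nonneg Θ ha)] at hx' ⊢
  obtain ⟨ε₀, hε₀, hxε⟩ := exists_cut_of_waybelow hQ (map_nonneg _ (map_nonneg Θ ha)) hx'
  obtain ⟨ε, hε, rfl⟩ : ∃ ε : ℝ, 0 < ε ∧ ε₀ = ε + ε := ⟨ε₀ / 2, by positivity, by ring⟩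
  set d := cut ε a with hd
  have hdn : CStarNonneg d := cut_nonneg ha ε
  set E := cut ε d with hE
  have hEn : CStarNonneg E := cut_nonneg hdn ε
  have hxE : x' ≤ hQ.cls (amp hQ m (Θ E)) := by
    rw [hE, hd, cut_cut ha hε.le hε.le, map_cut Θ (by positivity) hsa,
      map_cut (amp hQ m) (by positivity) (nonneg_isSelfAdjoint (map_nonneg Θ ha))]
    exact hxε
  have hroot : ∀ (b : β.Alg), CStarNonneg b → ∀ i, root (β.ev i b) = β.ev i (root b) :=
    fun b hb i => (map_fc (β.ev i) Real.continuous_sqrt (by simp) (nonneg_isSelfAdjoint hb)).symm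
  let p₀ : Fin (2 * m) := ⟨0, by omega⟩
  have hex : ∀ i : ℕ, ∃ (s : Fin n → Matrix (Fin m) (Fin m) A)
      (v : Fin n → Fin (2 * m) → Matrix (Fin m) (Fin m) A),
      (∀ j, ∃ s', s j = Matrix.diagonal (fun _ => root (β.ev i E)) * s' *
        Matrix.diagonal fun _ => root (β.ev i d)) ∧
      (∀ j p, ∃ v', v j p = Matrix.diagonal (fun _ => root (β.ev i d)) * v' *
        Matrix.diagonal fun _ => root (β.ev i d)) ∧
      (CutDivisible h m n ε (β.ev i d) →
        ‖h.matEmb m ((Matrix.diagonal fun _ => β.ev i E * β.ev i E * β.ev i E) -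
          ∑ j, s j * (v j p₀ * star (v j p₀)) * star (s j))‖ < 1 / ((i : ℝ) + 1) ∧
        ∀ j p q, ‖h.matEmb m (v j p * star (v j q) -
          if p = q then v j p₀ * star (v j p₀) else 0)‖ < 1 / ((i : ℝ) + 1)) ∧
      (∀ j p, ‖h.matEmb m (v j p)‖ ≤ 2) ∧
      ∀ j, ‖h.matEmb m (s j)‖ ≤ 2 * (‖β.ev i E‖ * (‖β.ev i E‖ + 1)) := by
    intro i
    by_cases hg : CutDivisible h m n ε (β.ev i d)
    · obtain ⟨y, hy1, hy2⟩ := hg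
      have hEi : cut ε (β.ev i d) = β.ev i E :=
        (map_cut (β.ev i) hε.le (nonneg_isSelfAdjoint hdn)).symm
      rw [hEi, nsmul_clsA h hm (map_nonneg _ hEn)] at hy1
      rw [nsmul_clsA h hm (map_nonneg _ hdn)] at hy2
      obtain ⟨s, v, h1, h2, h3, h4, h5, h6⟩ := exists_matrix_factorization h
        (map_nonneg (β.ev i) hEn) (map_nonneg (β.ev i) hdn) y hy1 hy2 p₀
        (η := 1 / ((i : ℝ) + 1)) (by positivity)
      exact ⟨s, v, h1, h2, fun _ => ⟨h3, h4⟩, h5, h6⟩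
    · refine ⟨fun _ => 0, fun _ _ => 0, fun _ => ⟨0, by simp⟩, fun _ _ => ⟨0, by simp⟩,
        fun hg' => absurd hg' hg, fun _ _ => by simp, fun _ => ?_⟩
      rw [map_zero, norm_zero]; positivity
  choose s v hs hv happ hvb hsb using hex
  have hEblock : ∀ i, InBlock (β.φ i) (root (β.ev i E)) := fun i => by
    rw [hroot E hEn]; exact β.inBlock_ev _ _
  have hdblock : ∀ i, InBlock (β.φ i) (root (β.ev i d)) := fun i => by
    rw [hroot d hdn]; exact β.inBlock_ev _ _
  have hSex : ∀ j, ∃ W : Matrix (Fin m) (Fin m) β.Alg, ∀ i, matMap m (β.ev i) W = s i j := by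
    intro j
    refine β.exists_matrix h (fun i => s i j) (fun i k l => ?_)
      (C := 2 * (‖E‖ * (‖E‖ + 1))) fun i => (hsb i j).trans ?_
    · obtain ⟨s', hs'⟩ := hs i j
      rw [hs']
      exact (hEblock i).diagonal_mul_mul_diagonal (hdblock i) _ _ _
    · have := β.norm_ev_le E i
      gcongr
  have hVex : ∀ j p, ∃ W : Matrix (Fin m) (Fin m) β.Alg,
      ∀ i, matMap m (β.ev i) W = v i j p := by
    intro j p
    refine β.exists_matrix h (fun i => v i j p) (fun i k l => ?_) (C := 2) fun i => hvb i j p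
    obtain ⟨v', hv'⟩ := hv i j p
    rw [hv']
    exact (hdblock i).diagonal_mul_mul_diagonal (hdblock i) _ _ _
  choose Sm hSm using hSex
  choose V hV using hVex
  have hcube : matMap m Θ ((Matrix.diagonal fun _ => E * E * E) -
      ∑ j, Sm j * (V j p₀ * star (V j p₀)) * star (Sm j)) = 0 := by
    refine β.matMap_toCorona_eq_zero h piQ hker ?_
    filter_upwards [hgood ε hε] with i hi
    have := (happ i hi).1
    simpa only [map_sub, map_sum, map_mul, map_star, matMap_diagonal, hSm, hV] using this
  have hgram : ∀ j p q, matMap m Θ (V j p * star (V j q) -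
      if p = q then V j p₀ * star (V j p₀) else 0) = 0 := by
    intro j p q
    refine β.matMap_toCorona_eq_zero h piQ hker ?_
    filter_upwards [hgood ε hε] with i hi
    have := (happ i hi).2 j p q
    simpa only [map_sub, map_mul, map_star, hV, apply_ite (matMap m (β.ev i)), map_zero] using this
  have hfix : ∀ j p, V j p * (Matrix.diagonal fun _ => cfcₙ (ratio ε) a) = V j p := by
    intro j p
    refine β.ext_matrix fun i => ?_
    obtain ⟨v', hv'⟩ := hv i j p
    rw [map_mul, hV, matMap_diagonal, hv', mul_assoc, Matrix.diagonal_mul_diagonal]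
    congr 2
    funext _
    rw [hroot d hdn, ← map_mul]
    congr 1
    have hdr : root d = cfcₙ (fun t : ℝ => √(max (t - ε) 0)) a :=
      (cfcₙ_comp (fun t : ℝ => √t) (fun t : ℝ => max (t - ε) 0) a
        Real.continuous_sqrt.continuousOn (by simp) (cut_continuous ε).continuousOn
        (cut_zero_at hε.le) hsa).symm
    have hc : Continuous fun t : ℝ => √(max (t - ε) 0) :=
      Real.continuous_sqrt.comp (cut_continuous ε)
    rw [hdr, fc_mul hc (by rw [cut_zero_at hε.le, Real.sqrt_zero]) (ratio_continuous hε) (by simp)]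
    refine fc_congr ha fun t ht => ?_
    rcases le_or_gt ε t with hεt | hεt
    · rw [ratio_eq_one hε hεt, mul_one]
    · rw [max_eq_right (by linarith), Real.sqrt_zero, zero_mul]
  let M : Matrix (Fin m) (Fin m) β.Alg →⋆ₙₐ[ℂ] hQ.stab := (hQ.matEmb m).comp (matMap m Θ)
  have hM0 : ∀ P, matMap m Θ P = 0 → M P = 0 := fun P hP => by
    change hQ.matEmb m (matMap m Θ P) = 0
    rw [hP, map_zero]
  have hMd : ∀ b : β.Alg, M (Matrix.diagonal fun _ => b) = amp hQ m (Θ b) := fun b => by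
    change hQ.matEmb m (matMap m Θ _) = _
    rw [matMap_diagonal]; rfl
  have hcubeQ := hM0 _ hcube
  have hgramQ := fun j p q => hM0 _ (hgram j p q)
  simp only [map_sub, map_sum, map_mul, map_star, hMd] at hcubeQ
  refine ⟨fun j => hQ.cls (M (V j p₀) * star (M (V j p₀))), ?_, fun j => ?_⟩
  · set F := amp hQ m (Θ E) with hF
    have hFn : CStarNonneg F := map_nonneg _ (map_nonneg Θ hEn)
    have hF3 : CStarNonneg (F * F * F) := by
      have := nonneg_conj hFn F
      rwa [nonneg_star hFn] at this
    calc x' ≤ hQ.cls F := hxE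
      _ ≤ hQ.cls (F * F * F) := cls_le_of_cuntzBelow hQ hFn hF3 (cuntzBelow_cube hFn)
      _ = hQ.cls (∑ j, M (Sm j) * (M (V j p₀) * star (M (V j p₀))) * star (M (Sm j))) := by
          rw [sub_eq_zero.1 hcubeQ]
      _ ≤ ∑ j, hQ.cls (M (Sm j) * (M (V j p₀) * star (M (V j p₀))) * star (M (Sm j))) :=
          cls_sum_le hQ _ _ fun j _ => nonneg_conj (nonneg_mul_star_self _) _
      _ ≤ _ := Finset.sum_le_sum fun j _ => cls_conj_le hQ (nonneg_mul_star_self _) _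
  · have hL : (2 * m) • hQ.cls (M (V j p₀) * star (M (V j p₀))) =
        ∑ _p : Fin (2 * m), hQ.cls (M (V j p₀) * star (M (V j p₀))) := by simp
    rw [hL]
    refine sum_cls_le_of_approx hQ (map_nonneg _ (map_nonneg Θ ha))
      (fun _ => nonneg_mul_star_self _) fun η hη => ?_
    set L := amp hQ m (Θ (cfcₙ (rootRatio ε) a)) with hLd
    set R := amp hQ m (Θ (cfcₙ (ratio ε) a)) with hR
    have hLs : star L = L := by rw [hLd, ← map_star, ← map_star, fc_star]
    have hRs : star R = R := by rw [hR, ← map_star, ← map_star, fc_star]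
    have hLDL : L * amp hQ m (Θ a) * L = R * R := by
      rw [hLd, hR, ← map_mul, ← map_mul, ← map_mul, ← map_mul, ← map_mul, ← map_mul]
      congr 2
      have hrc := rootRatio_continuous hε
      have hrc' : Continuous fun t : ℝ => rootRatio ε t * t := hrc.mul continuous_id'
      conv_lhs => enter [1, 2]; rw [← fc_id hsa]
      rw [fc_mul hrc (by simp) continuous_id' rfl,
        fc_mul hrc' (by simp) hrc (by simp),
        fc_mul (ratio_continuous hε) (by simp) (ratio_continuous hε) (by simp)]
      refine fc_congr ha fun t ht => ?_
      rw [rootRatio_sq ht, sq]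
    have hfixQ : ∀ p, M (V j p) * R = M (V j p) := fun p => by
      have := congrArg M (hfix j p)
      rwa [map_mul, hMd] at this
    refine ⟨fun p => M (V j p) * L, fun p q => ?_⟩
    have e1 : M (V j p) * L * amp hQ m (Θ a) * star (M (V j q) * L) =
        M (V j p) * star (M (V j q)) := by
      calc M (V j p) * L * amp hQ m (Θ a) * star (M (V j q) * L)
          = M (V j p) * (L * amp hQ m (Θ a) * L) * star (M (V j q)) := by
            rw [star_mul, hLs]; simp only [mul_assoc]
        _ = (M (V j p) * R) * star (M (V j q) * R) := by
            rw [hLDL, star_mul, hRs]; simp only [mul_assoc]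
        _ = _ := by rw [hfixQ, hfixQ]
    have e2 := hgramQ j p q
    rw [map_sub, map_mul, map_star, apply_ite M, map_mul, map_star, map_zero] at e2
    dsimp only
    rw [e1, e2, norm_zero]
    exact hη.le

end CoronaDivisibility

section Combine

variable {A : Type*} [NonUnitalCStarAlgebra A] {S : Type*} [CuSemigroup S]

/-- Divisibility constants pass from two parts of an element to the element itself. -/
lemma exists_isWeaklyDivisible_of_parts (h : IsCuntzSemigroupOf A S) {x : S} {p : Fin 2 → S}
    (hp : ∀ σ, p σ ≤ x) (hx : x ≤ ∑ σ, p σ)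
    (hdiv : ∀ σ, ∃ m n : ℕ, 1 ≤ m ∧ 1 ≤ n ∧ CuDiv.IsWeaklyDivisible (2 * m) n (m • p σ)) :
    ∃ m n : ℕ, 1 ≤ m ∧ 1 ≤ n ∧ CuDiv.IsWeaklyDivisible (2 * m) n (m • x) := by
  choose m n hm hn hd using hdiv
  obtain ⟨N, c, hN, hc, hmc⟩ : ∃ (N : ℕ) (c : Fin 2 → ℕ), 1 ≤ N ∧ (∀ σ, 1 ≤ c σ) ∧
      ∀ σ, N = c σ * m σ :=
    ⟨m 0 * m 1, ![m 1, m 0], Nat.mul_pos (hm 0) (hm 1),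
      by simp [Fin.forall_fin_two, hm], by simp [Fin.forall_fin_two, mul_comm]⟩
  let ι := Σ k : (Σ σ : Fin 2, Fin (c σ)), Fin (n k.1)
  have _ : Nonempty ι := ⟨⟨⟨0, ⟨0, hc 0⟩⟩, ⟨0, hn 0⟩⟩⟩
  refine ⟨N, Fintype.card ι, hN, Fintype.card_pos, fun x' hx' => ?_⟩
  have hle : N • x ≤ ∑ k : (Σ σ : Fin 2, Fin (c σ)), m k.1 • p k.1 := by
    rw [Fintype.sum_sigma]
    calc N • x ≤ N • ∑ σ, p σ := nsmul_le_nsmul_right hx N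
      _ = ∑ σ, N • p σ := Finset.smul_sum
      _ = ∑ σ, ∑ _k : Fin (c σ), m σ • p σ := Finset.sum_congr rfl fun σ _ => by
          rw [Finset.sum_const, Finset.card_univ, Fintype.card_fin, ← mul_nsmul', ← hmc]
      _ ≤ _ := le_rfl
  obtain ⟨y', hy', hxy'⟩ := exists_waybelow_sum h hx' hle
  choose z hz hzx using fun k : (Σ σ : Fin 2, Fin (c σ)) => hd k.1 (y' k) (hy' k)
  refine ⟨fun j => z ((Fintype.equivFin ι).symm j).1 ((Fintype.equivFin ι).symm j).2, ?_,
    fun j => ?_⟩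
  · rw [Equiv.sum_comp (Fintype.equivFin ι).symm fun i : ι => z i.1 i.2, Fintype.sum_sigma]
    exact hxy'.trans (Finset.sum_le_sum fun k _ => hz k)
  · dsimp only
    generalize (Fintype.equivFin ι).symm j = i
    obtain ⟨k, l⟩ := i
    calc (2 * N) • z k l = c k.1 • (2 * m k.1) • z k l := by
          rw [← mul_nsmul', hmc k.1]; congr 1; ring
      _ ≤ c k.1 • m k.1 • p k.1 := nsmul_le_nsmul_right (hzx k l) _
      _ ≤ c k.1 • m k.1 • x := nsmul_le_nsmul_right (nsmul_le_nsmul_right (hp k.1) _) _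
      _ = N • x := by rw [← mul_nsmul', ← hmc]

lemma wdiv_lt_top {m n : ℕ} {x : S} (hn : 1 ≤ n) (hx : CuDiv.IsWeaklyDivisible m n x) :
    CuDiv.wdiv m x < ⊤ :=
  lt_of_le_of_lt (sInf_le ⟨n, hn, rfl, hx⟩) (ENat.natCast_lt_top n)

end Combine

end CuntzAux

/-- Proposition 5.7.  Let `A` be a σ-unital C*-algebra such that for
every sequence of pairwise orthogonal positive elements `(aᵢ)` of `A` there are `m, n`
with `m·[aᵢ]` weakly `(2m, n)`-divisible for all `i`.  Then every positive element `T`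
of the corona algebra `𝓜(A)/A` satisfies `wdiv_{2m}(m·[T]) < ∞` for some `m`; in
particular, the corona algebra is nowhere scattered.  (The corona algebra is modelled
as any C*-algebra `Q` which is the quotient of `𝓜(A)` by the canonical copy of `A`.) -/
theorem corona_nowhereScattered_of_bounded_divisibility
    (A : Type) [NonUnitalCStarAlgebra A] (S : Type) [CuSemigroup S]
    (hS : IsCuntzSemigroupOf A S)
    (hsigma : SigmaUnital A)
    (Q : Type) [NonUnitalCStarAlgebra Q] (SQ : Type) [CuSemigroup SQ]
    (hSQ : IsCuntzSemigroupOf Q SQ)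
    (piQ : 𝓜(ℂ, A) →⋆ₙₐ[ℂ] Q)
    (hsurj : Function.Surjective piQ)
    (hker : ∀ x : 𝓜(ℂ, A), piQ x = 0 ↔
      x ∈ Set.range (DoubleCentralizer.coeHom (𝕜 := ℂ) (A := A)))
    (hdiv : ∀ a : ℕ → A, (∀ i, CStarNonneg (a i)) → (∀ i j, i ≠ j → a i * a j = 0) →
      ∃ m n : ℕ, 1 ≤ m ∧ 1 ≤ n ∧
        ∀ i, CuDiv.IsWeaklyDivisible (2 * m) n (m • hS.clsA (a i))) :
    (∀ T : Q, CStarNonneg T → ∃ m : ℕ, 1 ≤ m ∧ CuDiv.wdiv (2 * m) (m • hSQ.clsA T) < ⊤) ∧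
      NowhereScattered Q := by
  have hzero : ∀ a : A, piQ (a : 𝓜(ℂ, A)) = 0 := fun a => (hker _).2 ⟨a, rfl⟩
  have hQ : ∀ T : Q, CStarNonneg T → ∃ m n : ℕ, 1 ≤ m ∧ 1 ≤ n ∧
      CuDiv.IsWeaklyDivisible (2 * m) n (m • hSQ.clsA T) := by
    intro T hT
    obtain ⟨β, a, ha, hle, hge⟩ :=
      CuntzAux.exists_block_decomposition hsigma hSQ piQ hsurj hzero hT
    exact CuntzAux.exists_isWeaklyDivisible_of_parts hSQ hle hge fun σ =>
      CuntzAux.BlockSystem.exists_isWeaklyDivisible_toCorona hS (β σ) piQ hSQ hzero (ha σ) hdiv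
  refine ⟨fun T hT => ?_, CuntzAux.nowhereScattered_of_divisible hSQ fun T hT => ?_⟩
  · obtain ⟨m, n, hm, hn, hd⟩ := hQ T hT
    exact ⟨m, hm, CuntzAux.wdiv_lt_top hn hd⟩
  · obtain ⟨m, n, hm, -, hd⟩ := hQ T hT
    exact ⟨m, n, hm, hd⟩
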